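/- arXiv:1509.00934 — 3 statements merged into one kernel-verified Lean document; each statement's English description precedes it below -/
import Mathlib

section
/- Time-change equivalence between the modified and the original Smoluchowski equations with limited aggregations: let c₀ : S → [0,∞) satisfy 0 < ⟨c₀,a⟩ < ∞ and let (cₜ) be the unique solution of the modified equation with initial condition c₀, with Aₜ = ⟨cₜ,a⟩. Then (a) the ODE s'(t) = A_{s(t)}, s(0) = 0, has a unique solution s on [0,∞); this solution is a C¹-diffeomorphism of [0,∞) onto [0,∞), and t ↦ c_{s(t)} is a solution of the original Smoluchowski equation with limited aggregations with initial condition c₀. (b) Conversely, if b is a solution of the original equation with initial condition c₀ and Bₜ = ⟨bₜ,a⟩, the ODE s'(t) = 1/B_{s(t)}, s(0) = 0, has a unique solution on [0,∞); this solution is a C¹-diffeomorphism of [0,∞) onto [0,∞), and t ↦ b_{s(t)} is the solution of the modified equation with initial condition c₀. -/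
open Set MeasureTheory intervalIntegral

/-- Total concentration of arms ⟨c,a⟩ = ∑_{(a,m) ∈ S} a · c(a,m). -/
noncomputable def armSum (c : ℕ → ℕ → ℝ) : ℝ := ∑' p : ℕ × ℕ, (p.1 : ℝ) * c p.1 p.2

/-- Gain term (with its 1/2 factor). -/
noncomputable def coagGain (c : ℕ → ℕ → ℝ) (a m : ℕ) : ℝ :=
  (1 / 2) * ∑ a' ∈ Finset.range (a + 2), ∑ m' ∈ Finset.Ico 1 m,
    ((a' : ℝ) * ((a + 2 - a' : ℕ) : ℝ)) * c a' m' * c (a + 2 - a') (m - m')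

/-- Loss term. -/
noncomputable def coagLoss (c : ℕ → ℕ → ℝ) (a m : ℕ) : ℝ :=
  ∑' p' : ℕ × ℕ, ((a : ℝ) * (p'.1 : ℝ)) * c a m * c p'.1 p'.2

/-- Solution of the modified Smoluchowski equation with limited aggregations. -/
def IsModifiedSmoluchowskiSolution (c : ℝ → ℕ → ℕ → ℝ) (c₀ : ℕ → ℕ → ℝ) : Prop :=
  (∀ t ∈ Ici (0:ℝ), ∀ a m : ℕ, 0 ≤ c t a m) ∧
  (∀ t ∈ Ici (0:ℝ), ∀ a : ℕ, c t a 0 = 0) ∧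
  (∀ a m : ℕ, ContinuousOn (fun t => c t a m) (Ici 0)) ∧
  ∀ t ∈ Ici (0:ℝ),
    (0 < sInf ((fun s => armSum (c s)) '' Icc 0 t)) ∧
    BddAbove ((fun s => armSum (c s)) '' Icc 0 t) ∧
    IntervalIntegrable (fun s => (armSum (c s)) ^ 2) volume 0 t ∧
    ∀ a m : ℕ, 1 ≤ m →
      c t a m - c₀ a m =
        ∫ s in (0:ℝ)..t, (armSum (c s))⁻¹ * (coagGain (c s) a m - coagLoss (c s) a m)

/-- Solution of the original Smoluchowski equation with limited aggregations:
same as the modified one, but without the factor ⟨c_s,a⟩⁻¹ in the integrand. -/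
def IsOriginalSmoluchowskiSolution (c : ℝ → ℕ → ℕ → ℝ) (c₀ : ℕ → ℕ → ℝ) : Prop :=
  (∀ t ∈ Ici (0:ℝ), ∀ a m : ℕ, 0 ≤ c t a m) ∧
  (∀ t ∈ Ici (0:ℝ), ∀ a : ℕ, c t a 0 = 0) ∧
  (∀ a m : ℕ, ContinuousOn (fun t => c t a m) (Ici 0)) ∧
  ∀ t ∈ Ici (0:ℝ),
    (0 < sInf ((fun s => armSum (c s)) '' Icc 0 t)) ∧
    BddAbove ((fun s => armSum (c s)) '' Icc 0 t) ∧
    IntervalIntegrable (fun s => (armSum (c s)) ^ 2) volume 0 t ∧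
    ∀ a m : ℕ, 1 ≤ m →
      c t a m - c₀ a m =
        ∫ s in (0:ℝ)..t, (coagGain (c s) a m - coagLoss (c s) a m)

/-- `s` is a C¹-diffeomorphism of [0,∞) onto itself. -/
def IsC1DiffeoOfIci0 (s : ℝ → ℝ) : Prop :=
  ContDiffOn ℝ 1 s (Ici 0) ∧ BijOn s (Ici 0) (Ici 0) ∧
    ∃ g : ℝ → ℝ, ContDiffOn ℝ 1 g (Ici 0) ∧
      (∀ t ∈ Ici (0:ℝ), g (s t) = t) ∧ (∀ t ∈ Ici (0:ℝ), s (g t) = t)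

/-- A bounded function, measurable on `[0, T]`, is integrable on every subinterval. -/
lemma intervalIntegrable_of_abs_le {f : ℝ → ℝ} {r t T C : ℝ} (hr : 0 ≤ r) (hrt : r ≤ t)
    (htT : t ≤ T) (hf : AEStronglyMeasurable f (volume.restrict (Icc 0 T)))
    (hC : ∀ s ∈ Icc 0 T, |f s| ≤ C) : IntervalIntegrable f volume r t := by
  rw [intervalIntegrable_iff_integrableOn_Icc_of_le hrt]
  have : IntegrableOn f (Icc 0 T) := by
    refine Integrable.of_bound hf C ?_
    filter_upwards [ae_restrict_mem measurableSet_Icc] with s hs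
    simpa using hC s hs
  exact this.mono_set (Icc_subset_Icc hr htT)

/-- Integral equation satisfied by the exponential of the integral of a bounded function. -/
lemma integral_mul_exp_integral {g : ℝ → ℝ} {r t K : ℝ} (hrt : r ≤ t)
    (hg : IntervalIntegrable g volume r t) (hK : ∀ s ∈ Icc r t, |g s| ≤ K) :
    ∀ s ∈ Icc r t, ∀ u ∈ Icc r t,
      ∫ σ in s..u, g σ * Real.exp (∫ τ in σ..t, g τ) =
        Real.exp (∫ τ in s..t, g τ) - Real.exp (∫ τ in u..t, g τ) := by
  intro s hs u hu
  have hK0 : 0 ≤ K := (abs_nonneg _).trans (hK r ⟨le_rfl, hrt⟩)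
  have hint : ∀ x ∈ Icc r t, ∀ y ∈ Icc r t, IntervalIntegrable g volume x y := by
    intro x hx y hy
    apply hg.mono_set
    rw [uIcc_of_le hrt]
    exact uIcc_subset_Icc hx hy
  have hlip : ∀ x ∈ Icc r t, ∀ y ∈ Icc r t, |∫ τ in x..y, g τ| ≤ K * |y - x| := by
    intro x hx y hy
    rw [← Real.norm_eq_abs]
    apply intervalIntegral.norm_integral_le_of_norm_le_const
    intro z hz
    exact hK z (uIcc_subset_Icc hx hy (uIoc_subset_uIcc hz))
  have ht : t ∈ Icc r t := ⟨hrt, le_rfl⟩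
  set E : ℝ → ℝ := fun σ => Real.exp (∫ τ in σ..t, g τ) with hE
  have hdiff : ∀ x ∈ Icc r t, ∀ y ∈ Icc r t,
      E x - E y ≤ Real.exp (K * (t - r)) * K * |x - y| := by
    intro x hx y hy
    have h1 := Real.add_one_le_exp ((∫ τ in y..t, g τ) - ∫ τ in x..t, g τ)
    have h2 : E y = E x * Real.exp ((∫ τ in y..t, g τ) - ∫ τ in x..t, g τ) := by
      simp only [hE]
      rw [← Real.exp_add]
      ring_nf
    have hpos : 0 < E x := Real.exp_pos _
    have h3 : (∫ τ in x..t, g τ) - ∫ τ in y..t, g τ = ∫ τ in x..y, g τ := by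
      rw [← intervalIntegral.integral_add_adjacent_intervals (hint x hx y hy) (hint y hy t ht)]
      ring
    have h4 : E x ≤ Real.exp (K * (t - r)) := by
      apply Real.exp_le_exp.2
      refine (le_abs_self _).trans ((hlip x hx t ht).trans ?_)
      rw [abs_of_nonneg (by linarith [hx.2])]
      nlinarith [hx.1]
    have h5 := (le_abs_self _).trans (hlip x hx y hy)
    have h6 : E x - E y ≤ E x * ∫ τ in x..y, g τ := by
      rw [h2]
      nlinarith
    calc E x - E y ≤ E x * ∫ τ in x..y, g τ := h6
      _ ≤ E x * (K * |y - x|) := by gcongr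
      _ ≤ Real.exp (K * (t - r)) * (K * |y - x|) := by gcongr
      _ = _ := by rw [abs_sub_comm]; ring
  have hsub : uIcc s u ⊆ Icc r t := uIcc_subset_Icc hs hu
  have hac : AbsolutelyContinuousOnInterval E s u := by
    have : LipschitzOnWith (Real.toNNReal (Real.exp (K * (t - r)) * K)) E (uIcc s u) := by
      apply LipschitzOnWith.of_dist_le_mul
      intro x hx y hy
      rw [Real.coe_toNNReal _ (by positivity), Real.dist_eq, Real.dist_eq, abs_le]
      have h1 := hdiff x (hsub hx) y (hsub hy)
      have h2 := hdiff y (hsub hy) x (hsub hx)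
      rw [abs_sub_comm] at h2
      constructor <;> linarith
    exact this.absolutelyContinuousOnInterval
  have := hac.integral_deriv_eq_sub
  have h2 : ∫ σ in s..u, g σ * E σ = ∫ σ in s..u, - deriv E σ := by
    apply intervalIntegral.integral_congr_ae
    filter_upwards [hg.ae_hasDerivAt_integral] with x hx hxs
    have hxm : x ∈ Icc r t := hsub (uIoc_subset_uIcc hxs)
    have h3 := hx (by rwa [uIcc_of_le hrt]) t (by rw [uIcc_of_le hrt]; exact ht)
    have h4 : HasDerivAt E (Real.exp (-∫ τ in t..x, g τ) * (- g x)) x := by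
      have := (h3.neg).exp
      refine this.congr_of_eventuallyEq (Filter.Eventually.of_forall fun y => ?_)
      simp only [hE, Pi.neg_apply]
      rw [intervalIntegral.integral_symm]
    have h5 : E x = Real.exp (-∫ τ in t..x, g τ) := by
      simp only [hE]
      rw [intervalIntegral.integral_symm]
    rw [h4.deriv, h5]
    ring
  rw [h2, intervalIntegral.integral_neg, this]
  ring

/-- A time-dependent family of profiles `k t : [0,1] → ℝ` with `D t x = ∫ y in x..1, k t y`,
evolving by an integrated Burgers-type equation. -/
structure IsArmProfile (k D : ℝ → ℝ → ℝ) (A ψ : ℝ → ℝ) : Prop where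
  mono : ∀ t, 0 ≤ t → MonotoneOn (k t) (Icc 0 1)
  cont : ∀ t, 0 ≤ t → ContinuousOn (k t) (Icc 0 1)
  zero_nonneg : ∀ t, 0 ≤ t → 0 ≤ k t 0
  apply_one : ∀ t, 0 ≤ t → k t 1 = A t
  prim_one : ∀ t, 0 ≤ t → D t 1 = 0
  tangent : ∀ t, 0 ≤ t → ∀ x ∈ Icc (0:ℝ) 1, ∀ y ∈ Icc (0:ℝ) 1,
    D t y ≤ D t x - k t x * (y - x)
  strict : ∀ t, 0 ≤ t → k t 0 < k t 1 → StrictMonoOn (k t) (Icc 0 1)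
  rigid : ∀ t, 0 ≤ t → ∀ x₁ ∈ Icc (0:ℝ) 1, ∀ x₂ ∈ Icc (0:ℝ) 1, ∀ x₃ ∈ Icc (0:ℝ) 1,
    x₁ < x₂ → x₂ < x₃ → ∀ κ : ℝ, k t x₂ - k t x₁ = κ * (x₂ - x₁) →
      k t x₃ - k t x₂ = κ * (x₃ - x₂) → κ ≤ A t
  bdd : ∀ T, 0 ≤ T → ∃ K, ∀ s ∈ Icc 0 T, A s ≤ K ∧ 0 ≤ ψ s ∧ ψ s ≤ K
  meas_weight : ∀ T, 0 ≤ T → AEStronglyMeasurable ψ (volume.restrict (Icc 0 T))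
  meas : ∀ x ∈ Icc (0:ℝ) 1, ∀ T, 0 ≤ T →
    AEStronglyMeasurable (fun s => k s x) (volume.restrict (Icc 0 T))
  evol : ∀ x ∈ Icc (0:ℝ) 1, ∀ t, 0 ≤ t →
    D t x - D 0 x = -∫ s in (0:ℝ)..t, ψ s * (A s ^ 2 / 2 + k s x ^ 2 / 2 - A s * x * k s x)

namespace IsArmProfile

variable {k D : ℝ → ℝ → ℝ} {A ψ : ℝ → ℝ}

lemma nonneg (h : IsArmProfile k D A ψ) {t x : ℝ} (ht : 0 ≤ t) (hx : x ∈ Icc (0:ℝ) 1) :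
    0 ≤ k t x :=
  (h.zero_nonneg t ht).trans (h.mono t ht (left_mem_Icc.2 zero_le_one) hx hx.1)

lemma apply_le (h : IsArmProfile k D A ψ) {t x : ℝ} (ht : 0 ≤ t) (hx : x ∈ Icc (0:ℝ) 1) :
    k t x ≤ A t :=
  h.apply_one t ht ▸ h.mono t ht hx (right_mem_Icc.2 zero_le_one) hx.2

lemma total_nonneg (h : IsArmProfile k D A ψ) {t : ℝ} (ht : 0 ≤ t) : 0 ≤ A t :=
  (h.zero_nonneg t ht).trans (h.apply_le ht (left_mem_Icc.2 zero_le_one))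

lemma meas_total (h : IsArmProfile k D A ψ) {T : ℝ} (hT : 0 ≤ T) :
    AEStronglyMeasurable A (volume.restrict (Icc 0 T)) := by
  refine (h.meas 1 (right_mem_Icc.2 zero_le_one) T hT).congr ?_
  filter_upwards [ae_restrict_mem measurableSet_Icc] with s hs
  exact h.apply_one s hs.1

/-- A common bound for all time integrands used below. -/
lemma intervalIntegrable (h : IsArmProfile k D A ψ) {r t x : ℝ} (hr : 0 ≤ r) (hrt : r ≤ t)
    (hx : x ∈ Icc (0:ℝ) 1) : IntervalIntegrable
      (fun s => ψ s * (A s ^ 2 / 2 + k s x ^ 2 / 2 - A s * x * k s x)) volume r t := by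
  have ht := hr.trans hrt
  obtain ⟨K, hK⟩ := h.bdd t ht
  have m1 := (h.meas_weight t ht).aemeasurable
  have m2 := (h.meas_total ht).aemeasurable
  have m3 := (h.meas x hx t ht).aemeasurable
  refine intervalIntegrable_of_abs_le (C := K * (K ^ 2)) hr hrt le_rfl ?_ ?_
  · exact AEMeasurable.aestronglyMeasurable (by fun_prop)
  · intro s hs
    obtain ⟨h1, h2, h3⟩ := hK s hs
    have h4 := h.total_nonneg hs.1
    have h5 := h.nonneg hs.1 hx
    have h6 := h.apply_le hs.1 hx
    rw [abs_mul, abs_of_nonneg h2]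
    refine mul_le_mul h3 ?_ (abs_nonneg _) (h4.trans h1)
    have h7 : 0 ≤ A s * k s x := mul_nonneg h4 h5
    have h8 : A s * x * k s x ≤ A s * k s x := by nlinarith [hx.2]
    have h9 : 0 ≤ A s * x * k s x := by nlinarith [hx.1]
    rw [abs_le]
    constructor <;> nlinarith [sq_nonneg (A s - k s x)]

lemma evol_sub (h : IsArmProfile k D A ψ) {r t x : ℝ} (hr : 0 ≤ r) (hrt : r ≤ t)
    (hx : x ∈ Icc (0:ℝ) 1) : D t x - D r x =
      -∫ s in r..t, ψ s * (A s ^ 2 / 2 + k s x ^ 2 / 2 - A s * x * k s x) := by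
  have h1 := h.evol x hx t (hr.trans hrt)
  have h2 := h.evol x hx r hr
  rw [← intervalIntegral.integral_add_adjacent_intervals
    (h.intervalIntegrable le_rfl hr hx) (h.intervalIntegrable hr hrt hx)] at h1
  linarith

lemma prim_anti (h : IsArmProfile k D A ψ) {r t x : ℝ} (hr : 0 ≤ r) (hrt : r ≤ t)
    (hx : x ∈ Icc (0:ℝ) 1) : D t x ≤ D r x := by
  have h1 := h.evol_sub hr hrt hx
  have : 0 ≤ ∫ s in r..t, ψ s * (A s ^ 2 / 2 + k s x ^ 2 / 2 - A s * x * k s x) := by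
    apply intervalIntegral.integral_nonneg hrt
    intro s hs
    have hs0 := hr.trans hs.1
    obtain ⟨K, hK⟩ := h.bdd s hs0
    refine mul_nonneg (hK s ⟨hs0, le_rfl⟩).2.1 ?_
    have h4 := h.total_nonneg hs0
    have h5 := h.nonneg hs0 hx
    have h8 : A s * x * k s x ≤ A s * k s x := by nlinarith [hx.2, mul_nonneg h4 h5]
    nlinarith [sq_nonneg (A s - k s x)]
  linarith

lemma prim_lipschitz (h : IsArmProfile k D A ψ) {T : ℝ} (hT : 0 ≤ T) :
    ∃ L, ∀ r t x, 0 ≤ r → r ≤ t → t ≤ T → x ∈ Icc (0:ℝ) 1 → |D t x - D r x| ≤ L * (t - r) := by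
  obtain ⟨K, hK⟩ := h.bdd T hT
  refine ⟨K * K ^ 2, fun r t x hr hrt htT hx => ?_⟩
  rw [h.evol_sub hr hrt hx, abs_neg, ← abs_of_nonneg (sub_nonneg.2 hrt),
    ← Real.norm_eq_abs]
  apply intervalIntegral.norm_integral_le_of_norm_le_const
  intro s hs
  rw [uIoc_of_le hrt] at hs
  have hs' : s ∈ Icc 0 T := ⟨hr.trans hs.1.le, hs.2.trans htT⟩
  obtain ⟨h1, h2, h3⟩ := hK s hs'
  have h4 := h.total_nonneg hs'.1
  have h5 := h.nonneg hs'.1 hx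
  have h6 := h.apply_le hs'.1 hx
  rw [Real.norm_eq_abs, abs_mul, abs_of_nonneg h2]
  refine mul_le_mul h3 ?_ (abs_nonneg _) (h4.trans h1)
  have h7 : 0 ≤ A s * k s x := mul_nonneg h4 h5
  have h8 : A s * x * k s x ≤ A s * k s x := by nlinarith [hx.2]
  have h9 : 0 ≤ A s * x * k s x := by nlinarith [hx.1]
  rw [abs_le]
  constructor <;> nlinarith [sq_nonneg (A s - k s x)]

/-- The total is nonincreasing. -/
lemma antitone (h : IsArmProfile k D A ψ) : AntitoneOn A (Ici 0) := by
  intro r hr t ht hrt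
  have key : ∀ x ∈ Ico (0:ℝ) 1, k t x ≤ A r := by
    intro x hx
    have hx' : x ∈ Icc (0:ℝ) 1 := Ico_subset_Icc_self hx
    have h1 := h.tangent t ht x hx' 1 (right_mem_Icc.2 zero_le_one)
    have h2 := h.tangent r hr 1 (right_mem_Icc.2 zero_le_one) x hx'
    rw [h.prim_one t ht] at h1
    rw [h.prim_one r hr, h.apply_one r hr] at h2
    have h3 := h.prim_anti hr hrt hx'
    have : 0 < 1 - x := by linarith [hx.2]
    nlinarith
  rw [← h.apply_one t ht]
  have hc := (h.cont t ht 1 (right_mem_Icc.2 zero_le_one)).mono Ico_subset_Icc_self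
  have hne : (nhdsWithin (1:ℝ) (Ico 0 1)).NeBot := by
    rw [← mem_closure_iff_nhdsWithin_neBot, closure_Ico zero_ne_one]
    exact right_mem_Icc.2 zero_le_one
  exact le_of_tendsto hc (Filter.eventually_of_mem self_mem_nhdsWithin key)

lemma prim_continuousOn (h : IsArmProfile k D A ψ) {x : ℝ} (hx : x ∈ Icc (0:ℝ) 1) :
    ContinuousOn (fun t => D t x) (Ici 0) := by
  intro t ht
  have ht' : (0:ℝ) ≤ t := ht
  obtain ⟨L, hL⟩ := h.prim_lipschitz (T := t + 1) (by linarith)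
  have hlip : LipschitzOnWith (Real.toNNReal L) (fun t => D t x) (Icc 0 (t + 1)) := by
    apply LipschitzOnWith.of_dist_le'
    intro a ha b hb
    rcases le_total a b with hab | hab
    · rw [dist_comm, dist_comm a, Real.dist_eq, Real.dist_eq, abs_of_nonneg (sub_nonneg.2 hab)]
      exact hL a b x ha.1 hab hb.2 hx
    · rw [Real.dist_eq, Real.dist_eq, abs_of_nonneg (sub_nonneg.2 hab)]
      exact hL b a x hb.1 hab ha.2 hx
  refine (hlip.continuousOn t ⟨ht', by linarith⟩).mono_of_mem_nhdsWithin ?_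
  have : Iio (t + 1) ∈ nhdsWithin t (Ici 0) := mem_nhdsWithin_of_mem_nhds (Iio_mem_nhds (by linarith))
  filter_upwards [this, self_mem_nhdsWithin] with s hs hs0
  exact ⟨hs0, le_of_lt hs⟩

lemma eventually_lt (h : IsArmProfile k D A ψ) {t x c : ℝ} (ht : 0 ≤ t) (hx : x ∈ Ico (0:ℝ) 1)
    (hc : k t x < c) : ∀ᶠ s in nhdsWithin t (Ici 0), k s x < c := by
  have hx' := Ico_subset_Icc_self hx
  obtain ⟨y, hy, hyc⟩ : ∃ y ∈ Ioo x 1, k t y < c := by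
    have hcx : ContinuousWithinAt (k t) (Ioo x 1) x :=
      (h.cont t ht x hx').mono fun z hz => ⟨hx.1.trans hz.1.le, hz.2.le⟩
    have hne : (nhdsWithin x (Ioo x 1)).NeBot := by
      rw [← mem_closure_iff_nhdsWithin_neBot, closure_Ioo hx.2.ne]
      exact left_mem_Icc.2 hx.2.le
    have h1 : ∀ᶠ z in nhdsWithin x (Ioo x 1), k t z < c := hcx.eventually (gt_mem_nhds hc)
    obtain ⟨y, hy⟩ := (h1.and self_mem_nhdsWithin).exists
    exact ⟨y, hy.2, hy.1⟩
  have hy' : y ∈ Icc (0:ℝ) 1 := ⟨hx.1.trans hy.1.le, hy.2.le⟩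
  have hyx : 0 < y - x := by linarith [hy.1]
  have hlim := (((h.prim_continuousOn hx').sub (h.prim_continuousOn hy')) t ht)
  have h2 : D t x - D t y < c * (y - x) := by
    have := h.tangent t ht y hy' x hx'
    nlinarith
  filter_upwards [hlim.eventually (gt_mem_nhds h2), self_mem_nhdsWithin] with s hs hs0
  have := h.tangent s hs0 x hx' y hy'
  simp only [Pi.sub_apply] at hs
  nlinarith

lemma eventually_gt (h : IsArmProfile k D A ψ) {t x c : ℝ} (ht : 0 ≤ t) (hx : x ∈ Ioc (0:ℝ) 1)
    (hc : c < k t x) : ∀ᶠ s in nhdsWithin t (Ici 0), c < k s x := by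
  have hx' := Ioc_subset_Icc_self hx
  obtain ⟨y, hy, hyc⟩ : ∃ y ∈ Ioo 0 x, c < k t y := by
    have hcx : ContinuousWithinAt (k t) (Ioo 0 x) x :=
      (h.cont t ht x hx').mono fun z hz => ⟨hz.1.le, hz.2.le.trans hx.2⟩
    have hne : (nhdsWithin x (Ioo 0 x)).NeBot := by
      rw [← mem_closure_iff_nhdsWithin_neBot, closure_Ioo hx.1.ne]
      exact right_mem_Icc.2 hx.1.le
    have h1 : ∀ᶠ z in nhdsWithin x (Ioo 0 x), c < k t z := hcx.eventually (lt_mem_nhds hc)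
    obtain ⟨y, hy⟩ := (h1.and self_mem_nhdsWithin).exists
    exact ⟨y, hy.2, hy.1⟩
  have hy' : y ∈ Icc (0:ℝ) 1 := ⟨hy.1.le, hy.2.le.trans hx.2⟩
  have hyx : 0 < x - y := by linarith [hy.2]
  have hlim := (((h.prim_continuousOn hy').sub (h.prim_continuousOn hx')) t ht)
  have h2 : c * (x - y) < D t y - D t x := by
    have := h.tangent t ht y hy' x hx'
    nlinarith
  filter_upwards [hlim.eventually (lt_mem_nhds h2), self_mem_nhdsWithin] with s hs hs0
  have := h.tangent s hs0 x hx' y hy'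
  simp only [Pi.sub_apply] at hs
  nlinarith

/-- Evolution of the tilted primitive `D s x - v * E s * (1 - x)`, where `E' = - ψ A E`. -/
lemma tilted_sub (h : IsArmProfile k D A ψ) {t : ℝ} {E : ℝ → ℝ}
    (hEc : ContinuousOn E (Icc 0 t))
    (hE : ∀ s ∈ Icc 0 t, ∀ u ∈ Icc 0 t, ∫ σ in s..u, ψ σ * A σ * E σ = E s - E u)
    (v : ℝ) {s u x : ℝ} (hs : 0 ≤ s) (hsu : s ≤ u) (hut : u ≤ t) (hx : x ∈ Icc (0:ℝ) 1) :
    IntervalIntegrable (fun σ => ψ σ * (A σ - v * E σ) ^ 2) volume s u ∧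
    (D u x - v * E u * (1 - x)) - (D s x - v * E s * (1 - x)) =
      -(1 / 2 * ∫ σ in s..u, ψ σ * (A σ - v * E σ) ^ 2) -
      1 / 2 * ∫ σ in s..u, ψ σ * ((k σ x - v * E σ) * (k σ x + v * E σ - 2 * A σ * x)) := by
  have ht : 0 ≤ t := hs.trans (hsu.trans hut)
  obtain ⟨K, hK⟩ := h.bdd t ht
  obtain ⟨C, hC⟩ := isCompact_Icc.exists_bound_of_continuousOn hEc
  have hC0 : 0 ≤ C := (norm_nonneg _).trans (hC 0 ⟨le_rfl, ht⟩)
  have hK0 : 0 ≤ K := (h.total_nonneg le_rfl).trans (hK 0 ⟨le_rfl, ht⟩).1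
  have m1 := (h.meas_weight t ht).aemeasurable
  have m2 := (h.meas_total ht).aemeasurable
  have m4 := (hEc.aestronglyMeasurable (μ := volume) measurableSet_Icc).aemeasurable
  have i1 := h.intervalIntegrable hs hsu hx
  have bA : ∀ σ ∈ Icc 0 t, |A σ| ≤ K := fun σ hσ => by
    rw [abs_of_nonneg (h.total_nonneg hσ.1)]
    exact (hK σ hσ).1
  have bψ : ∀ σ ∈ Icc 0 t, |ψ σ| ≤ K := fun σ hσ => by
    rw [abs_of_nonneg (hK σ hσ).2.1]
    exact (hK σ hσ).2.2
  have bE : ∀ σ ∈ Icc 0 t, |E σ| ≤ C := hC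
  have i2 : IntervalIntegrable (fun σ => ψ σ * A σ * E σ) volume s u := by
    refine intervalIntegrable_of_abs_le (C := K * K * C) hs hsu hut
      (AEMeasurable.aestronglyMeasurable (by fun_prop)) fun σ hσ => ?_
    rw [abs_mul, abs_mul]
    have := bA σ hσ
    have := bψ σ hσ
    have := bE σ hσ
    gcongr
  have i3 : IntervalIntegrable (fun σ => ψ σ * (A σ - v * E σ) ^ 2) volume s u := by
    refine intervalIntegrable_of_abs_le (C := K * (K + |v| * C) ^ 2) hs hsu hut
      (AEMeasurable.aestronglyMeasurable (by fun_prop)) fun σ hσ => ?_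
    have h1 : |A σ - v * E σ| ≤ K + |v| * C := by
      refine (abs_sub _ _).trans ?_
      rw [abs_mul]
      have := bA σ hσ
      have := bE σ hσ
      gcongr
    rw [abs_mul, abs_pow]
    have := bψ σ hσ
    gcongr
  refine ⟨i3, ?_⟩
  have h1 := h.evol_sub hs hsu hx
  have h2 := hE s ⟨hs, hsu.trans hut⟩ u ⟨hs.trans hsu, hut⟩
  have h3 : ∫ σ in s..u, ψ σ * ((k σ x - v * E σ) * (k σ x + v * E σ - 2 * A σ * x)) =
      2 * (∫ σ in s..u, ψ σ * (A σ ^ 2 / 2 + k σ x ^ 2 / 2 - A σ * x * k σ x)) -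
      2 * (v * (1 - x)) * (∫ σ in s..u, ψ σ * A σ * E σ) -
      ∫ σ in s..u, ψ σ * (A σ - v * E σ) ^ 2 := by
    rw [← intervalIntegral.integral_const_mul, ← intervalIntegral.integral_const_mul,
      ← intervalIntegral.integral_sub (i1.const_mul _) (i2.const_mul _),
      ← intervalIntegral.integral_sub ((i1.const_mul _).sub (i2.const_mul _)) i3]
    congr 1
    ext σ
    ring
  rw [h3, h2]
  linarith

/-- Near a time `s`, the level `v * E` of `k` stays close to its value at `s`, uniformly. -/
lemma eventually_level (h : IsArmProfile k D A ψ) {t v : ℝ} {E : ℝ → ℝ}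
    (hEc : ContinuousOn E (Icc 0 t)) {s : ℝ} (hs : 0 ≤ s) (hst : s < t) {X : ℝ → ℝ}
    (hX : ∀ u ∈ Ico s t, X u ∈ Ioo (0:ℝ) 1 ∧ k u (X u) = v * E u)
    (h0 : k s 0 < v * E s) (h1 : v * E s < A s) {ε : ℝ} (hε : 0 < ε) :
    ∀ᶠ u in nhdsWithin s (Ici s), u < t ∧ ∀ σ ∈ Icc s u,
      |k σ (X s) - v * E σ| ≤ ε ∧ |k σ (X u) - v * E σ| ≤ ε := by
  obtain ⟨hXs, hkX⟩ := hX s ⟨le_rfl, hst⟩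
  have hXs' := Ioo_subset_Icc_self hXs
  have hstrict := h.strict s hs (by rw [h.apply_one s hs]; exact h0.trans h1)
  have hcX := h.cont s hs (X s) hXs'
  obtain ⟨x₁, hx₁, hx₁k⟩ : ∃ y ∈ Ioo 0 (X s), v * E s - ε / 2 < k s y := by
    have hne : (nhdsWithin (X s) (Ioo 0 (X s))).NeBot := by
      rw [← mem_closure_iff_nhdsWithin_neBot, closure_Ioo hXs.1.ne]
      exact right_mem_Icc.2 hXs.1.le
    have hc := hcX.mono (s := Ioo 0 (X s)) fun z hz => ⟨hz.1.le, hz.2.le.trans hXs.2.le⟩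
    have h2 := hc.eventually (lt_mem_nhds (show v * E s - ε / 2 < k s (X s) by linarith))
    obtain ⟨y, hy⟩ := (h2.and self_mem_nhdsWithin).exists
    exact ⟨y, hy.2, hy.1⟩
  obtain ⟨x₂, hx₂, hx₂k⟩ : ∃ y ∈ Ioo (X s) 1, k s y < v * E s + ε / 2 := by
    have hne : (nhdsWithin (X s) (Ioo (X s) 1)).NeBot := by
      rw [← mem_closure_iff_nhdsWithin_neBot, closure_Ioo hXs.2.ne]
      exact left_mem_Icc.2 hXs.2.le
    have hc := hcX.mono (s := Ioo (X s) 1) fun z hz => ⟨hXs.1.le.trans hz.1.le, hz.2.le⟩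
    have h2 := hc.eventually (gt_mem_nhds (show k s (X s) < v * E s + ε / 2 by linarith))
    obtain ⟨y, hy⟩ := (h2.and self_mem_nhdsWithin).exists
    exact ⟨y, hy.2, hy.1⟩
  have hx₁' : x₁ ∈ Ioo (0:ℝ) 1 := ⟨hx₁.1, hx₁.2.trans hXs.2⟩
  have hx₂' : x₂ ∈ Ioo (0:ℝ) 1 := ⟨hXs.1.trans hx₂.1, hx₂.2⟩
  have hk₁ : k s x₁ < v * E s := hkX ▸ hstrict (Ioo_subset_Icc_self hx₁') hXs' hx₁.2
  have hk₂ : v * E s < k s x₂ := hkX ▸ hstrict hXs' (Ioo_subset_Icc_self hx₂') hx₂.1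
  have hle : nhdsWithin s (Ici s) ≤ nhdsWithin s (Ici 0) :=
    nhdsWithin_mono _ (Ici_subset_Ici.2 hs)
  have hEs : Filter.Tendsto (fun σ => v * E σ) (nhdsWithin s (Ici s)) (nhds (v * E s)) := by
    have : ContinuousWithinAt E (Ici s) s := by
      refine (hEc s ⟨hs, hst.le⟩).mono_of_mem_nhdsWithin ?_
      filter_upwards [mem_nhdsWithin_of_mem_nhds (Iio_mem_nhds hst), self_mem_nhdsWithin]
        with σ h2 h3
      exact ⟨hs.trans h3, le_of_lt h2⟩
    exact this.const_mul v
  obtain ⟨m₁, hm₁, hm₁'⟩ := exists_between hk₁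
  obtain ⟨m₂, hm₂, hm₂'⟩ := exists_between hk₂
  have ev : ∀ᶠ σ in nhdsWithin s (Ici s), σ < t ∧ v * E s - ε / 2 < k σ x₁ ∧ k σ x₁ < v * E σ ∧
      v * E σ < k σ x₂ ∧ k σ x₂ < v * E s + ε / 2 ∧
      v * E s - ε / 2 < v * E σ ∧ v * E σ < v * E s + ε / 2 := by
    filter_upwards [mem_nhdsWithin_of_mem_nhds (Iio_mem_nhds hst),
      hle (h.eventually_gt hs (Ioo_subset_Ioc_self hx₁') hx₁k),
      hle (h.eventually_lt hs (Ioo_subset_Ico_self hx₁') hm₁),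
      hEs.eventually (lt_mem_nhds hm₁'),
      hle (h.eventually_gt hs (Ioo_subset_Ioc_self hx₂') hm₂'),
      hEs.eventually (gt_mem_nhds hm₂),
      hle (h.eventually_lt hs (Ioo_subset_Ico_self hx₂') hx₂k),
      hEs.eventually (lt_mem_nhds (show v * E s - ε / 2 < v * E s by linarith)),
      hEs.eventually (gt_mem_nhds (show v * E s < v * E s + ε / 2 by linarith))]
      with σ a1 a2 a3 a4 a5 a6 a7 a8 a9
    exact ⟨a1, a2, a3.trans a4, a6.trans a5, a7, a8, a9⟩
  obtain ⟨w, hw, hsub⟩ := (mem_nhdsGE_iff_exists_Ico_subset' hst).1 ev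
  filter_upwards [mem_nhdsWithin_of_mem_nhds (Iio_mem_nhds hw), self_mem_nhdsWithin] with u hu1 hu2
  obtain ⟨b1, -, b3, b4, -⟩ := hsub ⟨hu2, hu1⟩
  refine ⟨b1, fun σ hσ => ?_⟩
  have hu0 : 0 ≤ u := hs.trans hu2
  have hσ0 : 0 ≤ σ := hs.trans hσ.1
  have key : ∀ y ∈ Icc x₁ x₂, |k σ y - v * E σ| ≤ ε := by
    intro y hy
    obtain ⟨c1, c2, c3, c4, c5, c6, c7⟩ := hsub ⟨hσ.1, hσ.2.trans_lt hu1⟩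
    have hy' : y ∈ Icc (0:ℝ) 1 := ⟨hx₁'.1.le.trans hy.1, hy.2.trans hx₂'.2.le⟩
    have d1 := h.mono σ hσ0 (Ioo_subset_Icc_self hx₁') hy' hy.1
    have d2 := h.mono σ hσ0 hy' (Ioo_subset_Icc_self hx₂') hy.2
    rw [abs_le]
    constructor <;> linarith
  refine ⟨key _ ⟨hx₁.2.le, hx₂.1.le⟩, key _ ?_⟩
  obtain ⟨hXu, hku⟩ := hX u ⟨hu2, b1⟩
  constructor
  · by_contra! hlt
    have := h.mono u hu0 (Ioo_subset_Icc_self hXu) (Ioo_subset_Icc_self hx₁') hlt.le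
    linarith
  · by_contra! hlt
    have := h.mono u hu0 (Ioo_subset_Icc_self hx₂') (Ioo_subset_Icc_self hXu) hlt.le
    linarith

/-- If the total drops below the level `v * E` exactly at time `t`, then the maximum at an earlier
time `r` of the tilted primitive is an explicit quadratic function of `v`. -/
lemma exists_max_tilted (h : IsArmProfile k D A ψ) {t v : ℝ} {E : ℝ → ℝ}
    (hEc : ContinuousOn E (Icc 0 t)) (hEt : E t = 1)
    (hE : ∀ s ∈ Icc 0 t, ∀ u ∈ Icc 0 t, ∫ σ in s..u, ψ σ * A σ * E σ = E s - E u)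
    {r : ℝ} (hr : 0 ≤ r) (hrt : r < t) (hv : A t ≤ v)
    (hlev : ∀ s ∈ Ico r t, k s 0 < v * E s ∧ v * E s < A s) :
    ∃ X ∈ Ioo (0:ℝ) 1, k r X = v * E r ∧
      D r X - v * E r * (1 - X) = 1 / 2 * ∫ σ in r..t, ψ σ * (A σ - v * E σ) ^ 2 := by
  have ht : 0 ≤ t := hr.trans hrt.le
  have hex : ∀ s, ∃ X, s ∈ Icc r t → (X ∈ Icc (0:ℝ) 1 ∧
      (∀ y ∈ Icc (0:ℝ) 1, D s y - v * E s * (1 - y) ≤ D s X - v * E s * (1 - X)) ∧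
      (s < t → X ∈ Ioo (0:ℝ) 1 ∧ k s X = v * E s) ∧ (s = t → X = 1)) := by
    intro s
    by_cases hs : s ∈ Icc r t
    swap
    · exact ⟨0, fun h => absurd h hs⟩
    have hs0 : 0 ≤ s := hr.trans hs.1
    rcases hs.2.lt_or_eq with hst | rfl
    · obtain ⟨l1, l2⟩ := hlev s ⟨hs.1, hst⟩
      rw [← h.apply_one s hs0] at l2
      obtain ⟨X, hX, hXk⟩ := intermediate_value_Ioo zero_le_one (h.cont s hs0) ⟨l1, l2⟩
      refine ⟨X, fun _ => ⟨Ioo_subset_Icc_self hX, fun y hy => ?_, fun _ => ⟨hX, hXk⟩,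
        fun he => absurd he hst.ne⟩⟩
      have := h.tangent s hs0 X (Ioo_subset_Icc_self hX) y hy
      rw [hXk] at this
      linarith
    · refine ⟨1, fun _ => ⟨right_mem_Icc.2 zero_le_one, fun y hy => ?_,
        fun he => absurd he (lt_irrefl _), fun _ => rfl⟩⟩
      have := h.tangent s hs0 1 (right_mem_Icc.2 zero_le_one) y hy
      rw [h.apply_one s hs0] at this
      have h1 : 0 ≤ 1 - y := by linarith [hy.2]
      rw [hEt]
      nlinarith
  choose X hX using hex
  set N : ℝ → ℝ → ℝ := fun s x => D s x - v * E s * (1 - x) with hN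
  set Q : ℝ → ℝ → ℝ := fun s u => ∫ σ in s..u, ψ σ * (A σ - v * E σ) ^ 2 with hQ
  set R : ℝ → ℝ → ℝ → ℝ := fun s u x =>
    ∫ σ in s..u, ψ σ * ((k σ x - v * E σ) * (k σ x + v * E σ - 2 * A σ * x)) with hR
  have hsub : ∀ s u x, r ≤ s → s ≤ u → u ≤ t → x ∈ Icc (0:ℝ) 1 →
      N u x - N s x = -(1 / 2 * Q s u) - 1 / 2 * R s u x := fun s u x h1 h2 h3 h4 =>
    (h.tilted_sub hEc hE v (hr.trans h1) h2 h3 h4).2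
  have hint : ∀ s u, r ≤ s → s ≤ u → u ≤ t →
      IntervalIntegrable (fun σ => ψ σ * (A σ - v * E σ) ^ 2) volume s u := fun s u h1 h2 h3 =>
    (h.tilted_sub hEc hE v (hr.trans h1) h2 h3 (left_mem_Icc.2 zero_le_one)).1
  obtain ⟨K, hK⟩ := h.bdd t ht
  have hK0 : 0 ≤ K := (h.total_nonneg le_rfl).trans (hK 0 ⟨le_rfl, ht⟩).1
  -- pointwise bound on the integrand of `R`
  have hRb : ∀ s u x ε, r ≤ s → s ≤ u → u < t → x ∈ Icc (0:ℝ) 1 →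
      (∀ σ ∈ Icc s u, |k σ x - v * E σ| ≤ ε) → |R s u x| ≤ K * (ε * (2 * K)) * (u - s) := by
    intro s u x ε h1 h2 h3 hx h4
    have hε : 0 ≤ ε := (abs_nonneg _).trans (h4 s ⟨le_rfl, h2⟩)
    rw [← abs_of_nonneg (sub_nonneg.2 h2), ← Real.norm_eq_abs]
    apply intervalIntegral.norm_integral_le_of_norm_le_const
    intro σ hσ
    rw [uIoc_of_le h2] at hσ
    have hσ' : σ ∈ Icc 0 t := ⟨hr.trans (h1.trans hσ.1.le), hσ.2.trans h3.le⟩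
    obtain ⟨l1, l2⟩ := hlev σ ⟨h1.trans hσ.1.le, hσ.2.trans_lt h3⟩
    have l3 := h.zero_nonneg σ hσ'.1
    have l4 := h.nonneg hσ'.1 hx
    have l5 := h.apply_le hσ'.1 hx
    obtain ⟨l6, l7, l8⟩ := hK σ hσ'
    have l9 := h.total_nonneg hσ'.1
    rw [Real.norm_eq_abs, abs_mul, abs_mul, abs_of_nonneg l7]
    have l10 : |k σ x + v * E σ - 2 * A σ * x| ≤ 2 * K := by
      have := mul_nonneg l9 hx.1
      have : A σ * x ≤ A σ := mul_le_of_le_one_right l9 hx.2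
      rw [abs_le]
      constructor <;> linarith
    have := h4 σ ⟨hσ.1.le, hσ.2⟩
    gcongr
  have hM : ∀ s u, r ≤ s → s ≤ u → u ≤ t →
      -(1 / 2 * Q s u) - 1 / 2 * R s u (X s) ≤ N u (X u) - N s (X s) ∧
      N u (X u) - N s (X s) ≤ -(1 / 2 * Q s u) - 1 / 2 * R s u (X u) := by
    intro s u h1 h2 h3
    obtain ⟨a1, a2, -⟩ := hX s ⟨h1, h2.trans h3⟩
    obtain ⟨b1, b2, -⟩ := hX u ⟨h1.trans h2, h3⟩
    rw [← hsub s u _ h1 h2 h3 a1, ← hsub s u _ h1 h2 h3 b1]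
    have c1 : N s (X u) ≤ N s (X s) := a2 _ b1
    have c2 : N u (X s) ≤ N u (X u) := b2 _ a1
    constructor <;> linarith
  set F : ℝ → ℝ := fun s => N s (X s) - 1 / 2 * Q s t with hF
  have hFsub : ∀ s u, r ≤ s → s ≤ u → u ≤ t →
      F u - F s = N u (X u) - N s (X s) + 1 / 2 * Q s u := by
    intro s u h1 h2 h3
    have : Q s t = Q s u + Q u t :=
      (intervalIntegral.integral_add_adjacent_intervals (hint s u h1 h2 h3)
        (hint u t (h1.trans h2) h3 le_rfl)).symm
    simp only [hF, this]
    ring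
  have hFlip : ∃ C, ∀ s u, r ≤ s → s ≤ u → u ≤ t → |F u - F s| ≤ C * (u - s) := by
    obtain ⟨C, hC⟩ := isCompact_Icc.exists_bound_of_continuousOn hEc
    have hC0 : 0 ≤ C := (norm_nonneg _).trans (hC 0 ⟨le_rfl, ht⟩)
    refine ⟨1 / 2 * (K * ((K + |v| * C) * (3 * K + |v| * C))), fun s u h1 h2 h3 => ?_⟩
    have bound : ∀ x ∈ Icc (0:ℝ) 1,
        |R s u x| ≤ K * ((K + |v| * C) * (3 * K + |v| * C)) * (u - s) := by
      intro x hx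
      rw [← abs_of_nonneg (sub_nonneg.2 h2), ← Real.norm_eq_abs]
      apply intervalIntegral.norm_integral_le_of_norm_le_const
      intro σ hσ
      rw [uIoc_of_le h2] at hσ
      have hσ' : σ ∈ Icc 0 t := ⟨hr.trans (h1.trans hσ.1.le), hσ.2.trans h3⟩
      have l4 := h.nonneg hσ'.1 hx
      have l5 := h.apply_le hσ'.1 hx
      obtain ⟨l6, l7, l8⟩ := hK σ hσ'
      have l9 := h.total_nonneg hσ'.1
      have l10 := mul_nonneg l9 hx.1
      have l11 : A σ * x ≤ A σ := mul_le_of_le_one_right l9 hx.2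
      have l12 : |v * E σ| ≤ |v| * C := by
        rw [abs_mul]
        exact mul_le_mul_of_nonneg_left (hC σ hσ') (abs_nonneg _)
      obtain ⟨l13, l14⟩ := abs_le.1 l12
      rw [Real.norm_eq_abs, abs_mul, abs_mul, abs_of_nonneg l7]
      have e1 : |k σ x - v * E σ| ≤ K + |v| * C := by
        rw [abs_le]
        constructor <;> linarith
      have e2 : |k σ x + v * E σ - 2 * A σ * x| ≤ 3 * K + |v| * C := by
        rw [abs_le]
        constructor <;> linarith
      gcongr
    obtain ⟨m1, m2⟩ := hM s u h1 h2 h3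
    obtain ⟨b1, b2⟩ := abs_le.1 (bound _ (hX s ⟨h1, h2.trans h3⟩).1)
    obtain ⟨b3, b4⟩ := abs_le.1 (bound _ (hX u ⟨h1.trans h2, h3⟩).1)
    rw [hFsub s u h1 h2 h3, abs_le]
    constructor <;> linarith
  have hFcont : ContinuousOn F (Icc r t) := by
    obtain ⟨C, hC⟩ := hFlip
    have : LipschitzOnWith (Real.toNNReal C) F (Icc r t) := by
      apply LipschitzOnWith.of_dist_le'
      intro a ha b hb
      rcases le_total a b with hab | hab
      · rw [dist_comm, dist_comm a, Real.dist_eq, Real.dist_eq, abs_of_nonneg (sub_nonneg.2 hab)]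
        exact hC a b ha.1 hab hb.2
      · rw [Real.dist_eq, Real.dist_eq, abs_of_nonneg (sub_nonneg.2 hab)]
        exact hC b a hb.1 hab ha.2
    exact this.continuousOn
  have hFderiv : ∀ s ∈ Ico r t, HasDerivWithinAt F 0 (Ici s) s := by
    intro s hs
    rw [hasDerivWithinAt_iff_isLittleO, Asymptotics.isLittleO_iff]
    intro ε hε
    have hε' : 0 < ε / (K ^ 2 + 1) := by positivity
    have hs0 : 0 ≤ s := hr.trans hs.1
    filter_upwards [h.eventually_level hEc hs0 hs.2 (v := v) (X := X)
      (fun u hu => (hX u ⟨hs.1.trans hu.1, hu.2.le⟩).2.2.1 hu.2) (hlev s hs).1 (hlev s hs).2 hε',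
      self_mem_nhdsWithin] with u hu hsu
    obtain ⟨hut, hu⟩ := hu
    have hsu' : s ≤ u := hsu
    have r1 := hRb s u (X s) _ hs.1 hsu hut (hX s ⟨hs.1, hs.2.le⟩).1 fun σ hσ => (hu σ hσ).1
    have r2 := hRb s u (X u) _ hs.1 hsu hut (hX u ⟨hs.1.trans hsu, hut.le⟩).1
      fun σ hσ => (hu σ hσ).2
    obtain ⟨m1, m2⟩ := hM s u hs.1 hsu hut.le
    have e : K * (ε / (K ^ 2 + 1) * (2 * K)) * (u - s) ≤ 2 * (ε * (u - s)) := by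
      have : K * (ε / (K ^ 2 + 1) * (2 * K)) ≤ 2 * ε := by
        have : K * (ε / (K ^ 2 + 1) * (2 * K)) = 2 * ε * (K ^ 2 / (K ^ 2 + 1)) := by
          field_simp
        rw [this]
        refine mul_le_of_le_one_right (by positivity) ?_
        rw [div_le_one (by positivity)]
        linarith
      nlinarith [sub_nonneg.2 hsu']
    obtain ⟨b1, b2⟩ := abs_le.1 (r1.trans e)
    obtain ⟨b3, b4⟩ := abs_le.1 (r2.trans e)
    rw [smul_zero, sub_zero, hFsub s u hs.1 hsu hut.le, Real.norm_eq_abs, Real.norm_eq_abs,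
      abs_of_nonneg (sub_nonneg.2 hsu'), abs_le]
    constructor <;> linarith
  have hconst := constant_of_has_deriv_right_zero hFcont hFderiv t ⟨hrt.le, le_rfl⟩
  have hXt : X t = 1 := (hX t ⟨hrt.le, le_rfl⟩).2.2.2 rfl
  have hFt : F t = 0 := by
    simp [hF, hN, hQ, hXt, h.prim_one t ht]
  obtain ⟨-, -, hXr, -⟩ := hX r ⟨le_rfl, hrt.le⟩
  obtain ⟨hXr, hkr⟩ := hXr hrt
  refine ⟨X r, hXr, hkr, ?_⟩
  have : F r = 0 := by rw [← hconst, hFt]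
  simp only [hF, hN, hQ] at this
  linarith

/-- The linear coefficient of a line supporting a parabola from below is the derivative. -/
lemma slope_eq_of_supports {p d γ η : ℝ} (hη : 0 < η) (hγ : 0 ≤ γ)
    (hsupp : ∀ e, |e| ≤ η → p * e ≤ d * e + γ * e ^ 2) : p = d := by
  by_contra hne
  have hd : 0 < |p - d| := abs_pos.2 (sub_ne_zero.2 hne)
  set τ := min (η / |p - d|) (1 / (γ + 1)) with hτ
  have hτ0 : 0 < τ := lt_min (by positivity) (by positivity)
  have hτ1 : τ * |p - d| ≤ η := by
    rw [← le_div_iff₀ hd]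
    exact min_le_left _ _
  have hτ2 : τ * (γ + 1) ≤ 1 := by
    rw [← le_div_iff₀ (by positivity)]
    exact min_le_right _ _
  have h1 := hsupp (τ * (p - d)) (by rwa [abs_mul, abs_of_pos hτ0])
  have h2 : 0 < (p - d) ^ 2 := by
    rw [← sq_abs]
    positivity
  have h3 : (p - d) ^ 2 * τ * (1 - γ * τ) ≤ 0 := by nlinarith
  have h4 : 0 < 1 - γ * τ := by linarith
  have : 0 < (p - d) ^ 2 * τ * (1 - γ * τ) := by positivity
  linarith

/-- The total number of arms does not jump down from the left. -/
lemma not_left_gap (h : IsArmProfile k D A ψ) {t δ : ℝ} (ht : 0 < t) (hδ : 0 < δ)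
    (hgap : ∀ s ∈ Ico 0 t, A t + δ ≤ A s) : False := by
  obtain ⟨K, hK⟩ := h.bdd t ht.le
  have hK0 : 0 ≤ K := (h.total_nonneg le_rfl).trans (hK 0 ⟨le_rfl, ht.le⟩).1
  have hAt := h.total_nonneg ht.le
  have mψA : AEStronglyMeasurable (fun s => ψ s * A s) (volume.restrict (Icc 0 t)) :=
    (h.meas_weight t ht.le).mul (h.meas_total ht.le)
  have hg0 : ∀ s ∈ Icc 0 t, 0 ≤ ψ s * A s := fun s hs =>
    mul_nonneg (hK s hs).2.1 (h.total_nonneg hs.1)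
  have hgK : ∀ s ∈ Icc 0 t, |ψ s * A s| ≤ K * K := fun s hs => by
    rw [abs_of_nonneg (hg0 s hs)]
    exact mul_le_mul (hK s hs).2.2 (hK s hs).1 (h.total_nonneg hs.1) hK0
  have hgi : IntervalIntegrable (fun s => ψ s * A s) volume 0 t :=
    intervalIntegrable_of_abs_le le_rfl ht.le le_rfl mψA hgK
  set E : ℝ → ℝ := fun s => Real.exp (∫ τ in s..t, ψ τ * A τ) with hEdef
  have hE := integral_mul_exp_integral ht.le hgi hgK
  have hEt : E t = 1 := by simp [hEdef]
  have hEc : ContinuousOn E (Icc 0 t) := by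
    apply Real.continuous_exp.comp_continuousOn
    have h1 := (intervalIntegrable_iff_integrableOn_Icc_of_le ht.le).1 hgi
    have := intervalIntegral.continuousOn_primitive_interval_left (a := 0) (b := t)
      (f := fun s => ψ s * A s) (by rwa [uIcc_of_le ht.le])
    rwa [uIcc_of_le ht.le] at this
  have hEpos : ∀ s, 0 < E s := fun s => Real.exp_pos _
  have hEanti : ∀ s ∈ Icc 0 t, ∀ u ∈ Icc 0 t, s ≤ u → E u ≤ E s := by
    intro s hs u hu hsu
    have h1 : 0 ≤ ∫ σ in s..u, ψ σ * A σ * E σ := by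
      apply intervalIntegral.integral_nonneg hsu
      intro σ hσ
      exact mul_nonneg (hg0 σ ⟨hs.1.trans hσ.1, hσ.2.trans hu.2⟩) (hEpos σ).le
    have h2 : ∫ σ in s..u, ψ σ * A σ * E σ = E s - E u := hE s hs u hu
    linarith
  have hE1 : ∀ s ∈ Icc 0 t, 1 ≤ E s := fun s hs =>
    hEt ▸ hEanti s hs t ⟨ht.le, le_rfl⟩ hs.2
  obtain ⟨r, ⟨hrt, hr⟩⟩ : ∃ r, r < t ∧ ∀ s ∈ Ico r t, (0 ≤ s ∧ k s 0 < A t + δ / 4 ∧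
      E s * (A t + δ / 2) < A t + δ ∧ A 0 * K * (t - s) < 1) := by
    have hmem : Icc 0 t ∈ nhdsWithin t (Iio t) := Icc_mem_nhdsLT ht
    have e1 : ∀ᶠ s in nhdsWithin t (Iio t), 0 ≤ s := by
      filter_upwards [hmem] with s hs using hs.1
    have e2 : ∀ᶠ s in nhdsWithin t (Iio t), k s 0 < A t + δ / 4 := by
      have := h.eventually_lt ht.le (x := 0) ⟨le_rfl, zero_lt_one⟩
        (c := A t + δ / 4) (by linarith [h.apply_le ht.le (left_mem_Icc.2 zero_le_one)])
      apply this.filter_mono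
      apply nhdsWithin_le_of_mem
      filter_upwards [hmem] with s hs using hs.1
    have e3 : ∀ᶠ s in nhdsWithin t (Iio t), E s * (A t + δ / 2) < A t + δ := by
      have h1 : ContinuousWithinAt (fun s => E s * (A t + δ / 2)) (Icc 0 t) t :=
        (hEc t ⟨ht.le, le_rfl⟩).mul continuousWithinAt_const
      have h2 := h1.eventually_lt_const (u := A t + δ) (by simp only [hEt]; linarith)
      exact h2.filter_mono (nhdsWithin_le_of_mem hmem)
    have e4 : ∀ᶠ s in nhdsWithin t (Iio t), A 0 * K * (t - s) < 1 := by
      have h1 : ContinuousAt (fun s => A 0 * K * (t - s)) t := by fun_prop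
      have h2 := h1.eventually_lt_const (u := 1) (by simp)
      exact h2.filter_mono nhdsWithin_le_nhds
    obtain ⟨r, hr, hrs⟩ := mem_nhdsLT_iff_exists_Ico_subset.1
      (e1.and (e2.and (e3.and e4)))
    exact ⟨r, hr, fun s hs => hrs hs⟩
  obtain ⟨hr0, -, -, hrK⟩ := hr r ⟨le_rfl, hrt⟩
  have hrI : r ∈ Icc 0 t := ⟨hr0, hrt.le⟩
  have hX : ∀ v ∈ Icc (A t + δ / 4) (A t + δ / 2), ∃ X ∈ Ioo (0:ℝ) 1, k r X = v * E r ∧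
      D r X - v * E r * (1 - X) = 1 / 2 * ∫ σ in r..t, ψ σ * (A σ - v * E σ) ^ 2 := by
    intro v hv
    refine h.exists_max_tilted hEc hEt hE hr0 hrt (by linarith [hv.1]) fun s hs => ?_
    obtain ⟨hs0, hs1, hs2, -⟩ := hr s hs
    have hs3 := hE1 s ⟨hs0, hs.2.le⟩
    have hs4 := hgap s ⟨hs0, hs.2⟩
    constructor
    · nlinarith [hv.1]
    · nlinarith [hv.2]
  choose! X hXmem hXk hXD using hX
  have hint : ∀ v, IntervalIntegrable (fun σ => ψ σ * (A σ - v * E σ) ^ 2) volume r t := fun v =>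
    (h.tilted_sub hEc hE v hr0 hrt.le le_rfl (right_mem_Icc.2 zero_le_one)).1
  have i0 : IntervalIntegrable (fun σ => ψ σ * A σ ^ 2) volume r t := by
    simpa using hint 0
  have i2 : IntervalIntegrable (fun σ => ψ σ * E σ ^ 2) volume r t := by
    have := (((hint 1).add (hint (-1))).const_mul (1 / 2)).sub i0
    refine this.congr fun σ _ => ?_
    ring
  have i1 : IntervalIntegrable (fun σ => ψ σ * (A σ * E σ)) volume r t := by
    have := ((hint (-1)).sub (hint 1)).const_mul (1 / 4)
    refine this.congr fun σ _ => ?_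
    ring
  set γ := 1 / 2 * ∫ σ in r..t, ψ σ * E σ ^ 2 with hγdef
  set β := ∫ σ in r..t, ψ σ * (A σ * E σ) with hβdef
  have hq : ∀ v, 1 / 2 * ∫ σ in r..t, ψ σ * (A σ - v * E σ) ^ 2 =
      1 / 2 * (∫ σ in r..t, ψ σ * A σ ^ 2) - β * v + γ * v ^ 2 := by
    intro v
    have : ∫ σ in r..t, ψ σ * (A σ - v * E σ) ^ 2 =
        ∫ σ in r..t, (ψ σ * A σ ^ 2 - (2 * v) * (ψ σ * (A σ * E σ))
          + v ^ 2 * (ψ σ * E σ ^ 2)) := by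
      congr 1
      ext σ
      ring
    rw [this, intervalIntegral.integral_add (i0.sub (i1.const_mul _)) (i2.const_mul _),
      intervalIntegral.integral_sub i0 (i1.const_mul _), intervalIntegral.integral_const_mul,
      intervalIntegral.integral_const_mul, hγdef, hβdef]
    ring
  have hγ0 : 0 ≤ γ := by
    rw [hγdef]
    refine mul_nonneg (by norm_num) (intervalIntegral.integral_nonneg hrt.le fun σ hσ => ?_)
    exact mul_nonneg (hK σ ⟨hr0.trans hσ.1, hσ.2⟩).2.1 (sq_nonneg _)
  have hγle : 2 * γ ≤ K * E r ^ 2 * (t - r) := by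
    have h1 : ∫ σ in r..t, ψ σ * E σ ^ 2 ≤ ∫ σ in r..t, K * E r ^ 2 := by
      apply intervalIntegral.integral_mono_on hrt.le i2 intervalIntegrable_const
      intro σ hσ
      have hσI : σ ∈ Icc 0 t := ⟨hr0.trans hσ.1, hσ.2⟩
      have h2 := hEanti r hrI σ hσI hσ.1
      have h3 := hEpos σ
      have h4 := hK σ hσI
      gcongr
      · exact h4.2.2
    rw [intervalIntegral.integral_const, smul_eq_mul] at h1
    rw [hγdef]
    linarith
  have hsupp : ∀ v ∈ Icc (A t + δ / 4) (A t + δ / 2), ∀ w ∈ Icc (A t + δ / 4) (A t + δ / 2),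
      -(E r * (1 - X v)) * (w - v) ≤ (-β + 2 * γ * v) * (w - v) + γ * (w - v) ^ 2 := by
    intro v hv w hw
    have h1 := hXD v hv
    have h2 := hXD w hw
    have h3 := h.tangent r hr0 (X w) (Ioo_subset_Icc_self (hXmem w hw)) (X v)
      (Ioo_subset_Icc_self (hXmem v hv))
    rw [hq] at h1 h2
    rw [hXk w hw] at h3
    nlinarith
  have hslope : ∀ v, A t + 5 * δ / 16 ≤ v → v ≤ A t + 7 * δ / 16 →
      -(E r * (1 - X v)) = -β + 2 * γ * v := by
    intro v hv1 hv2
    apply slope_eq_of_supports (η := δ / 16) (by positivity) hγ0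
    intro e he
    obtain ⟨he1, he2⟩ := abs_le.1 he
    have := hsupp v ⟨by linarith, by linarith⟩ (v + e) ⟨by linarith, by linarith⟩
    simpa using this
  have p1 := hslope (A t + 5 * δ / 16) (by linarith) (by linarith)
  have p2 := hslope (A t + 6 * δ / 16) (by linarith) (by linarith)
  have p3 := hslope (A t + 7 * δ / 16) (by linarith) (by linarith)
  have m1 : A t + 5 * δ / 16 ∈ Icc (A t + δ / 4) (A t + δ / 2) := ⟨by linarith, by linarith⟩
  have m2 : A t + 6 * δ / 16 ∈ Icc (A t + δ / 4) (A t + δ / 2) := ⟨by linarith, by linarith⟩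
  have m3 : A t + 7 * δ / 16 ∈ Icc (A t + δ / 4) (A t + δ / 2) := ⟨by linarith, by linarith⟩
  have k1 := hXk _ m1
  have k2 := hXk _ m2
  have k3 := hXk _ m3
  have x1 := hXmem _ m1
  have x2 := hXmem _ m2
  have x3 := hXmem _ m3
  generalize X (A t + 5 * δ / 16) = X₁ at *
  generalize X (A t + 6 * δ / 16) = X₂ at *
  generalize X (A t + 7 * δ / 16) = X₃ at *
  have hEr := hEpos r
  have hγpos : 0 < γ := by
    refine hγ0.lt_of_ne fun h0 => ?_
    rw [← h0] at p1 p2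
    have : X₁ = X₂ := by
      have : E r * (X₁ - X₂) = 0 := by linarith
      rcases mul_eq_zero.1 this with h1 | h1
      · exact absurd h1 hEr.ne'
      · linarith
    rw [this] at k1
    have : δ * E r = 0 := by nlinarith
    rcases mul_eq_zero.1 this with h1 | h1
    · exact hδ.ne' h1
    · exact hEr.ne' h1
  have d12 : E r * (X₂ - X₁) = γ * δ / 8 := by linarith
  have d23 : E r * (X₃ - X₂) = γ * δ / 8 := by linarith
  have l12 : X₁ < X₂ := by
    have : 0 < E r * (X₂ - X₁) := by rw [d12]; positivity
    linarith [(pos_iff_pos_of_mul_pos this).1 hEr]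
  have l23 : X₂ < X₃ := by
    have : 0 < E r * (X₃ - X₂) := by rw [d23]; positivity
    linarith [(pos_iff_pos_of_mul_pos this).1 hEr]
  have hrig := h.rigid r hr0 X₁ (Ioo_subset_Icc_self x1) X₂ (Ioo_subset_Icc_self x2) X₃
    (Ioo_subset_Icc_self x3) l12 l23 (E r ^ 2 / (2 * γ))
    (by rw [k1, k2, div_mul_eq_mul_div, eq_div_iff (by positivity)]; linear_combination (-E r) * d12)
    (by rw [k2, k3, div_mul_eq_mul_div, eq_div_iff (by positivity)]; linear_combination (-E r) * d23)
  have hA0 := hrig.trans (h.antitone self_mem_Ici (mem_Ici.2 hr0) hr0)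
  rw [div_le_iff₀ (by positivity)] at hA0
  have hA00 := h.total_nonneg le_rfl
  have : E r ^ 2 ≤ A 0 * (K * E r ^ 2 * (t - r)) := hA0.trans (by gcongr)
  have h2 : 0 < E r ^ 2 := by positivity
  nlinarith

/-- The total number of arms is a continuous function of time. -/
theorem continuousOn (h : IsArmProfile k D A ψ) : ContinuousOn A (Ici 0) := by
  intro t ht
  have ht' : (0:ℝ) ≤ t := ht
  refine tendsto_order.2 ⟨fun c hc => ?_, fun c hc => ?_⟩
  · have h1 := h.eventually_gt ht' (x := 1) ⟨zero_lt_one, le_rfl⟩ (c := c)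
      (by rwa [h.apply_one t ht'])
    filter_upwards [h1, self_mem_nhdsWithin] with s hs hs0
    rwa [h.apply_one s hs0] at hs
  · obtain ⟨s, hst, hs⟩ : ∃ s, (s < t ∧ ∀ u ∈ Ici (0:ℝ), s < u → A u < c) := by
      rcases ht'.eq_or_lt with rfl | htpos
      · exact ⟨-1, by norm_num, fun u hu _ => (h.antitone self_mem_Ici hu hu).trans_lt hc⟩
      · by_contra! hcon
        refine h.not_left_gap htpos (δ := c - A t) (by linarith) fun s hs => ?_
        obtain ⟨u, hu, hsu, hcu⟩ := hcon s hs.2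
        linarith [h.antitone (mem_Ici.2 hs.1) hu hsu.le]
    filter_upwards [self_mem_nhdsWithin, mem_nhdsWithin_of_mem_nhds (Ioi_mem_nhds hst)]
      with u hu hsu using hs u hu hsu

end IsArmProfile

/-! ### Generating functions of a state -/

/-- Derivative of the generating function of the number of free arms. -/
noncomputable def armGen (c : ℕ → ℕ → ℝ) (x : ℝ) : ℝ :=
  ∑' p : ℕ × ℕ, (p.1 : ℝ) * c p.1 p.2 * x ^ (p.1 - 1)

/-- Difference between the values at `1` and at `x` of the generating function of the number of
free arms. -/
noncomputable def armDefect (c : ℕ → ℕ → ℝ) (x : ℝ) : ℝ :=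
  ∑' p : ℕ × ℕ, c p.1 p.2 * (1 - x ^ p.1)

/-- A nonnegative state without massless clusters and with finitely many arms. -/
structure IsClusterState (c : ℕ → ℕ → ℝ) : Prop where
  nonneg : ∀ a m, 0 ≤ c a m
  massless : ∀ a, c a 0 = 0
  summable : Summable (fun p : ℕ × ℕ => (p.1 : ℝ) * c p.1 p.2)

lemma pow_tangent_le {x y : ℝ} (hx : 0 ≤ x) (hy : 0 ≤ y) (n : ℕ) :
    x ^ n + n * x ^ (n - 1) * (y - x) ≤ y ^ n := by
  induction n with
  | zero => simp
  | succ n ih =>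
    rcases n.eq_zero_or_pos with rfl | hn
    · simp
    have h1 : x ^ n = x * x ^ (n - 1) := (mul_pow_sub_one hn.ne' x).symm
    have h2 : 0 ≤ n * x ^ (n - 1) * (y - x) ^ 2 := by positivity
    have h3 := mul_le_mul_of_nonneg_left ih hy
    rw [Nat.add_sub_cancel, pow_succ, pow_succ, Nat.cast_add_one]
    rw [h1] at h3 ⊢
    nlinarith

lemma one_sub_pow_le_self {x : ℝ} (hx : x ∈ Icc (0:ℝ) 1) (n : ℕ) : 1 - x ^ n ≤ n := by
  rcases n.eq_zero_or_pos with rfl | hn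
  · simp
  · have h1 : (1:ℝ) ≤ n := by exact_mod_cast hn
    have h2 := pow_nonneg hx.1 n
    linarith

namespace IsClusterState

variable {c : ℕ → ℕ → ℝ}

lemma weight_nonneg (h : IsClusterState c) (p : ℕ × ℕ) : 0 ≤ (p.1 : ℝ) * c p.1 p.2 :=
  mul_nonneg (Nat.cast_nonneg _) (h.nonneg _ _)

lemma armSum_nonneg (h : IsClusterState c) : 0 ≤ armSum c := tsum_nonneg h.weight_nonneg

lemma summable_gen (h : IsClusterState c) {x : ℝ} (hx : x ∈ Icc (0:ℝ) 1) :
    Summable (fun p : ℕ × ℕ => (p.1 : ℝ) * c p.1 p.2 * x ^ (p.1 - 1)) :=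
  Summable.of_nonneg_of_le (fun p => mul_nonneg (h.weight_nonneg p) (pow_nonneg hx.1 _))
    (fun p => mul_le_of_le_one_right (h.weight_nonneg p) (pow_le_one₀ hx.1 hx.2)) h.summable

lemma summable_defect (h : IsClusterState c) {x : ℝ} (hx : x ∈ Icc (0:ℝ) 1) :
    Summable (fun p : ℕ × ℕ => c p.1 p.2 * (1 - x ^ p.1)) := by
  refine Summable.of_nonneg_of_le (fun p => mul_nonneg (h.nonneg _ _) ?_) (fun p => ?_) h.summable
  · linarith [pow_le_one₀ hx.1 hx.2 (n := p.1)]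
  · rw [mul_comm]
    exact mul_le_mul_of_nonneg_right (one_sub_pow_le_self hx _) (h.nonneg _ _)

lemma gen_one : armGen c 1 = armSum c := by simp [armGen, armSum]

lemma defect_one : armDefect c 1 = 0 := by simp [armDefect]

lemma gen_zero_nonneg (h : IsClusterState c) : 0 ≤ armGen c 0 :=
  tsum_nonneg fun p => mul_nonneg (h.weight_nonneg p) (pow_nonneg le_rfl _)

lemma gen_mono (h : IsClusterState c) : MonotoneOn (armGen c) (Icc 0 1) := by
  intro x hx y hy hxy
  exact (h.summable_gen hx).tsum_le_tsum
    (fun p => mul_le_mul_of_nonneg_left (pow_le_pow_left₀ hx.1 hxy _) (h.weight_nonneg p))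
    (h.summable_gen hy)

lemma gen_continuousOn (h : IsClusterState c) : ContinuousOn (armGen c) (Icc 0 1) := by
  refine continuousOn_tsum (u := fun p : ℕ × ℕ => (p.1 : ℝ) * c p.1 p.2)
    (fun p => by fun_prop) h.summable fun p x hx => ?_
  rw [Real.norm_of_nonneg (mul_nonneg (h.weight_nonneg p) (pow_nonneg hx.1 _))]
  exact mul_le_of_le_one_right (h.weight_nonneg p) (pow_le_one₀ hx.1 hx.2)

lemma defect_tangent (h : IsClusterState c) {x y : ℝ} (hx : x ∈ Icc (0:ℝ) 1)
    (hy : y ∈ Icc (0:ℝ) 1) : armDefect c y ≤ armDefect c x - armGen c x * (y - x) := by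
  rw [armDefect, armDefect, armGen, ← tsum_mul_right,
    ← (h.summable_defect hx).tsum_sub ((h.summable_gen hx).mul_right _)]
  refine (h.summable_defect hy).tsum_le_tsum (fun p => ?_)
    ((h.summable_defect hx).sub ((h.summable_gen hx).mul_right _))
  have h1 := mul_le_mul_of_nonneg_left (pow_tangent_le hx.1 hy.1 p.1) (h.nonneg p.1 p.2)
  linarith

lemma gen_strictMonoOn (h : IsClusterState c) (hlt : armGen c 0 < armGen c 1) :
    StrictMonoOn (armGen c) (Icc 0 1) := by
  obtain ⟨p, hp⟩ : ∃ p : ℕ × ℕ, (p.1 : ℝ) * c p.1 p.2 * 0 ^ (p.1 - 1) <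
      (p.1 : ℝ) * c p.1 p.2 * 1 ^ (p.1 - 1) := by
    by_contra! hcon
    exact hlt.not_ge ((h.summable_gen (right_mem_Icc.2 zero_le_one)).tsum_le_tsum hcon
      (h.summable_gen (left_mem_Icc.2 zero_le_one)))
  have hn : p.1 - 1 ≠ 0 := fun h0 => by simp [h0] at hp
  have hw : 0 < (p.1 : ℝ) * c p.1 p.2 := by simpa [hn] using hp
  intro x hx y hy hxy
  exact (h.summable_gen hx).tsum_lt_tsum (i := p)
    (fun q => mul_le_mul_of_nonneg_left (pow_le_pow_left₀ hx.1 hxy.le _) (h.weight_nonneg q))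
    (mul_lt_mul_of_pos_left (pow_lt_pow_left₀ hxy hx.1 hn) hw) (h.summable_gen hy)

lemma gen_rigid (h : IsClusterState c) {x₁ x₂ x₃ κ : ℝ} (hx₁ : x₁ ∈ Icc (0:ℝ) 1)
    (hx₂ : x₂ ∈ Icc (0:ℝ) 1) (hx₃ : x₃ ∈ Icc (0:ℝ) 1) (h₁₂ : x₁ < x₂) (h₂₃ : x₂ < x₃)
    (hκ₁ : armGen c x₂ - armGen c x₁ = κ * (x₂ - x₁))
    (hκ₂ : armGen c x₃ - armGen c x₂ = κ * (x₃ - x₂)) : κ ≤ armSum c := by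
  set g : ℕ × ℕ → ℝ := fun p => (p.1 : ℝ) * c p.1 p.2 with hg
  have s₁ := h.summable_gen hx₁
  have s₂ := h.summable_gen hx₂
  have s₃ := h.summable_gen hx₃
  set f : ℕ × ℕ → ℝ := fun p => (g p * x₃ ^ (p.1 - 1) - g p * x₂ ^ (p.1 - 1)) * (x₂ - x₁) -
    (g p * x₂ ^ (p.1 - 1) - g p * x₁ ^ (p.1 - 1)) * (x₃ - x₂) with hf
  have hfs : HasSum f ((armGen c x₃ - armGen c x₂) * (x₂ - x₁) -
      (armGen c x₂ - armGen c x₁) * (x₃ - x₂)) :=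
    ((s₃.hasSum.sub s₂.hasSum).mul_right _).sub ((s₂.hasSum.sub s₁.hasSum).mul_right _)
  rw [hκ₁, hκ₂, show κ * (x₃ - x₂) * (x₂ - x₁) - κ * (x₂ - x₁) * (x₃ - x₂) = 0 by ring] at hfs
  have hfeq : ∀ p, f p = g p * ((x₃ ^ (p.1 - 1) - x₂ ^ (p.1 - 1)) * (x₂ - x₁) -
      (x₂ ^ (p.1 - 1) - x₁ ^ (p.1 - 1)) * (x₃ - x₂)) := fun p => by
    simp only [hf]
    ring
  have hf0 : ∀ p, 0 ≤ f p := by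
    intro p
    rw [hfeq]
    refine mul_nonneg (h.weight_nonneg p) ?_
    have := (convexOn_pow (𝕜 := ℝ) (p.1 - 1)).slope_mono_adjacent (mem_Ici.2 hx₁.1)
      (mem_Ici.2 hx₃.1) h₁₂ h₂₃
    rw [div_le_div_iff₀ (by linarith) (by linarith)] at this
    linarith
  have hfz : ∀ p, f p = 0 := fun p => congrFun ((hasSum_zero_iff_of_nonneg hf0).1 hfs) p
  have hz : ∀ p : ℕ × ℕ, 2 ≤ p.1 - 1 → g p = 0 := by
    intro p hp
    have h1 := hfz p
    rw [hfeq] at h1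
    refine (mul_eq_zero.1 h1).resolve_right ?_
    have := (strictConvexOn_pow hp).slope_strict_mono_adjacent (mem_Ici.2 hx₁.1)
      (mem_Ici.2 hx₃.1) h₁₂ h₂₃
    rw [div_lt_div_iff₀ (by linarith) (by linarith)] at this
    linarith
  have hle : armGen c x₂ - armGen c x₁ ≤ armSum c * (x₂ - x₁) := by
    refine hasSum_le (fun p => ?_) (s₂.hasSum.sub s₁.hasSum)
      (h.summable.hasSum.mul_right (x₂ - x₁))
    change g p * x₂ ^ (p.1 - 1) - g p * x₁ ^ (p.1 - 1) ≤ g p * (x₂ - x₁)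
    have hg0 : 0 ≤ g p := h.weight_nonneg p
    rcases Nat.lt_or_ge (p.1 - 1) 2 with h2 | h2
    · interval_cases hn : p.1 - 1
      · simp only [pow_zero, sub_self]
        exact mul_nonneg hg0 (by linarith)
      · simp only [pow_one]
        linarith
    · simp [hz p h2]
  rw [hκ₁] at hle
  exact le_of_mul_le_mul_right hle (by linarith)

lemma coagLoss_eq (c : ℕ → ℕ → ℝ) (a m : ℕ) : coagLoss c a m = a * c a m * armSum c := by
  rw [coagLoss, armSum, ← tsum_mul_left]
  congr 1
  ext p
  ring

lemma coagGain_nonneg (h : IsClusterState c) (a m : ℕ) : 0 ≤ coagGain c a m := by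
  refine mul_nonneg (by norm_num) (Finset.sum_nonneg fun i _ => Finset.sum_nonneg fun j _ => ?_)
  have := h.nonneg i j
  have := h.nonneg (a + 2 - i) (m - j)
  positivity

lemma coagLoss_nonneg (h : IsClusterState c) (a m : ℕ) : 0 ≤ coagLoss c a m := by
  rw [coagLoss_eq]
  exact mul_nonneg (h.weight_nonneg (a, m)) h.armSum_nonneg

/-- The antidiagonal of a pair of natural numbers, as a product of antidiagonals. -/
instance : Finset.HasAntidiagonal (ℕ × ℕ) where
  antidiagonal p := (Finset.HasAntidiagonal.antidiagonal p.1 ×ˢ Finset.HasAntidiagonal.antidiagonal p.2).image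
    fun q => ((q.1.1, q.2.1), (q.1.2, q.2.2))
  mem_antidiagonal := by
    rintro ⟨a, m⟩ ⟨⟨i, j⟩, ⟨i', j'⟩⟩
    simp

lemma sum_antidiagonal_prod (f : (ℕ × ℕ) × (ℕ × ℕ) → ℝ) (a m : ℕ) :
    ∑ q ∈ Finset.HasAntidiagonal.antidiagonal (a, m), f q =
      ∑ i ∈ Finset.range (a + 1), ∑ j ∈ Finset.range (m + 1), f ((i, j), (a - i, m - j)) := by
  have : Finset.HasAntidiagonal.antidiagonal (a, m) =
      (Finset.HasAntidiagonal.antidiagonal a ×ˢ Finset.HasAntidiagonal.antidiagonal m).image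
        fun q => ((q.1.1, q.2.1), (q.1.2, q.2.2)) := rfl
  rw [this, Finset.sum_image (by
    rintro ⟨⟨i, i'⟩, ⟨j, j'⟩⟩ - ⟨⟨k, k'⟩, ⟨l, l'⟩⟩ - hq
    simp only [Prod.mk.injEq] at hq ⊢
    tauto), Finset.sum_product, Finset.Nat.sum_antidiagonal_eq_sum_range_succ_mk]
  refine Finset.sum_congr rfl fun i _ => ?_
  rw [Finset.Nat.sum_antidiagonal_eq_sum_range_succ_mk]

lemma two_mul_coagGain (h : IsClusterState c) (a m : ℕ) :
    2 * coagGain c a m = ∑ q ∈ Finset.HasAntidiagonal.antidiagonal (a, m),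
      ((q.1.1 + 1 : ℕ) * c (q.1.1 + 1) q.1.2) * ((q.2.1 + 1 : ℕ) * c (q.2.1 + 1) q.2.2) := by
  rw [sum_antidiagonal_prod, coagGain, Finset.sum_range_succ' _ (a + 1)]
  simp only [Nat.cast_zero, zero_mul, Finset.sum_const_zero, add_zero]
  rw [← mul_assoc, mul_one_div_cancel two_ne_zero, one_mul]
  refine Finset.sum_congr rfl fun i hi => ?_
  have hi' : i ≤ a := by simpa [Nat.lt_succ_iff] using hi
  have hai : a + 2 - (i + 1) = a - i + 1 := by omega
  rw [hai]
  have hsub : Finset.Ico 1 m ⊆ Finset.range (m + 1) := fun j hj => by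
    simp only [Finset.mem_Ico, Finset.mem_range] at hj ⊢
    omega
  rw [← Finset.sum_subset hsub]
  · refine Finset.sum_congr rfl fun j _ => ?_
    ring
  · intro j hj hj'
    simp only [Finset.mem_Ico, Finset.mem_range, not_and, not_lt] at hj hj'
    rcases j.eq_zero_or_pos with rfl | hpos
    · simp [h.massless]
    · have : j = m := by have := hj' hpos; omega
      simp [this, h.massless]

lemma hasSum_gen_shift (h : IsClusterState c) {x : ℝ} (hx : x ∈ Icc (0:ℝ) 1) :
    HasSum (fun p : ℕ × ℕ => ((p.1 + 1 : ℕ) * c (p.1 + 1) p.2) * x ^ p.1) (armGen c x) := by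
  have hinj : Function.Injective (fun p : ℕ × ℕ => (p.1 + 1, p.2)) := by
    rintro ⟨a, m⟩ ⟨a', m'⟩ hp
    simpa using hp
  refine (hinj.hasSum_iff (f := fun p : ℕ × ℕ => (p.1 : ℝ) * c p.1 p.2 * x ^ (p.1 - 1)) ?_).2
    (h.summable_gen hx).hasSum
  rintro ⟨a, m⟩ hp
  rcases a.eq_zero_or_pos with rfl | ha
  · simp
  · exact absurd ⟨(a - 1, m), by simp [Nat.sub_add_cancel ha]⟩ hp

/-- The generating function of the gain term. -/
lemma hasSum_gain (h : IsClusterState c) {x : ℝ} (hx : x ∈ Icc (0:ℝ) 1) :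
    HasSum (fun p : ℕ × ℕ => coagGain c p.1 p.2 * x ^ p.1) (armGen c x ^ 2 / 2) := by
  set f : ℕ × ℕ → ℝ := fun p => ((p.1 + 1 : ℕ) * c (p.1 + 1) p.2) * x ^ p.1 with hf
  have hfs := h.hasSum_gen_shift hx
  have hf0 : ∀ p, 0 ≤ f p := fun p =>
    mul_nonneg (h.weight_nonneg (p.1 + 1, p.2)) (pow_nonneg hx.1 _)
  have hprod : Summable fun q : (ℕ × ℕ) × (ℕ × ℕ) => f q.1 * f q.2 :=
    hfs.summable.mul_of_nonneg hfs.summable hf0 hf0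
  have hs := (summable_sum_mul_antidiagonal_of_summable_mul hprod).hasSum
  rw [← hfs.summable.tsum_mul_tsum_eq_tsum_sum_antidiagonal hfs.summable hprod, hfs.tsum_eq] at hs
  have hs2 := hs.div_const 2
  rw [← sq] at hs2
  refine hs2.congr_fun fun p => ?_
  have h1 := h.two_mul_coagGain p.1 p.2
  have h2 : ∑ q ∈ Finset.HasAntidiagonal.antidiagonal p, f q.1 * f q.2 = 2 * coagGain c p.1 p.2 * x ^ p.1 := by
    rw [h1, Finset.sum_mul]
    refine Finset.sum_congr rfl fun q hq => ?_
    have : q.1.1 + q.2.1 = p.1 := congrArg Prod.fst (Finset.HasAntidiagonal.mem_antidiagonal.1 hq)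
    simp only [hf]
    rw [← this, pow_add]
    ring
  rw [h2]
  ring

/-- The generating function of the loss term. -/
lemma hasSum_loss (h : IsClusterState c) {x : ℝ} (hx : x ∈ Icc (0:ℝ) 1) :
    HasSum (fun p : ℕ × ℕ => coagLoss c p.1 p.2 * x ^ p.1) (armSum c * x * armGen c x) := by
  refine ((h.summable_gen hx).hasSum.mul_left (armSum c * x)).congr_fun fun p => ?_
  rw [coagLoss_eq]
  rcases p.1.eq_zero_or_pos with h0 | hpos
  · simp [h0]
  · rw [← mul_pow_sub_one hpos.ne' x]
    ring

lemma hasSum_gain_add_loss (h : IsClusterState c) :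
    HasSum (fun p : ℕ × ℕ => coagGain c p.1 p.2 + coagLoss c p.1 p.2) (3 / 2 * armSum c ^ 2) := by
  have h1 := (h.hasSum_gain (right_mem_Icc.2 zero_le_one)).add
    (h.hasSum_loss (right_mem_Icc.2 zero_le_one))
  simp only [one_pow, mul_one, gen_one] at h1
  convert h1 using 1
  ring

lemma hasSum_defect_rate (h : IsClusterState c) {x : ℝ} (hx : x ∈ Icc (0:ℝ) 1) :
    HasSum (fun p : ℕ × ℕ => (coagGain c p.1 p.2 - coagLoss c p.1 p.2) * (1 - x ^ p.1))
      (-(armSum c ^ 2 / 2 + armGen c x ^ 2 / 2 - armSum c * x * armGen c x)) := by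
  have h1 := (h.hasSum_gain (right_mem_Icc.2 zero_le_one)).sub
    (h.hasSum_loss (right_mem_Icc.2 zero_le_one))
  have h2 := h1.sub ((h.hasSum_gain hx).sub (h.hasSum_loss hx))
  simp only [one_pow, mul_one, gen_one] at h2
  rw [show -(armSum c ^ 2 / 2 + armGen c x ^ 2 / 2 - armSum c * x * armGen c x) =
    armSum c ^ 2 / 2 - armSum c * armSum c -
      (armGen c x ^ 2 / 2 - armSum c * x * armGen c x) by ring]
  refine h2.congr_fun fun p => ?_
  ring

end IsClusterState

/-! ### Solutions of the coagulation equation with a time weight -/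

/-- Solution of the coagulation equation in which the collision rates are multiplied by a function
of the total number of arms. -/
def IsWeightedSolution (w : ℝ → ℝ) (c : ℝ → ℕ → ℕ → ℝ) (c₀ : ℕ → ℕ → ℝ) : Prop :=
  (∀ t ∈ Ici (0:ℝ), ∀ a m : ℕ, 0 ≤ c t a m) ∧
  (∀ t ∈ Ici (0:ℝ), ∀ a : ℕ, c t a 0 = 0) ∧
  (∀ a m : ℕ, ContinuousOn (fun t => c t a m) (Ici 0)) ∧
  ∀ t ∈ Ici (0:ℝ),
    (0 < sInf ((fun s => armSum (c s)) '' Icc 0 t)) ∧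
    BddAbove ((fun s => armSum (c s)) '' Icc 0 t) ∧
    IntervalIntegrable (fun s => (armSum (c s)) ^ 2) volume 0 t ∧
    ∀ a m : ℕ, 1 ≤ m →
      c t a m - c₀ a m =
        ∫ s in (0:ℝ)..t, w (armSum (c s)) * (coagGain (c s) a m - coagLoss (c s) a m)

lemma isModified_iff_isWeighted {c : ℝ → ℕ → ℕ → ℝ} {c₀ : ℕ → ℕ → ℝ} :
    IsModifiedSmoluchowskiSolution c c₀ ↔ IsWeightedSolution (fun y => y⁻¹) c c₀ := Iff.rfl

lemma isOriginal_iff_isWeighted {c : ℝ → ℕ → ℕ → ℝ} {c₀ : ℕ → ℕ → ℝ} :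
    IsOriginalSmoluchowskiSolution c c₀ ↔ IsWeightedSolution (fun _ => 1) c c₀ := by
  simp only [IsOriginalSmoluchowskiSolution, IsWeightedSolution, one_mul]

namespace IsWeightedSolution

variable {w : ℝ → ℝ} {c : ℝ → ℕ → ℕ → ℝ} {c₀ : ℕ → ℕ → ℝ}

lemma exists_lower_bound (h : IsWeightedSolution w c c₀) {T : ℝ} (hT : 0 ≤ T) :
    ∃ δ > 0, ∀ s ∈ Icc 0 T, δ ≤ armSum (c s) := by
  refine ⟨_, (h.2.2.2 T hT).1, fun s hs => csInf_le ⟨0, ?_⟩ ⟨s, hs, rfl⟩⟩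
  rintro _ ⟨u, hu, rfl⟩
  exact tsum_nonneg fun p => mul_nonneg (Nat.cast_nonneg _) (h.1 u hu.1 _ _)

lemma armSum_pos (h : IsWeightedSolution w c c₀) {t : ℝ} (ht : 0 ≤ t) : 0 < armSum (c t) := by
  obtain ⟨δ, hδ, hb⟩ := h.exists_lower_bound ht
  exact hδ.trans_le (hb t ⟨ht, le_rfl⟩)

lemma isClusterState (h : IsWeightedSolution w c c₀) {t : ℝ} (ht : 0 ≤ t) :
    IsClusterState (c t) where
  nonneg := h.1 t ht
  massless := h.2.1 t ht
  summable := by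
    by_contra hs
    exact (h.armSum_pos ht).ne' (tsum_eq_zero_of_not_summable hs)

lemma aemeasurable_apply (h : IsWeightedSolution w c c₀) (a m : ℕ) (T : ℝ) :
    AEMeasurable (fun s => c s a m) (volume.restrict (Icc 0 T)) :=
  ((h.2.2.1 a m).mono Icc_subset_Ici_self).aemeasurable measurableSet_Icc

lemma aemeasurable_armGen (h : IsWeightedSolution w c c₀) {x : ℝ} (hx : x ∈ Icc (0:ℝ) 1) (T : ℝ) :
    AEMeasurable (fun s => armGen (c s) x) (volume.restrict (Icc 0 T)) := by
  refine aemeasurable_of_tendsto_metrizable_ae (Filter.atTop : Filter (Finset (ℕ × ℕ)))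
    (f := fun F s => ∑ p ∈ F, (p.1 : ℝ) * c s p.1 p.2 * x ^ (p.1 - 1)) (fun F => ?_) ?_
  · refine Finset.aemeasurable_fun_sum _ fun p _ => ?_
    exact ((h.aemeasurable_apply p.1 p.2 T).const_mul _).mul_const _
  · filter_upwards [ae_restrict_mem measurableSet_Icc] with s hs
    exact ((h.isClusterState hs.1).summable_gen hx).hasSum

lemma aemeasurable_armSum (h : IsWeightedSolution w c c₀) (T : ℝ) :
    AEMeasurable (fun s => armSum (c s)) (volume.restrict (Icc 0 T)) := by
  simpa only [IsClusterState.gen_one] using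
    h.aemeasurable_armGen (right_mem_Icc.2 zero_le_one) T

lemma aemeasurable_gain (h : IsWeightedSolution w c c₀) (a m : ℕ) (T : ℝ) :
    AEMeasurable (fun s => coagGain (c s) a m) (volume.restrict (Icc 0 T)) := by
  refine (Finset.aemeasurable_fun_sum _ fun i _ => Finset.aemeasurable_fun_sum _ fun j _ => ?_)
    |>.const_mul _
  exact ((h.aemeasurable_apply _ _ T).const_mul _).mul (h.aemeasurable_apply _ _ T)

lemma aemeasurable_loss (h : IsWeightedSolution w c c₀) (a m : ℕ) (T : ℝ) :
    AEMeasurable (fun s => coagLoss (c s) a m) (volume.restrict (Icc 0 T)) := by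
  simp only [IsClusterState.coagLoss_eq]
  exact ((h.aemeasurable_apply _ _ T).const_mul _).mul (h.aemeasurable_armSum T)

lemma apply_zero (h : IsWeightedSolution w c c₀) (h₀ : ∀ a, c₀ a 0 = 0) : c 0 = c₀ := by
  ext a m
  rcases m.eq_zero_or_pos with rfl | hm
  · rw [h.2.1 0 self_mem_Ici, h₀]
  · have := (h.2.2.2 0 self_mem_Ici).2.2.2 a m hm
    rw [intervalIntegral.integral_same] at this
    linarith

lemma sub_eq (h : IsWeightedSolution w c c₀) (h₀ : ∀ a, c₀ a 0 = 0) {t : ℝ} (ht : 0 ≤ t)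
    (a m : ℕ) : c t a m - c 0 a m =
      ∫ s in (0:ℝ)..t, w (armSum (c s)) * (coagGain (c s) a m - coagLoss (c s) a m) := by
  rcases m.eq_zero_or_pos with rfl | hm
  · rw [h.2.1 t ht, h.2.1 0 self_mem_Ici, sub_self, eq_comm]
    apply intervalIntegral.integral_zero_ae
    refine Filter.Eventually.of_forall fun s hs => ?_
    rw [uIoc_of_le ht] at hs
    simp [IsClusterState.coagLoss_eq, coagGain, h.2.1 s hs.1.le]
  · rw [h.apply_zero h₀, (h.2.2.2 t ht).2.2.2 a m hm]

lemma exists_bound (h : IsWeightedSolution w c c₀) (hwc : ContinuousOn w (Ioi 0))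
    (hw0 : ∀ y, 0 < y → 0 ≤ w y) {T : ℝ} (hT : 0 ≤ T) :
    ∃ K, ∀ s ∈ Icc 0 T, armSum (c s) ≤ K ∧ 0 ≤ w (armSum (c s)) ∧ w (armSum (c s)) ≤ K := by
  obtain ⟨δ, hδ, hb⟩ := h.exists_lower_bound hT
  obtain ⟨M, hM⟩ := (h.2.2.2 T hT).2.1
  have hM' : ∀ s ∈ Icc 0 T, armSum (c s) ≤ M := fun s hs => hM ⟨s, hs, rfl⟩
  obtain ⟨K, hK⟩ := isCompact_Icc.bddAbove_image
    (hwc.mono fun y (hy : y ∈ Icc δ M) => hδ.trans_le hy.1)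
  refine ⟨max M K, fun s hs => ⟨(hM' s hs).trans (le_max_left _ _), hw0 _ (h.armSum_pos hs.1),
    (hK ⟨_, ⟨hb s hs, hM' s hs⟩, rfl⟩).trans (le_max_right _ _)⟩⟩

lemma armDefect_sub (h : IsWeightedSolution w c c₀) (h₀ : ∀ a, c₀ a 0 = 0) (hwm : Measurable w)
    (hwc : ContinuousOn w (Ioi 0)) (hw0 : ∀ y, 0 < y → 0 ≤ w y) {x t : ℝ}
    (hx : x ∈ Icc (0:ℝ) 1) (ht : 0 ≤ t) :
    armDefect (c t) x - armDefect (c 0) x = -∫ s in (0:ℝ)..t, w (armSum (c s)) *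
      (armSum (c s) ^ 2 / 2 + armGen (c s) x ^ 2 / 2 - armSum (c s) * x * armGen (c s) x) := by
  obtain ⟨K, hK⟩ := h.exists_bound hwc hw0 ht
  have hmw : AEMeasurable (fun s => w (armSum (c s))) (volume.restrict (Icc 0 t)) :=
    hwm.comp_aemeasurable (h.aemeasurable_armSum t)
  have hmem : ∀ s ∈ uIoc 0 t, s ∈ Icc 0 t := fun s hs => by
    rw [uIoc_of_le ht] at hs
    exact Ioc_subset_Icc_self hs
  have hres : volume.restrict (uIoc 0 t) ≤ volume.restrict (Icc 0 t) :=
    Measure.restrict_mono hmem le_rfl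
  have hx1 : ∀ n : ℕ, 0 ≤ 1 - x ^ n ∧ 1 - x ^ n ≤ 1 := fun n =>
    ⟨by linarith [pow_le_one₀ hx.1 hx.2 (n := n)], by linarith [pow_nonneg hx.1 n]⟩
  have hsum := intervalIntegral.hasSum_integral_of_dominated_convergence (μ := volume)
    (a := 0) (b := t) (ι := ℕ × ℕ)
    (F := fun p s => w (armSum (c s)) *
      ((coagGain (c s) p.1 p.2 - coagLoss (c s) p.1 p.2) * (1 - x ^ p.1)))
    (f := fun s => w (armSum (c s)) * (-(armSum (c s) ^ 2 / 2 + armGen (c s) x ^ 2 / 2 -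
      armSum (c s) * x * armGen (c s) x)))
    (fun p s => w (armSum (c s)) * (coagGain (c s) p.1 p.2 + coagLoss (c s) p.1 p.2))
    ?_ ?_ ?_ ?_ ?_
  · have hlhs : HasSum (fun p : ℕ × ℕ => c t p.1 p.2 * (1 - x ^ p.1) -
        c 0 p.1 p.2 * (1 - x ^ p.1)) (armDefect (c t) x - armDefect (c 0) x) :=
      ((h.isClusterState ht).summable_defect hx).hasSum.sub
        ((h.isClusterState le_rfl).summable_defect hx).hasSum
    rw [← intervalIntegral.integral_neg]
    simp only [← mul_neg]
    refine hlhs.unique (hsum.congr_fun fun p => ?_)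
    rw [← sub_mul, h.sub_eq h₀ ht, ← intervalIntegral.integral_mul_const]
    congr 1
    ext s
    ring
  · intro p
    refine AEMeasurable.aestronglyMeasurable (AEMeasurable.mono_measure ?_ hres)
    exact hmw.mul (((h.aemeasurable_gain _ _ t).sub (h.aemeasurable_loss _ _ t)).mul_const _)
  · refine fun p => Filter.Eventually.of_forall fun s hs => ?_
    have hs' := hmem s hs
    have hw := (hK s hs').2.1
    have h1 := (h.isClusterState hs'.1).coagGain_nonneg p.1 p.2
    have h2 := (h.isClusterState hs'.1).coagLoss_nonneg p.1 p.2
    rw [Real.norm_eq_abs, abs_mul, abs_mul, abs_of_nonneg hw, abs_of_nonneg (hx1 p.1).1]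
    refine mul_le_mul_of_nonneg_left ?_ hw
    refine (mul_le_of_le_one_right (abs_nonneg _) (hx1 p.1).2).trans ?_
    rw [abs_le]
    constructor <;> linarith
  · exact Filter.Eventually.of_forall fun s hs =>
      ((h.isClusterState (hmem s hs).1).hasSum_gain_add_loss.summable).mul_left _
  · have hb : IntervalIntegrable
        (fun s => w (armSum (c s)) * (3 / 2 * armSum (c s) ^ 2)) volume 0 t := by
      refine intervalIntegrable_of_abs_le (C := K * (3 / 2 * K ^ 2)) le_rfl ht le_rfl
        (hmw.mul (((h.aemeasurable_armSum t).pow_const 2).const_mul _)).aestronglyMeasurable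
        fun s hs => ?_
      obtain ⟨k1, k2, k3⟩ := hK s hs
      have k4 := (h.armSum_pos hs.1).le
      rw [abs_of_nonneg (by positivity)]
      gcongr
      exact k2.trans k3
    refine hb.congr fun s hs => ?_
    rw [tsum_mul_left, (h.isClusterState (hmem s hs).1).hasSum_gain_add_loss.tsum_eq]
  · exact Filter.Eventually.of_forall fun s hs =>
      ((h.isClusterState (hmem s hs).1).hasSum_defect_rate hx).mul_left _

lemma isArmProfile (h : IsWeightedSolution w c c₀) (h₀ : ∀ a, c₀ a 0 = 0) (hwm : Measurable w)
    (hwc : ContinuousOn w (Ioi 0)) (hw0 : ∀ y, 0 < y → 0 ≤ w y) :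
    IsArmProfile (fun t => armGen (c t)) (fun t => armDefect (c t)) (fun t => armSum (c t))
      (fun t => w (armSum (c t))) where
  mono _ ht := (h.isClusterState ht).gen_mono
  cont _ ht := (h.isClusterState ht).gen_continuousOn
  zero_nonneg _ ht := (h.isClusterState ht).gen_zero_nonneg
  apply_one _ _ := IsClusterState.gen_one
  prim_one _ _ := IsClusterState.defect_one
  tangent _ ht _ hx _ hy := (h.isClusterState ht).defect_tangent hx hy
  strict _ ht := (h.isClusterState ht).gen_strictMonoOn
  rigid _ ht _ h₁ _ h₂ _ h₃ h₁₂ h₂₃ _ := (h.isClusterState ht).gen_rigid h₁ h₂ h₃ h₁₂ h₂₃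
  bdd _ hT := h.exists_bound hwc hw0 hT
  meas_weight T _ := (hwm.comp_aemeasurable (h.aemeasurable_armSum T)).aestronglyMeasurable
  meas _ hx T _ := (h.aemeasurable_armGen hx T).aestronglyMeasurable
  evol _ hx _ ht := h.armDefect_sub h₀ hwm hwc hw0 hx ht

end IsWeightedSolution

/-! ### Time changes -/

lemma continuous_comp_max {F : ℝ → ℝ} (hF : ContinuousOn F (Ici 0)) :
    Continuous fun τ => F (max τ 0) :=
  hF.comp_continuous (by fun_prop) fun τ => le_max_right τ 0

lemma hasDerivAt_integral_max {F : ℝ → ℝ} (hF : ContinuousOn F (Ici 0)) (u : ℝ) :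
    HasDerivAt (fun u => ∫ τ in (0:ℝ)..u, F (max τ 0)) (F (max u 0)) u :=
  ((continuous_comp_max hF).integral_hasStrictDerivAt 0 u).hasDerivAt

lemma integral_max_eq (F : ℝ → ℝ) {u : ℝ} (hu : 0 ≤ u) :
    ∫ τ in (0:ℝ)..u, F (max τ 0) = ∫ τ in (0:ℝ)..u, F τ := by
  apply intervalIntegral.integral_congr
  intro τ hτ
  rw [uIcc_of_le hu] at hτ
  simp only [max_eq_left hτ.1]

/-- Autonomous scalar equation with a positive continuous speed and no explosion of the inverse. -/
lemma exists_time_change {f : ℝ → ℝ} (hf : ContinuousOn f (Ici 0)) (hpos : ∀ u, 0 ≤ u → 0 < f u)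
    (hinf : ∀ y, ∃ u, 0 ≤ u ∧ y ≤ ∫ τ in (0:ℝ)..u, (f τ)⁻¹) :
    ∃ s : ℝ → ℝ,
      (s 0 = 0 ∧ ∀ t ∈ Ici (0:ℝ), 0 ≤ s t ∧ HasDerivWithinAt s (f (s t)) (Ici 0) t) ∧
      (∀ s' : ℝ → ℝ,
        (s' 0 = 0 ∧ ∀ t ∈ Ici (0:ℝ), 0 ≤ s' t ∧ HasDerivWithinAt s' (f (s' t)) (Ici 0) t) →
        EqOn s' s (Ici 0)) ∧
      IsC1DiffeoOfIci0 s := by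
  have hf' : ContinuousOn (fun τ => (f τ)⁻¹) (Ici 0) := hf.inv₀ fun u hu => (hpos u hu).ne'
  have hmax : ∀ u, 0 < f (max u 0) := fun u => hpos _ (le_max_right _ _)
  set g : ℝ → ℝ := fun u => ∫ τ in (0:ℝ)..u, (f (max τ 0))⁻¹ with hg
  have hgd : ∀ u, HasDerivAt g (f (max u 0))⁻¹ u := hasDerivAt_integral_max hf'
  have hgc : Continuous g := continuous_iff_continuousAt.2 fun u => (hgd u).continuousAt
  have hg0 : g 0 = 0 := by simp [hg]
  have hgm : StrictMono g := strictMono_of_deriv_pos fun u => by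
    rw [(hgd u).deriv]
    exact inv_pos.2 (hmax u)
  have hgs : Function.Surjective g := by
    intro y
    rcases le_total 0 y with hy | hy
    · obtain ⟨u, hu, hyu⟩ := hinf y
      rw [← integral_max_eq (fun τ => (f τ)⁻¹) hu] at hyu
      obtain ⟨v, -, hv⟩ := intermediate_value_Icc hu hgc.continuousOn
        (show y ∈ Icc (g 0) (g u) from ⟨hg0.trans_le hy, hyu⟩)
      exact ⟨v, hv⟩
    · have h0 := hpos 0 le_rfl
      have hyf : y * f 0 ≤ 0 := mul_nonpos_of_nonpos_of_nonneg hy h0.le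
      refine ⟨y * f 0, ?_⟩
      have : g (y * f 0) = ∫ τ in (0:ℝ)..(y * f 0), (f 0)⁻¹ := by
        apply intervalIntegral.integral_congr
        intro τ hτ
        rw [uIcc_of_ge hyf] at hτ
        simp only [max_eq_right hτ.2]
      rw [this, intervalIntegral.integral_const, smul_eq_mul]
      field_simp
      ring
  set e := hgm.orderIsoOfSurjective g hgs
  set s : ℝ → ℝ := fun t => e.symm t
  have hgs' : ∀ t, g (s t) = t := fun t => e.apply_symm_apply t
  have hsg : ∀ t, s (g t) = t := fun t => e.symm_apply_apply t
  have hsc : Continuous s := e.symm.continuous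
  have hsd : ∀ t, HasDerivAt s (f (max (s t) 0)) t := fun t => by
    have := HasDerivAt.of_local_left_inverse hsc.continuousAt (hgd (s t))
      (inv_pos.2 (hmax _)).ne' (Filter.Eventually.of_forall hgs')
    rwa [inv_inv] at this
  have hs0 : s 0 = 0 := by rw [← hg0, hsg, hg0]
  have hsm : Monotone s := e.symm.monotone
  have hspos : ∀ t, 0 ≤ t → 0 ≤ s t := fun t ht => hs0 ▸ hsm ht
  have hgpos : ∀ t, 0 ≤ t → 0 ≤ g t := fun t ht => hg0 ▸ hgm.monotone ht
  refine ⟨s, ⟨hs0, fun t ht => ⟨hspos t ht, ?_⟩⟩, fun s' ⟨hs'0, hs'⟩ t ht => ?_, ?_, ?_, g, ?_⟩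
  · have := (hsd t).hasDerivWithinAt (s := Ici 0)
    rwa [max_eq_left (hspos t ht)] at this
  · have hd : ∀ x ∈ Ici (0:ℝ), HasDerivWithinAt (fun x => g (s' x) - x) 0 (Ici 0) x := by
      intro x hx
      obtain ⟨h1, h2⟩ := hs' x hx
      have h3 := ((hgd (s' x)).comp_hasDerivWithinAt x h2).sub (hasDerivWithinAt_id x (Ici 0))
      rw [max_eq_left h1, inv_mul_cancel₀ (hpos _ h1).ne', sub_self] at h3
      exact h3
    have hconst := constant_of_has_deriv_right_zero (a := 0) (b := t)
      (f := fun x => g (s' x) - x)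
      (fun x hx => ((hd x hx.1).continuousWithinAt).mono Icc_subset_Ici_self)
      (fun x hx => (hd x hx.1).mono (Ici_subset_Ici.2 hx.1)) t ⟨ht, le_rfl⟩
    simp only [hs'0, hg0, sub_zero, sub_eq_zero] at hconst
    rw [← hsg (s' t), hconst]
  · have : ContDiff ℝ 1 s := by
      refine contDiff_one_iff_deriv.2 ⟨fun t => (hsd t).differentiableAt, ?_⟩
      have hder : deriv s = fun t => f (max (s t) 0) := funext fun t => (hsd t).deriv
      rw [hder]
      exact (continuous_comp_max hf).comp hsc
    exact this.contDiffOn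
  · refine ⟨hspos, e.symm.injective.injOn, fun u hu => ⟨g u, hgpos u hu, hsg u⟩⟩
  · refine ⟨?_, fun t _ => hgs' t, fun t _ => hsg t⟩
    have : ContDiff ℝ 1 g := by
      refine contDiff_one_iff_deriv.2 ⟨fun t => (hgd t).differentiableAt, ?_⟩
      have hder : deriv g = fun t => (f (max t 0))⁻¹ := funext fun t => (hgd t).deriv
      rw [hder]
      exact continuous_comp_max hf'
    exact this.contDiffOn

namespace IsWeightedSolution

variable {w φ : ℝ → ℝ} {c : ℝ → ℕ → ℕ → ℝ} {c₀ : ℕ → ℕ → ℝ}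

lemma continuousOn_rate (h : IsWeightedSolution w c c₀)
    (hA : ContinuousOn (fun t => armSum (c t)) (Ici 0)) (a m : ℕ) :
    ContinuousOn (fun t => coagGain (c t) a m - coagLoss (c t) a m) (Ici 0) := by
  simp only [IsClusterState.coagLoss_eq, coagGain]
  refine ContinuousOn.sub (continuousOn_const.mul ?_)
    ((continuousOn_const.mul (h.2.2.1 a m)).mul hA)
  exact continuousOn_finsetSum _ fun i _ => continuousOn_finsetSum _ fun j _ =>
    (continuousOn_const.mul (h.2.2.1 _ _)).mul (h.2.2.1 _ _)

/-- A time change along a speed depending on the number of arms multiplies the weight by it. -/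
lemma comp_time_change (h : IsWeightedSolution w c c₀) (hwc : ContinuousOn w (Ioi 0))
    (hφ : ContinuousOn φ (Ioi 0)) (hA : ContinuousOn (fun t => armSum (c t)) (Ici 0))
    {s : ℝ → ℝ} (hs0 : s 0 = 0)
    (hs : ∀ t ∈ Ici (0:ℝ), 0 ≤ s t ∧ HasDerivWithinAt s (φ (armSum (c (s t)))) (Ici 0) t) :
    IsWeightedSolution (fun y => w y * φ y) (fun t => c (s t)) c₀ := by
  have hmaps : MapsTo s (Ici 0) (Ici 0) := fun t ht => (hs t ht).1
  have hsc : ContinuousOn s (Ici 0) := fun t ht => (hs t ht).2.continuousWithinAt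
  have hAs : ContinuousOn (fun t => armSum (c (s t))) (Ici 0) := hA.comp hsc hmaps
  have hmem : ∀ u, u ∈ Ici (0:ℝ) → armSum (c u) ∈ Ioi (0:ℝ) := fun u hu => h.armSum_pos hu
  refine ⟨fun t ht => h.1 _ (hmaps ht), fun t ht => h.2.1 _ (hmaps ht),
    fun a m => (h.2.2.1 a m).comp hsc hmaps, fun t ht => ?_⟩
  have hcpt := isCompact_Icc.image_of_continuousOn (hAs.mono (Icc_subset_Ici_self : Icc 0 t ⊆ Ici 0))
  have hne : ((fun s' => armSum (c (s s'))) '' Icc 0 t).Nonempty := (nonempty_Icc.2 ht).image _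
  refine ⟨?_, hcpt.bddAbove, ?_, fun a m hm => ?_⟩
  · obtain ⟨u, hu, hus⟩ := hcpt.sInf_mem hne
    rw [← hus]
    exact h.armSum_pos (hmaps hu.1)
  · apply ContinuousOn.intervalIntegrable
    rw [uIcc_of_le ht]
    exact (hAs.mono Icc_subset_Ici_self).pow 2
  · have hsub : Icc 0 t ⊆ Ici (0:ℝ) := Icc_subset_Ici_self
    rw [(h.2.2.2 _ (hmaps ht)).2.2.2 a m hm]
    have hG : ContinuousOn (fun u => w (armSum (c u)) *
        (coagGain (c u) a m - coagLoss (c u) a m)) (Ici 0) :=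
      (hwc.comp hA hmem).mul (h.continuousOn_rate hA a m)
    have hsubst := intervalIntegral.integral_comp_mul_deriv'' (a := 0) (b := t) (f := s)
      (f' := fun x => φ (armSum (c (s x))))
      (g := fun u => w (armSum (c u)) * (coagGain (c u) a m - coagLoss (c u) a m))
      (by rw [uIcc_of_le ht]; exact hsc.mono hsub)
      (fun x hx => by
        rw [min_eq_left (mem_Ici.1 ht)] at hx
        exact (hs x hx.1.le).2.mono fun y hy => hx.1.le.trans (le_of_lt hy))
      (by
        rw [uIcc_of_le ht]
        exact (hφ.comp hAs fun u hu => hmem _ (hmaps hu)).mono hsub)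
      (hG.mono (by
        rw [uIcc_of_le ht]
        rintro _ ⟨u, hu, rfl⟩
        exact hmaps hu.1))
    rw [hs0] at hsubst
    rw [← hsubst]
    congr 1
    ext u
    simp only [Function.comp_apply]
    ring

lemma congr_weight {w' : ℝ → ℝ} (h : IsWeightedSolution w c c₀)
    (hw : ∀ y, 0 < y → w y = w' y) : IsWeightedSolution w' c c₀ := by
  refine ⟨h.1, h.2.1, h.2.2.1, fun t ht => ⟨(h.2.2.2 t ht).1, (h.2.2.2 t ht).2.1,
    (h.2.2.2 t ht).2.2.1, fun a m hm => ?_⟩⟩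
  rw [(h.2.2.2 t ht).2.2.2 a m hm]
  apply intervalIntegral.integral_congr
  intro s hs
  rw [uIcc_of_le ht] at hs
  simp only [hw _ (h.armSum_pos hs.1)]

/-- For the unweighted equation, the total number of arms is not integrable in time. -/
lemma exists_le_integral_armSum (h : IsWeightedSolution (fun _ => 1) c c₀) (h₀ : ∀ a, c₀ a 0 = 0)
    (hA : ContinuousOn (fun t => armSum (c t)) (Ici 0)) (y : ℝ) :
    ∃ u, 0 ≤ u ∧ y ≤ ∫ τ in (0:ℝ)..u, armSum (c τ) := by
  obtain ⟨⟨a, m⟩, hp⟩ : ∃ p : ℕ × ℕ, 0 < (p.1 : ℝ) * c 0 p.1 p.2 := by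
    by_contra! hcon
    exact (h.armSum_pos le_rfl).not_ge (tsum_nonpos hcon)
  have ha : (0:ℝ) < a := by
    refine (Nat.cast_nonneg a).lt_of_ne fun h0 => ?_
    simp [← h0] at hp
  set R : ℝ → ℝ := fun t => coagGain (c t) a m - coagLoss (c t) a m with hR
  have hRc : ContinuousOn R (Ici 0) := h.continuousOn_rate hA a m
  set G : ℝ → ℝ := fun u => ∫ τ in (0:ℝ)..u, armSum (c (max τ 0)) with hG
  set P : ℝ → ℝ := fun u => ∫ τ in (0:ℝ)..u, R (max τ 0) with hP
  have hGd : ∀ u, HasDerivAt G (armSum (c (max u 0))) u := hasDerivAt_integral_max hA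
  have hPd : ∀ u, HasDerivAt P (R (max u 0)) u := hasDerivAt_integral_max hRc
  have hG0 : G 0 = 0 := by simp [hG]
  have hP0 : P 0 = 0 := by simp [hP]
  have hPeq : ∀ u, 0 ≤ u → c u a m = c 0 a m + P u := by
    intro u hu
    have h1 := h.sub_eq h₀ hu a m
    simp only [one_mul] at h1
    have h2 : P u = ∫ τ in (0:ℝ)..u, R τ := integral_max_eq R hu
    rw [h2]
    linarith
  have hEd : ∀ u, HasDerivAt (fun u => Real.exp (a * G u))
      (Real.exp (a * G u) * (a * armSum (c (max u 0)))) u := fun u =>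
    ((hGd u).const_mul (a : ℝ)).exp
  have hΦd : ∀ u, HasDerivAt (fun u => (c 0 a m + P u) * Real.exp (a * G u))
      (R (max u 0) * Real.exp (a * G u) + (c 0 a m + P u) *
        (Real.exp (a * G u) * (a * armSum (c (max u 0))))) u := fun u =>
    ((hPd u).const_add _).mul (hEd u)
  have hΦm : MonotoneOn (fun u => (c 0 a m + P u) * Real.exp (a * G u)) (Ici 0) := by
    refine monotoneOn_of_deriv_nonneg (convex_Ici 0)
      (fun u _ => (hΦd u).continuousAt.continuousWithinAt)
      (fun u _ => (hΦd u).differentiableAt.differentiableWithinAt) fun u hu => ?_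
    rw [interior_Ici] at hu
    have hu' : (0:ℝ) ≤ u := le_of_lt hu
    rw [(hΦd u).deriv, max_eq_left hu', ← hPeq u hu']
    have h1 := (h.isClusterState hu').coagGain_nonneg a m
    have h2 : R u * Real.exp (a * G u) + c u a m * (Real.exp (a * G u) * (a * armSum (c u))) =
        coagGain (c u) a m * Real.exp (a * G u) := by
      simp only [hR, IsClusterState.coagLoss_eq]
      ring
    rw [h2]
    positivity
  have hκ : ∀ u, 0 ≤ u → a * c 0 a m ≤ armSum (c u) * Real.exp (a * G u) := by
    intro u hu
    have h1 := hΦm self_mem_Ici hu hu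
    simp only [hP0, hG0, mul_zero, Real.exp_zero, mul_one, add_zero] at h1
    rw [← hPeq u hu] at h1
    have hst := h.isClusterState hu
    have h2 : a * c u a m ≤ armSum (c u) :=
      hst.summable.le_tsum (a, m) fun q _ => hst.weight_nonneg q
    calc a * c 0 a m ≤ a * (c u a m * Real.exp (a * G u)) := by gcongr
      _ = a * c u a m * Real.exp (a * G u) := by ring
      _ ≤ _ := by gcongr
  set κ := (a:ℝ) * (a * c 0 a m) with hκdef
  have hκpos : 0 < κ := mul_pos ha hp
  have hEm : MonotoneOn (fun u => Real.exp (a * G u) - κ * u) (Ici 0) := by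
    have hd : ∀ u, HasDerivAt (fun u => Real.exp (a * G u) - κ * u)
        (Real.exp (a * G u) * (a * armSum (c (max u 0))) - κ) u := fun u => by
      have := (hEd u).sub ((hasDerivAt_id u).const_mul κ)
      rwa [mul_one] at this
    refine monotoneOn_of_deriv_nonneg (convex_Ici 0)
      (fun u _ => (hd u).continuousAt.continuousWithinAt)
      (fun u _ => (hd u).differentiableAt.differentiableWithinAt) fun u hu => ?_
    rw [interior_Ici] at hu
    have hu' : (0:ℝ) ≤ u := le_of_lt hu
    rw [(hd u).deriv, max_eq_left hu']
    have h1 := mul_le_mul_of_nonneg_left (hκ u hu') ha.le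
    rw [hκdef]
    linarith
  have hu : 0 ≤ Real.exp (a * y) / κ := by positivity
  refine ⟨Real.exp (a * y) / κ, hu, ?_⟩
  rw [← integral_max_eq (fun τ => armSum (c τ)) hu]
  have h1 := hEm self_mem_Ici hu hu
  simp only [hG0, mul_zero, Real.exp_zero, sub_zero] at h1
  rw [mul_div_cancel₀ _ hκpos.ne'] at h1
  have h2 : Real.exp (a * y) ≤ Real.exp (a * G (Real.exp (a * y) / κ)) := by linarith
  exact le_of_mul_le_mul_left (Real.exp_le_exp.1 h2) ha

end IsWeightedSolution

/-- time-change equivalence between the modified and the original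
Smoluchowski equations with limited aggregations. -/
theorem stmt2
    (c₀ : ℕ → ℕ → ℝ) (h₀pos : ∀ a m : ℕ, 0 ≤ c₀ a m) (h₀mass0 : ∀ a : ℕ, c₀ a 0 = 0)
    (h₀sum : Summable (fun p : ℕ × ℕ => (p.1 : ℝ) * c₀ p.1 p.2))
    (h₀arm : 0 < armSum c₀)
    (c : ℝ → ℕ → ℕ → ℝ) (hc : IsModifiedSmoluchowskiSolution c c₀) :
    -- (a) the ODE s' = A_{s(t)}, s(0) = 0 has a unique solution, a C¹-diffeomorphism
    -- of [0,∞), and c ∘ s solves the original equation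
    (∃ s : ℝ → ℝ,
      (s 0 = 0 ∧ ∀ t ∈ Ici (0:ℝ), 0 ≤ s t ∧
        HasDerivWithinAt s (armSum (c (s t))) (Ici 0) t) ∧
      (∀ s' : ℝ → ℝ,
        (s' 0 = 0 ∧ ∀ t ∈ Ici (0:ℝ), 0 ≤ s' t ∧
          HasDerivWithinAt s' (armSum (c (s' t))) (Ici 0) t) →
        EqOn s' s (Ici 0)) ∧
      IsC1DiffeoOfIci0 s ∧
      IsOriginalSmoluchowskiSolution (fun t => c (s t)) c₀) ∧
    -- (b) conversely, from a solution of the original equation one recovers the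
    -- solution of the modified one by the inverse time change
    ∀ b : ℝ → ℕ → ℕ → ℝ, IsOriginalSmoluchowskiSolution b c₀ →
      ∃ s : ℝ → ℝ,
        (s 0 = 0 ∧ ∀ t ∈ Ici (0:ℝ), 0 ≤ s t ∧
          HasDerivWithinAt s (armSum (b (s t)))⁻¹ (Ici 0) t) ∧
        (∀ s' : ℝ → ℝ,
          (s' 0 = 0 ∧ ∀ t ∈ Ici (0:ℝ), 0 ≤ s' t ∧
            HasDerivWithinAt s' (armSum (b (s' t)))⁻¹ (Ici 0) t) →
          EqOn s' s (Ici 0)) ∧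
        IsC1DiffeoOfIci0 s ∧
        IsModifiedSmoluchowskiSolution (fun t => b (s t)) c₀ := by
  have hw0 : ∀ y : ℝ, 0 < y → 0 ≤ y⁻¹ := fun y hy => (inv_pos.2 hy).le
  have hinv : ContinuousOn (fun y : ℝ => y⁻¹) (Ioi 0) :=
    continuousOn_id.inv₀ fun y hy => (mem_Ioi.1 hy).ne'
  constructor
  · have h := isModified_iff_isWeighted.1 hc
    have hprof := h.isArmProfile h₀mass0 measurable_inv hinv hw0
    have hA := hprof.continuousOn
    obtain ⟨s, hs, huniq, hdiff⟩ := exists_time_change hA (fun u hu => h.armSum_pos hu) fun y => by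
      have hA0 := h.armSum_pos le_rfl
      have hu : 0 ≤ max (y * armSum (c 0)) 0 := le_max_right _ _
      refine ⟨_, hu, ?_⟩
      have hmono : ∫ _ in (0:ℝ)..max (y * armSum (c 0)) 0, (armSum (c 0))⁻¹ ≤
          ∫ τ in (0:ℝ)..max (y * armSum (c 0)) 0, (armSum (c τ))⁻¹ := by
        refine intervalIntegral.integral_mono_on hu intervalIntegrable_const ?_ fun τ hτ => ?_
        · apply ContinuousOn.intervalIntegrable
          rw [uIcc_of_le hu]
          exact (hA.mono Icc_subset_Ici_self).inv₀ fun τ hτ => (h.armSum_pos hτ.1).ne'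
        · exact inv_anti₀ (h.armSum_pos hτ.1) (hprof.antitone self_mem_Ici hτ.1 hτ.1)
      refine le_trans ?_ hmono
      rw [intervalIntegral.integral_const, smul_eq_mul, sub_zero, ← div_eq_mul_inv,
        le_div_iff₀ hA0]
      exact le_max_left _ _
    refine ⟨s, hs, huniq, hdiff, isOriginal_iff_isWeighted.2 ?_⟩
    exact (h.comp_time_change hinv continuousOn_id hA hs.1 hs.2).congr_weight
      fun y hy => inv_mul_cancel₀ hy.ne'
  · intro b hb
    have h := isOriginal_iff_isWeighted.1 hb
    have hB := (h.isArmProfile h₀mass0 measurable_const continuousOn_const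
      fun _ _ => zero_le_one).continuousOn
    obtain ⟨s, hs, huniq, hdiff⟩ := exists_time_change (f := fun u => (armSum (b u))⁻¹)
      (hB.inv₀ fun u hu => (h.armSum_pos hu).ne') (fun u hu => inv_pos.2 (h.armSum_pos hu))
      fun y => by
        simpa only [inv_inv] using h.exists_le_integral_armSum h₀mass0 hB y
    refine ⟨s, hs, huniq, hdiff, isModified_iff_isWeighted.2 ?_⟩
    exact (h.comp_time_change continuousOn_const hinv hB hs.1 hs.2).congr_weight
      fun y _ => one_mul _
end

section
/- Limiting concentrations in the supercritical monodisperse case: let μ' be a measure on ℕ with ∑_a a·μ'(a) = 1, ∑_a a²·μ'(a) < ∞, μ'(1) > 0 and γ' = ∑_a a(a−2)·μ'(a) > 0. Let ν be the probability measure on ℕ given by ν(k) = (k+1)μ'(k+1), let c ∈ (0,1) be the unique solution of c·G_ν'(c) = G_ν(c), and β = 1/G_ν'(c). Let (cₜ) be the unique solution of the modified Smoluchowski equation with limited aggregations with monodisperse initial condition c₀(a,m) = μ'(a)·1_{m=1}. Then for every (a,m) ∈ S the limit c_∞(a,m) = lim_{t→∞} cₜ(a,m) exists, and for every m ≥ 2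 and every a ≥ 0, c_∞(a,m) = 1_{a=0} · (1/(m(m−1))) · β^{m−1} · ν^{*m}(m−2), where ν^{*m} is the m-fold convolution of ν (ν^{*m}(j) = ∑_{j₁+⋯+j_m=j} ν(j₁)⋯ν(j_m)). -/
open Set MeasureTheory intervalIntegral Filter Topology

/-- Generating function of a measure on ℕ. -/
noncomputable def Gfun (ν : ℕ → ℝ) (x : ℝ) : ℝ := ∑' k : ℕ, ν k * x ^ k

/-- Derivative series of the generating function: G_ν'(x) = ∑_{k≥1} k ν(k) x^{k-1}. -/
noncomputable def Gder (ν : ℕ → ℝ) (x : ℝ) : ℝ := ∑' k : ℕ, ((k : ℝ) + 1) * ν (k + 1) * x ^ k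

/-- Convolution of two measures on ℕ. -/
def convNat (f g : ℕ → ℝ) (j : ℕ) : ℝ := ∑ i ∈ Finset.range (j + 1), f i * g (j - i)

/-- m-fold convolution power ν^{*m}. -/
def convPow (f : ℕ → ℝ) : ℕ → ℕ → ℝ
  | 0 => fun j => if j = 0 then 1 else 0
  | n + 1 => convNat f (convPow f n)

namespace Smoluchowski

open PowerSeries
open scoped NNReal ENNReal

lemma derivative_mul {R : Type*} [CommSemiring R] (f g : R⟦X⟧) :
    d⁄dX R (f * g) = f * d⁄dX R g + g * d⁄dX R f := by
  exact (derivative R).leibniz f g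

/-- Coefficientwise derivative with respect to the inner variable of a double power series. -/
noncomputable def innerDeriv (f : ℝ≥0⟦X⟧⟦X⟧) : ℝ≥0⟦X⟧⟦X⟧ :=
  PowerSeries.mk fun k => d⁄dX ℝ≥0 (coeff k f)

@[simp] lemma coeff_innerDeriv (f : ℝ≥0⟦X⟧⟦X⟧) (k : ℕ) :
    coeff k (innerDeriv f) = d⁄dX ℝ≥0 (coeff k f) := coeff_mk _ _

lemma innerDeriv_add (f g : ℝ≥0⟦X⟧⟦X⟧) :
    innerDeriv (f + g) = innerDeriv f + innerDeriv g := by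
  ext1 k; simp

lemma innerDeriv_mul (f g : ℝ≥0⟦X⟧⟦X⟧) :
    innerDeriv (f * g) = f * innerDeriv g + g * innerDeriv f := by
  ext1 k
  rw [mul_comm g (innerDeriv f)]
  simp only [coeff_innerDeriv, coeff_mul, map_sum, Derivation.leibniz, map_add, smul_eq_mul,
    Finset.sum_add_distrib]
  congr 1
  exact Finset.sum_congr rfl fun p _ => mul_comm _ _

lemma innerDeriv_one : innerDeriv 1 = 0 := by
  ext1 k
  rw [coeff_innerDeriv, coeff_one]
  split_ifs <;> simp

lemma innerDeriv_pow_succ (f : ℝ≥0⟦X⟧⟦X⟧) (j : ℕ) :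
    innerDeriv (f ^ (j + 1)) = (j + 1) * (f ^ j * innerDeriv f) := by
  induction j with
  | zero => simp
  | succ j ih =>
    rw [pow_succ, innerDeriv_mul, ih]
    push_cast
    ring

/-- Coefficients of the formal solution `W` of the Burgers equation `∂_α W = W ∂_z W` with
`W = g` at `α = 0`. -/
noncomputable def burgersCoeff (g : ℝ≥0⟦X⟧) : ℕ → ℝ≥0⟦X⟧
  | 0 => g
  | k + 1 => C ((2 * ((k : ℝ≥0) + 1))⁻¹) *
      d⁄dX ℝ≥0 (∑ i : Fin (k + 1), burgersCoeff g i * burgersCoeff g (k - i))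
  decreasing_by all_goals omega

/-- The formal solution of the Burgers equation `∂_α W = W ∂_z W` with `W = g` at `α = 0`. -/
noncomputable def burgers (g : ℝ≥0⟦X⟧) : ℝ≥0⟦X⟧⟦X⟧ := PowerSeries.mk (burgersCoeff g)

lemma coeff_burgers_zero (g : ℝ≥0⟦X⟧) : coeff 0 (burgers g) = g := by
  rw [burgers, coeff_mk, burgersCoeff]

lemma coeff_coeff_burgers_succ (g : ℝ≥0⟦X⟧) (k n : ℕ) :
    coeff n (coeff (k + 1) (burgers g)) =
      (2 * ((k : ℝ≥0) + 1))⁻¹ * (coeff (n + 1) (coeff k (burgers g ^ 2)) * (n + 1)) := by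
  rw [burgers, coeff_mk, burgersCoeff, coeff_C_mul, coeff_derivative, sq, coeff_mul,
    Finset.Nat.sum_antidiagonal_eq_sum_range_succ_mk, Finset.sum_range]
  simp

lemma derivative_burgers (g : ℝ≥0⟦X⟧) :
    d⁄dX _ (burgers g) = burgers g * innerDeriv (burgers g) := by
  have h : innerDeriv (burgers g ^ 2) = 2 * (burgers g * innerDeriv (burgers g)) := by
    have := innerDeriv_pow_succ (burgers g) 1
    norm_num at this
    rw [this]
  ext k n
  have h2 := congrArg (fun f => coeff n (coeff k f)) h
  have e : (2 : ℝ≥0⟦X⟧⟦X⟧) = C (C 2) := by rw [map_ofNat, map_ofNat]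
  simp only [coeff_innerDeriv, coeff_derivative, e, coeff_C_mul] at h2
  rw [coeff_derivative, show ((k : ℝ≥0⟦X⟧) + 1) = C ((k : ℝ≥0) + 1) by simp, coeff_mul_C,
    coeff_coeff_burgers_succ, h2]
  field_simp

/-- Formal characteristic `z + α W`. -/
noncomputable def characteristic (g : ℝ≥0⟦X⟧) : ℝ≥0⟦X⟧⟦X⟧ := C X + X * burgers g

lemma derivative_characteristic (g : ℝ≥0⟦X⟧) :
    d⁄dX _ (characteristic g) = burgers g * innerDeriv (characteristic g) := by
  have h1 : innerDeriv (C (X : ℝ≥0⟦X⟧)) = 1 := by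
    ext1 k
    rw [coeff_innerDeriv, coeff_C, coeff_one]
    split_ifs <;> simp
  have h2 : innerDeriv (X : ℝ≥0⟦X⟧⟦X⟧) = 0 := by
    ext1 k
    rw [coeff_innerDeriv, coeff_X]
    split_ifs <;> simp
  rw [characteristic, innerDeriv_add, innerDeriv_mul, map_add, derivative_mul, h1, h2,
    derivative_burgers, derivative_C, derivative_X]
  ring

lemma derivative_pow_of_transport {W f : ℝ≥0⟦X⟧⟦X⟧} (hf : d⁄dX _ f = W * innerDeriv f) (j : ℕ) :
    d⁄dX _ (f ^ j) = W * innerDeriv (f ^ j) := by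
  induction j with
  | zero => simp [innerDeriv_one]
  | succ j ih =>
    rw [pow_succ, derivative_mul, innerDeriv_mul, ih, hf]
    ring

lemma coeff_succ_of_transport {W f : ℝ≥0⟦X⟧⟦X⟧} (hf : d⁄dX _ f = W * innerDeriv f) (k n : ℕ) :
    coeff n (coeff (k + 1) f) * (k + 1) = ∑ p ∈ Finset.HasAntidiagonal.antidiagonal k,
      ∑ q ∈ Finset.HasAntidiagonal.antidiagonal n,
        coeff q.1 (coeff p.1 W) * (coeff (q.2 + 1) (coeff p.2 f) * (q.2 + 1)) := by
  have h := congrArg (fun f => coeff n (coeff k f)) hf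
  simp only [coeff_derivative, coeff_mul, coeff_innerDeriv, map_sum] at h
  rw [← h, show ((k : ℝ≥0⟦X⟧) + 1) = C ((k : ℝ≥0) + 1) by simp, ← coeff_mul, coeff_mul_C]

/-- Formal functional equation `W = g (z + α W)`, coefficient by coefficient. -/
lemma coeff_coeff_burgers_eq_sum (g : ℝ≥0⟦X⟧) (k n J : ℕ) (hJ : n + k ≤ J) :
    coeff n (coeff k (burgers g)) = ∑ j ∈ Finset.range (J + 1),
      coeff j g * coeff n (coeff k (characteristic g ^ j)) := by
  induction k using Nat.strong_induction_on generalizing n with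
  | _ k ih =>
  rcases k with _ | k
  · have h : ∀ j, coeff 0 (characteristic g ^ j) = X ^ j := fun j => by
      rw [coeff_zero_eq_constantCoeff_apply, map_pow]
      simp [characteristic]
    simp only [h, coeff_burgers_zero, coeff_X_pow, mul_ite, mul_one, mul_zero]
    rw [Finset.sum_ite_eq, if_pos (by simp; omega)]
  · have hk : ((k : ℝ≥0) + 1) ≠ 0 := by positivity
    apply mul_right_cancel₀ hk
    rw [coeff_succ_of_transport (derivative_burgers g), Finset.sum_mul]
    simp_rw [mul_assoc, coeff_succ_of_transport
      (derivative_pow_of_transport (derivative_characteristic g) _), Finset.mul_sum]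
    conv_rhs => rw [Finset.sum_comm]
    refine Finset.sum_congr rfl fun p hp => ?_
    conv_rhs => rw [Finset.sum_comm]
    refine Finset.sum_congr rfl fun q hq => ?_
    rw [Finset.HasAntidiagonal.mem_antidiagonal] at hp hq
    rw [ih p.2 (by omega) (q.2 + 1) (by omega), Finset.sum_mul, Finset.mul_sum]
    exact Finset.sum_congr rfl fun j _ => by ring

/-- Lagrange inversion for powers of the formal solution. -/
lemma coeff_coeff_burgers_pow (g : ℝ≥0⟦X⟧) (k j n : ℕ) :
    ((j + 1 + k : ℕ) : ℝ≥0) * coeff n (coeff k (burgers g ^ (j + 1))) =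
      (j + 1) * (n + k).choose k * coeff (n + k) (g ^ (j + 1 + k)) := by
  induction k generalizing j n with
  | zero =>
    rw [coeff_zero_eq_constantCoeff_apply, map_pow, ← coeff_zero_eq_constantCoeff_apply,
      coeff_burgers_zero]
    simp
  | succ k ih =>
    have h1 : ((j : ℝ≥0⟦X⟧⟦X⟧) + 2) * d⁄dX _ (burgers g ^ (j + 1)) =
        (j + 1) * innerDeriv (burgers g ^ (j + 1 + 1)) := by
      rw [derivative_pow_of_transport (derivative_burgers g), innerDeriv_pow_succ,
        innerDeriv_pow_succ]
      push_cast
      ring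
    have h2 := congrArg (fun f => coeff n (coeff k f)) h1
    rw [show ((j : ℝ≥0⟦X⟧⟦X⟧) + 2) = C (C ((j : ℝ≥0) + 2)) by
        simp only [map_add, map_natCast, map_ofNat],
      show ((j : ℝ≥0⟦X⟧⟦X⟧) + 1) = C (C ((j : ℝ≥0) + 1)) by simp, coeff_C_mul, coeff_C_mul,
      coeff_C_mul, coeff_C_mul, coeff_innerDeriv, coeff_derivative, coeff_derivative,
      show ((k : ℝ≥0⟦X⟧) + 1) = C ((k : ℝ≥0) + 1) by simp, coeff_mul_C] at h2
    have h3 := ih (j + 1) (n + 1)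
    have h4 : ((n + 1 + k : ℕ).choose k : ℝ≥0) * (n + 1) =
        (n + (k + 1)).choose (k + 1) * (k + 1) := by
      have := Nat.choose_succ_right_eq (n + 1 + k) k
      rw [show n + 1 + k - k = n + 1 by omega] at this
      rw [show n + (k + 1) = n + 1 + k by omega]
      exact_mod_cast this.symm
    have hk : ((k : ℝ≥0) + 1) * (j + 2) ≠ 0 := by positivity
    apply mul_right_cancel₀ hk
    rw [show n + 1 + k = n + (k + 1) by omega, show j + 1 + 1 + k = j + 1 + (k + 1) by omega] at h3
    rw [show n + 1 + k = n + (k + 1) by omega] at h4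
    calc _ = ((j + 1 + (k + 1) : ℕ) : ℝ≥0) *
        (((j : ℝ≥0) + 2) * (coeff n (coeff (k + 1) (burgers g ^ (j + 1))) * (k + 1))) := by ring
      _ = (j + 1) * (n + 1) * (((j + 1 + (k + 1) : ℕ) : ℝ≥0) *
          coeff (n + 1) (coeff k (burgers g ^ (j + 1 + 1)))) := by rw [h2]; ring
      _ = (j + 1) * (j + 2) * (((n + (k + 1)).choose k : ℝ≥0) * (n + 1)) *
          coeff (n + (k + 1)) (g ^ (j + 1 + (k + 1))) := by rw [h3]; push_cast; ring
      _ = _ := by rw [h4]; ring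

lemma coeff_zero_coeff_burgers_sq (g : ℝ≥0⟦X⟧) (k : ℕ) :
    ((k : ℝ≥0) + 2) * coeff 0 (coeff k (burgers g ^ 2)) = 2 * coeff k (g ^ (k + 2)) := by
  have h := coeff_coeff_burgers_pow g k 1 0
  rw [show 1 + 1 + k = k + 2 by omega] at h
  simp only [zero_add, Nat.choose_self, Nat.reduceAdd] at h
  push_cast at h
  rw [h]
  ring

/-- Evaluation of a power series with coefficients in `ℝ≥0∞`. -/
noncomputable def evalSeries (x : ℝ≥0∞) : ℝ≥0∞⟦X⟧ →+* ℝ≥0∞ where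
  toFun f := ∑' n, coeff n f * x ^ n
  map_zero' := by simp
  map_one' := by
    rw [tsum_eq_single 0 (fun n hn => by simp [coeff_one, hn])]
    simp
  map_add' f g := by
    simp only [map_add, add_mul]
    exact ENNReal.tsum_add
  map_mul' f g := by
    simp_rw [← ENNReal.tsum_mul_right, ← ENNReal.tsum_mul_left]
    rw [← ENNReal.tsum_prod, ← Finset.HasAntidiagonal.sigmaAntidiagonalEquivProd.tsum_eq,
      ENNReal.tsum_sigma']
    refine tsum_congr fun n => ?_
    rw [coeff_mul, Finset.sum_mul, tsum_fintype, ← Finset.sum_coe_sort]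
    refine Finset.sum_congr rfl fun p _ => ?_
    simp only [Finset.HasAntidiagonal.sigmaAntidiagonalEquivProd_apply]
    have hx : x ^ n = x ^ p.1.1 * x ^ p.1.2 := by
      rw [← pow_add, Finset.HasAntidiagonal.mem_antidiagonal.1 p.2]
    rw [hx]
    ring

lemma evalSeries_apply (x : ℝ≥0∞) (f : ℝ≥0∞⟦X⟧) :
    evalSeries x f = ∑' n, coeff n f * x ^ n := rfl

lemma evalSeries_C (x a : ℝ≥0∞) : evalSeries x (C a) = a := by
  rw [evalSeries_apply, tsum_eq_single 0 (fun n hn => by simp [coeff_C, hn])]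
  simp

lemma evalSeries_X (x : ℝ≥0∞) : evalSeries x X = x := by
  rw [evalSeries_apply, tsum_eq_single 1 (fun n hn => by simp [coeff_X, hn])]
  simp

/-- Partial sums of a power series are submultiplicative. -/
lemma partialSum_mul_le (x : ℝ≥0∞) (f g : ℝ≥0∞⟦X⟧) (N : ℕ) :
    ∑ n ∈ Finset.range N, coeff n (f * g) * x ^ n ≤
      (∑ n ∈ Finset.range N, coeff n f * x ^ n) * ∑ n ∈ Finset.range N, coeff n g * x ^ n := by
  have h : ∀ n ∈ Finset.range N, coeff n (f * g) * x ^ n =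
      ∑ p ∈ (Finset.range N ×ˢ Finset.range N) with p.1 + p.2 = n,
        (coeff p.1 f * x ^ p.1) * (coeff p.2 g * x ^ p.2) := by
    intro n hn
    rw [Finset.mem_range] at hn
    rw [coeff_mul, Finset.sum_mul]
    refine Finset.sum_congr ?_ fun p hp => ?_
    · ext p
      simp only [Finset.HasAntidiagonal.mem_antidiagonal, Finset.mem_filter, Finset.mem_product,
        Finset.mem_range]
      omega
    · rw [← (Finset.mem_filter.1 hp).2, pow_add]
      ring
  rw [Finset.sum_congr rfl h, Finset.sum_mul_sum, ← Finset.sum_product']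
  rw [← Finset.sum_fiberwise_of_maps_to (s := Finset.range N ×ˢ Finset.range N)
    (t := Finset.range (2 * N)) (g := fun p => p.1 + p.2)]
  · exact Finset.sum_le_sum_of_subset (Finset.range_mono (by omega))
  · intro p hp
    simp only [Finset.mem_product, Finset.mem_range] at hp ⊢
    omega

lemma partialSum_pow_le (x : ℝ≥0∞) (f : ℝ≥0∞⟦X⟧) (N j : ℕ) :
    ∑ n ∈ Finset.range N, coeff n (f ^ j) * x ^ n ≤
      (∑ n ∈ Finset.range N, coeff n f * x ^ n) ^ j := by
  induction j with
  | zero =>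
    rcases N with _ | N
    · simp
    · rw [Finset.sum_range_succ']
      simp [coeff_one]
  | succ j ih =>
    rw [pow_succ, pow_succ]
    exact (partialSum_mul_le x _ _ N).trans (by gcongr)

/-- Evaluation of the inner variable of a double power series. -/
noncomputable def evalInner (z : ℝ≥0∞) : ℝ≥0⟦X⟧⟦X⟧ →+* ℝ≥0∞⟦X⟧ :=
  PowerSeries.map ((evalSeries z).comp (PowerSeries.map ENNReal.ofNNRealHom))

lemma coeff_evalInner (z : ℝ≥0∞) (f : ℝ≥0⟦X⟧⟦X⟧) (k : ℕ) :
    coeff k (evalInner z f) = ∑' n, ((coeff n (coeff k f) : ℝ≥0) : ℝ≥0∞) * z ^ n := by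
  simp [evalInner, evalSeries_apply]

lemma evalInner_characteristic (g : ℝ≥0⟦X⟧) (z : ℝ≥0∞) :
    evalInner z (characteristic g) = C z + X * evalInner z (burgers g) := by
  rw [characteristic, map_add, map_mul, evalInner, map_C, map_X, RingHom.comp_apply, map_X,
    evalSeries_X]

lemma coeff_evalInner_burgers (g : ℝ≥0⟦X⟧) (z : ℝ≥0∞) (k : ℕ) :
    coeff k (evalInner z (burgers g)) = ∑' j, ((coeff j g : ℝ≥0) : ℝ≥0∞) *
      coeff k (evalInner z (characteristic g) ^ j) := by
  have h : ∀ n, ((coeff n (coeff k (burgers g)) : ℝ≥0) : ℝ≥0∞) =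
      ∑' j, ((coeff j g : ℝ≥0) : ℝ≥0∞) *
        ((coeff n (coeff k (characteristic g ^ j)) : ℝ≥0) : ℝ≥0∞) := by
    intro n
    refine tendsto_nhds_unique (tendsto_const_nhds.congr' ?_)
      ((ENNReal.tendsto_nat_tsum _).comp (tendsto_add_atTop_nat 1))
    filter_upwards [eventually_ge_atTop (n + k)] with J hJ
    rw [coeff_coeff_burgers_eq_sum g k n J hJ]
    simp
  rw [coeff_evalInner]
  simp_rw [h, ← ENNReal.tsum_mul_right]
  rw [ENNReal.tsum_comm]
  refine tsum_congr fun j => ?_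
  rw [← map_pow, coeff_evalInner, ← ENNReal.tsum_mul_left]
  exact tsum_congr fun n => mul_assoc _ _ _

/-- Value of the formal Burgers solution at `(α, z)`. -/
noncomputable def burgersValue (g : ℝ≥0⟦X⟧) (α z : ℝ≥0∞) : ℝ≥0∞ :=
  evalSeries α (evalInner z (burgers g))

lemma burgersValue_eq (g : ℝ≥0⟦X⟧) (α z : ℝ≥0∞) :
    burgersValue g α z =
      ∑' k, ∑' n, ((coeff n (coeff k (burgers g)) : ℝ≥0) : ℝ≥0∞) * z ^ n * α ^ k := by
  simp_rw [burgersValue, evalSeries_apply, coeff_evalInner, ENNReal.tsum_mul_right]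

/-- Functional equation `W = G (z + α W)`. -/
lemma burgersValue_functional_eq (g : ℝ≥0⟦X⟧) (α z : ℝ≥0∞) :
    burgersValue g α z =
      ∑' j, ((coeff j g : ℝ≥0) : ℝ≥0∞) * (z + α * burgersValue g α z) ^ j := by
  have h : evalSeries α (evalInner z (characteristic g)) = z + α * burgersValue g α z := by
    rw [evalInner_characteristic, map_add, map_mul, evalSeries_C, evalSeries_X, burgersValue]
  rw [← h]
  conv_lhs => rw [burgersValue, evalSeries_apply]
  simp_rw [coeff_evalInner_burgers, ← ENNReal.tsum_mul_right]
  rw [ENNReal.tsum_comm]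
  refine tsum_congr fun j => ?_
  simp_rw [mul_assoc]
  rw [ENNReal.tsum_mul_left, ← evalSeries_apply, map_pow]

/-- Minimality of the solution of `x = z + α G x` built from the formal series. -/
lemma burgersValue_le_of_supersolution (g : ℝ≥0⟦X⟧) (α z c : ℝ≥0∞)
    (hc : z + α * ∑' j, ((coeff j g : ℝ≥0) : ℝ≥0∞) * c ^ j ≤ c) :
    burgersValue g α z ≤ ∑' j, ((coeff j g : ℝ≥0) : ℝ≥0∞) * c ^ j := by
  have step : ∀ N, ∑ n ∈ Finset.range N, coeff n (evalInner z (characteristic g)) * α ^ n ≤ c →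
      ∑ n ∈ Finset.range N, coeff n (evalInner z (burgers g)) * α ^ n ≤
        ∑' j, ((coeff j g : ℝ≥0) : ℝ≥0∞) * c ^ j := by
    intro N hN
    simp_rw [coeff_evalInner_burgers, ← ENNReal.tsum_mul_right]
    rw [← Summable.tsum_finsetSum fun _ _ => ENNReal.summable]
    refine ENNReal.tsum_le_tsum fun j => ?_
    simp_rw [mul_assoc, ← Finset.mul_sum]
    gcongr
    exact (partialSum_pow_le _ _ _ _).trans (by gcongr)
  have key : ∀ N, ∑ n ∈ Finset.range N,
      coeff n (evalInner z (characteristic g)) * α ^ n ≤ c := by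
    intro N
    induction N with
    | zero => simp
    | succ N ih =>
      refine le_trans ?_ hc
      rw [Finset.sum_range_succ', evalInner_characteristic, add_comm]
      refine add_le_add (by simp) ?_
      refine le_trans (le_of_eq ?_) (mul_le_mul_right (step N ih) α)
      rw [Finset.mul_sum]
      refine Finset.sum_congr rfl fun n _ => ?_
      rw [map_add, coeff_C, if_neg (Nat.succ_ne_zero n), zero_add, coeff_succ_X_mul, pow_succ]
      ring
  rw [burgersValue, evalSeries_apply, ENNReal.tsum_eq_iSup_nat]
  exact iSup_le fun N => step N (key N)

lemma absolutelyContinuousOnInterval_const (r a b : ℝ) :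
    AbsolutelyContinuousOnInterval (fun _ : ℝ => r) a b :=
  (contDiff_const (n := 1)).contDiffOn.absolutelyContinuousOnInterval

lemma absolutelyContinuousOnInterval_pow {f : ℝ → ℝ} {a b : ℝ}
    (hf : AbsolutelyContinuousOnInterval f a b) (k : ℕ) :
    AbsolutelyContinuousOnInterval (fun x => f x ^ k) a b := by
  induction k with
  | zero => simpa using absolutelyContinuousOnInterval_const 1 a b
  | succ k ih => simpa only [pow_succ] using ih.fun_mul hf

/-- Explicit solution of a linear integral equation with a source that is the integrating factor
times the derivative of a power of a primitive. -/
lemma eq_of_integral_equation {T a κ y₀ : ℝ} (k : ℕ) (hT : 0 ≤ T) {h y : ℝ → ℝ}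
    (hh : IntervalIntegrable h volume 0 T) (hy : ContinuousOn y (Icc 0 T))
    (hint : ∀ t ∈ Icc 0 T, y t = y₀ + ∫ s in (0 : ℝ)..t,
      (κ * (k + 1) * (∫ r in (0 : ℝ)..s, h r) ^ k * h s * Real.exp (-a * s) - a * y s)) :
    y T = Real.exp (-a * T) * (y₀ + κ * (∫ r in (0 : ℝ)..T, h r) ^ (k + 1)) := by
  set α : ℝ → ℝ := fun t => ∫ r in (0 : ℝ)..t, h r with hα
  have h0 : (0 : ℝ) ∈ uIcc 0 T := left_mem_uIcc
  have hαac : AbsolutelyContinuousOnInterval α 0 T :=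
    hh.absolutelyContinuousOnInterval_intervalIntegral h0
  set v : ℝ → ℝ := fun s =>
    κ * (k + 1) * α s ^ k * h s * Real.exp (-a * s) - a * y s with hv
  have hvint : IntervalIntegrable v volume 0 T := by
    refine IntervalIntegrable.sub ?_ ?_
    · refine IntervalIntegrable.mul_continuousOn ?_ (by fun_prop)
      refine hh.continuousOn_mul ?_
      exact continuousOn_const.mul (hαac.continuousOn.pow k)
    · exact ((uIcc_of_le hT ▸ hy : ContinuousOn y (uIcc 0 T)).const_mul a).intervalIntegrable
  set Y : ℝ → ℝ := fun t => y₀ + ∫ s in (0 : ℝ)..t, v s with hY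
  have hYac : AbsolutelyContinuousOnInterval Y 0 T :=
    (absolutelyContinuousOnInterval_const y₀ 0 T).fun_add
      (hvint.absolutelyContinuousOnInterval_intervalIntegral h0)
  have hexp : AbsolutelyContinuousOnInterval (fun t => Real.exp (a * t)) 0 T :=
    ContDiffOn.absolutelyContinuousOnInterval
      (ContDiff.contDiffOn (n := 1) (by fun_prop))
  have hD : AbsolutelyContinuousOnInterval
      (fun t => Real.exp (a * t) * Y t - κ * α t ^ (k + 1)) 0 T :=
    (hexp.fun_mul hYac).fun_sub
      ((absolutelyContinuousOnInterval_pow hαac (k + 1)).const_mul κ)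
  obtain ⟨C, hC⟩ := hD.const_of_ae_hasDerivAt_zero (by
    filter_upwards [hh.ae_hasDerivAt_integral, hvint.ae_hasDerivAt_integral] with x h1 h2 hx
    have d1 : HasDerivAt α (h x) x := h1 hx 0 h0
    have d2 : HasDerivAt Y (v x) x := (h2 hx 0 h0).const_add y₀
    have d3 : HasDerivAt (fun t => Real.exp (a * t)) (Real.exp (a * x) * a) x := by
      simpa using ((hasDerivAt_id x).const_mul a).exp
    have d := (d3.mul d2).sub ((d1.pow (k + 1)).const_mul κ)
    refine d.congr_deriv ?_
    have hYx : Y x = y x := (hint x (uIcc_of_le hT ▸ hx)).symm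
    have he : Real.exp (a * x) * Real.exp (-a * x) = 1 := by
      rw [← Real.exp_add]; simp
    rw [hYx, hv]
    push_cast
    linear_combination (κ * (k + 1) * α x ^ k * h x) * he)
  have e0 := hC 0 h0
  have eT := hC T right_mem_uIcc
  rw [← e0] at eT
  have hα0 : α 0 = 0 := by simp [hα]
  have hY0 : Y 0 = y₀ := by simp [hY]
  have hYT : Y T = y T := (hint T (right_mem_Icc.2 hT)).symm
  simp only [hα0, hY0, hYT, mul_zero, Real.exp_zero, one_mul, ne_eq, Nat.add_eq_zero_iff,
    one_ne_zero, and_false, not_false_eq_true, zero_pow, sub_zero] at eT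
  have he : Real.exp (-a * T) * Real.exp (a * T) = 1 := by
    rw [← Real.exp_add]; simp
  linear_combination Real.exp (-a * T) * eT - y T * he

lemma coagLoss_eq (u : ℕ → ℕ → ℝ) (a m : ℕ) :
    coagLoss u a m = a * u a m * armSum u := by
  rw [coagLoss, armSum, ← tsum_mul_left]
  exact tsum_congr fun p => by ring

lemma coagGain_one (u : ℕ → ℕ → ℝ) (a : ℕ) : coagGain u a 1 = 0 := by
  simp [coagGain]

lemma coagGain_eq_of_burgers (g : ℝ≥0⟦X⟧) (u : ℕ → ℕ → ℝ) (e α : ℝ) (k a : ℕ)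
    (hu : ∀ l ≤ k, ∀ n : ℕ, ((n : ℝ) + 1) * u (n + 1) (l + 1) =
      e ^ (n + 1) * α ^ l * (coeff n (coeff l (burgers g)) : ℝ≥0)) :
    coagGain u a (k + 2) =
      (1 / 2) * e ^ (a + 2) * α ^ k * (coeff a (coeff k (burgers g ^ 2)) : ℝ≥0) := by
  rw [coagGain, mul_assoc, mul_assoc]
  congr 1
  rw [Finset.sum_range_succ', Finset.sum_eq_zero (s := Finset.Ico 1 (k + 2)) (by simp), add_zero,
    sq, coeff_mul, map_sum]
  simp_rw [coeff_mul]
  rw [Finset.sum_comm, Finset.Nat.sum_antidiagonal_eq_sum_range_succ_mk]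
  simp_rw [Finset.Nat.sum_antidiagonal_eq_sum_range_succ_mk]
  push_cast
  simp_rw [Finset.sum_Ico_eq_sum_range, Finset.mul_sum]
  refine Finset.sum_congr (by simp) fun l hl => Finset.sum_congr rfl fun p hp => ?_
  rw [Finset.mem_range] at hp hl
  have h1 := hu l (by omega) p
  have h2 := hu (k - l) (by omega) (a - p)
  rw [show a + 1 - p = a - p + 1 by omega, show k + 2 - (1 + l) = k - l + 1 by omega,
    add_comm 1 l]
  have h3 : e ^ (a + 2) = e ^ (p + 1) * e ^ (a - p + 1) := by
    rw [← pow_add]; congr 1; omega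
  have h4 : α ^ k = α ^ l * α ^ (k - l) := by
    rw [← pow_add]; congr 1; omega
  push_cast
  rw [h3, h4]
  linear_combination (e ^ (p + 1) * α ^ l * (coeff p (coeff l (burgers g)) : ℝ≥0)) * h2 +
    (((a - p : ℕ) : ℝ) + 1) * u (a - p + 1) (k - l + 1) * h1

lemma ofReal_armSum (g : ℝ≥0⟦X⟧) (u : ℕ → ℕ → ℝ) {e α : ℝ} (he : 0 ≤ e) (hα : 0 ≤ α)
    (hnn : ∀ a m, 0 ≤ u a m) (hu0 : ∀ a, u a 0 = 0) (hA : 0 < armSum u)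
    (hu : ∀ l n : ℕ, ((n : ℝ) + 1) * u (n + 1) (l + 1) =
      e ^ (n + 1) * α ^ l * (coeff n (coeff l (burgers g)) : ℝ≥0)) :
    ENNReal.ofReal (armSum u) =
      ENNReal.ofReal e * burgersValue g (ENNReal.ofReal α) (ENNReal.ofReal e) := by
  have hs : Summable fun p : ℕ × ℕ => (p.1 : ℝ) * u p.1 p.2 := by
    by_contra h
    exact hA.ne' (tsum_eq_zero_of_not_summable h)
  rw [armSum, ENNReal.ofReal_tsum_of_nonneg (fun p => mul_nonneg (by positivity) (hnn _ _)) hs,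
    ENNReal.tsum_prod', burgersValue_eq, tsum_eq_zero_add' ENNReal.summable]
  simp only [CharP.cast_eq_zero, zero_mul, ENNReal.ofReal_zero, tsum_zero, zero_add]
  rw [ENNReal.tsum_comm, tsum_eq_zero_add' ENNReal.summable]
  simp only [hu0, mul_zero, ENNReal.ofReal_zero, tsum_zero, zero_add]
  simp_rw [← ENNReal.tsum_mul_left]
  refine tsum_congr fun l => tsum_congr fun n => ?_
  have := hu l n
  push_cast
  rw [this, ENNReal.ofReal_mul (by positivity), ENNReal.ofReal_mul (by positivity),
    ENNReal.ofReal_pow he, ENNReal.ofReal_pow hα, ENNReal.ofReal_coe_nnreal]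
  ring

section Solution

variable {c : ℝ → ℕ → ℕ → ℝ} {c₀ : ℕ → ℕ → ℝ}

lemma armSum_nonneg (hc : IsModifiedSmoluchowskiSolution c c₀) {t : ℝ} (ht : 0 ≤ t) :
    0 ≤ armSum (c t) :=
  tsum_nonneg fun _ => mul_nonneg (by positivity) (hc.1 t ht _ _)

lemma sInf_armSum_le (hc : IsModifiedSmoluchowskiSolution c c₀) {s t : ℝ} (hs : 0 ≤ s)
    (hst : s ≤ t) : sInf ((fun s => armSum (c s)) '' Icc 0 t) ≤ armSum (c s) := by
  refine csInf_le ⟨0, ?_⟩ (mem_image_of_mem _ ⟨hs, hst⟩)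
  rintro _ ⟨r, hr, rfl⟩
  exact armSum_nonneg hc hr.1

lemma armSum_pos (hc : IsModifiedSmoluchowskiSolution c c₀) {t : ℝ} (ht : 0 ≤ t) :
    0 < armSum (c t) :=
  (hc.2.2.2 t ht).1.trans_le (sInf_armSum_le hc ht le_rfl)

lemma intervalIntegrable_exp_mul_inv_armSum (hc : IsModifiedSmoluchowskiSolution c c₀) {t : ℝ}
    (ht : 0 ≤ t) :
    IntervalIntegrable (fun s => Real.exp (-2 * s) * (armSum (c s))⁻¹) volume 0 t := by
  refine IntervalIntegrable.continuousOn_mul ?_ (by fun_prop)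
  rw [intervalIntegrable_iff_integrableOn_Ioc_of_le ht]
  have hm := ((intervalIntegrable_iff_integrableOn_Ioc_of_le ht).1
    (hc.2.2.2 t ht).2.2.1).aestronglyMeasurable.aemeasurable
  have hm' : AEMeasurable (fun s => (armSum (c s))⁻¹) (volume.restrict (Ioc 0 t)) := by
    refine (hm.sqrt.inv).congr ?_
    filter_upwards [ae_restrict_mem measurableSet_Ioc] with s hs
    simp [Real.sqrt_sq (armSum_nonneg hc hs.1.le)]
  refine Integrable.of_bound hm'.aestronglyMeasurable
    (sInf ((fun s => armSum (c s)) '' Icc 0 t))⁻¹ ?_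
  filter_upwards [ae_restrict_mem measurableSet_Ioc] with s hs
  rw [Real.norm_of_nonneg (inv_nonneg.2 (armSum_nonneg hc hs.1.le))]
  exact inv_anti₀ (hc.2.2.2 t ht).1 (sInf_armSum_le hc hs.1.le hs.2)

/-- The intrinsic clock `∫₀ᵗ e^{-2s} / ⟨c_s, a⟩ ds`. -/
noncomputable def clock (c : ℝ → ℕ → ℕ → ℝ) (t : ℝ) : ℝ :=
  ∫ s in (0 : ℝ)..t, Real.exp (-2 * s) * (armSum (c s))⁻¹

lemma clock_nonneg (hc : IsModifiedSmoluchowskiSolution c c₀) {t : ℝ} (ht : 0 ≤ t) :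
    0 ≤ clock c t :=
  intervalIntegral.integral_nonneg ht fun _ hs =>
    mul_nonneg (Real.exp_nonneg _) (inv_nonneg.2 (armSum_nonneg hc hs.1))

lemma continuousOn_clock (hc : IsModifiedSmoluchowskiSolution c c₀) {T : ℝ} (hT : 0 ≤ T) :
    ContinuousOn (clock c) (Icc 0 T) := by
  have := ((intervalIntegrable_exp_mul_inv_armSum hc
    hT).absolutelyContinuousOnInterval_intervalIntegral left_mem_uIcc).continuousOn
  rwa [uIcc_of_le hT] at this

/-- Coefficients of the explicit monodisperse solution. -/
noncomputable def solutionCoeff (μ : ℕ → ℝ) (g : ℝ≥0⟦X⟧) (a : ℕ) : ℕ → ℝ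
  | 0 => μ a
  | k + 1 => (coeff a (coeff k (burgers g ^ 2)) : ℝ≥0) / (2 * ((k : ℝ) + 1))

lemma succ_mul_solutionCoeff {μ : ℕ → ℝ} {g : ℝ≥0⟦X⟧}
    (hg : ∀ n : ℕ, ((coeff n g : ℝ≥0) : ℝ) = (n + 1) * μ (n + 1)) (k n : ℕ) :
    ((n : ℝ) + 1) * solutionCoeff μ g (n + 1) k = (coeff n (coeff k (burgers g)) : ℝ≥0) := by
  rcases k with _ | k
  · rw [solutionCoeff, coeff_burgers_zero, hg]
  · rw [solutionCoeff, coeff_coeff_burgers_succ]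
    push_cast
    field_simp

lemma integral_equation (hc : IsModifiedSmoluchowskiSolution c c₀) {t : ℝ} (ht : 0 ≤ t)
    (a k : ℕ) :
    c t a (k + 1) = c₀ a (k + 1) + ∫ s in (0 : ℝ)..t,
      ((armSum (c s))⁻¹ * coagGain (c s) a (k + 1) - a * c s a (k + 1)) := by
  rw [← sub_eq_iff_eq_add', (hc.2.2.2 t ht).2.2.2 a (k + 1) (by omega)]
  refine intervalIntegral.integral_congr fun s hs => ?_
  rw [uIcc_of_le ht] at hs
  have := (armSum_pos hc hs.1).ne'
  simp only [coagLoss_eq]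
  field_simp

variable {μ : ℕ → ℝ} {g : ℝ≥0⟦X⟧}

/-- Explicit form of a monodisperse solution in terms of its clock. -/
lemma monodisperse_eq
    (hc : IsModifiedSmoluchowskiSolution c (fun a m => if m = 1 then μ a else 0))
    (hg : ∀ n : ℕ, ((coeff n g : ℝ≥0) : ℝ) = (n + 1) * μ (n + 1)) (k a : ℕ) {t : ℝ}
    (ht : 0 ≤ t) :
    c t a (k + 1) = Real.exp (-a * t) * (clock c t ^ k * solutionCoeff μ g a k) := by
  induction k using Nat.strong_induction_on generalizing a t with
  | _ k ih =>
  have hcont : ContinuousOn (fun t => c t a (k + 1)) (Icc 0 t) :=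
    (hc.2.2.1 a (k + 1)).mono Icc_subset_Ici_self
  have hh := intervalIntegrable_exp_mul_inv_armSum hc ht
  rcases k with _ | k
  · rw [eq_of_integral_equation (a := a) (κ := 0) (y₀ := μ a) 0 ht hh hcont]
    · simp [solutionCoeff]
    · intro r hr
      rw [integral_equation hc hr.1]
      simp [coagGain_one]
  · rw [eq_of_integral_equation (a := a) (κ := solutionCoeff μ g a (k + 1)) (y₀ := 0) k ht hh
      hcont]
    · rw [← clock]; ring
    · intro r hr
      rw [integral_equation hc hr.1]
      simp only [Nat.add_eq_right, Nat.add_eq_zero_iff, one_ne_zero, and_false, if_false]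
      congr 1
      refine intervalIntegral.integral_congr fun s hs => ?_
      rw [uIcc_of_le hr.1] at hs
      have hgain := coagGain_eq_of_burgers g (c s) (Real.exp (-s)) (clock c s) k a (by
        intro l hl n
        rw [ih l (by omega) (n + 1) hs.1, ← succ_mul_solutionCoeff hg, ← Real.exp_nat_mul]
        push_cast
        rw [show -((n : ℝ) + 1) * s = (n + 1) * -s by ring]
        ring)
      rw [hgain, ← clock, solutionCoeff, ← Real.exp_nat_mul]
      push_cast
      rw [show ((a : ℝ) + 2) * -s = -2 * s + -a * s by ring, Real.exp_add]
      field_simp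

lemma ofReal_armSum_eq
    (hc : IsModifiedSmoluchowskiSolution c (fun a m => if m = 1 then μ a else 0))
    (hg : ∀ n : ℕ, ((coeff n g : ℝ≥0) : ℝ) = (n + 1) * μ (n + 1)) {t : ℝ} (ht : 0 ≤ t) :
    ENNReal.ofReal (Real.exp t * armSum (c t)) =
      burgersValue g (ENNReal.ofReal (clock c t)) (ENNReal.ofReal (Real.exp (-t))) := by
  rw [ENNReal.ofReal_mul (by positivity), ofReal_armSum g (c t) (Real.exp_nonneg (-t))
    (clock_nonneg hc ht) (hc.1 t ht) (hc.2.1 t ht) (armSum_pos hc ht), ← mul_assoc,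
    ← ENNReal.ofReal_mul (by positivity), ← Real.exp_add]
  · simp
  · intro l n
    rw [monodisperse_eq hc hg l (n + 1) ht, ← succ_mul_solutionCoeff hg, ← Real.exp_nat_mul]
    push_cast
    rw [show -((n : ℝ) + 1) * t = (n + 1) * -t by ring]
    ring

lemma tsum_ofReal_eq_tsum {ν : ℕ → ℝ} (hg : ∀ n : ℕ, ((coeff n g : ℝ≥0) : ℝ) = ν n) {x : ℝ}
    (hx : 0 ≤ x) (j : ℕ) :
    ((coeff j g : ℝ≥0) : ℝ≥0∞) * ENNReal.ofReal x ^ j = ENNReal.ofReal (ν j * x ^ j) := by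
  rw [← hg, ENNReal.ofReal_mul (by positivity), ENNReal.ofReal_pow hx, ENNReal.ofReal_coe_nnreal]

variable {ν : ℕ → ℝ}

/-- The rescaled arm concentration is the value of the generating function on characteristics. -/
lemma hasSum_armSum
    (hc : IsModifiedSmoluchowskiSolution c (fun a m => if m = 1 then μ a else 0))
    (hν : ∀ k, ν k = ((k : ℝ) + 1) * μ (k + 1))
    (hg : ∀ n : ℕ, ((coeff n g : ℝ≥0) : ℝ) = ν n) {t : ℝ} (ht : 0 ≤ t) :
    HasSum (fun j => ν j * (Real.exp (-t) + clock c t * (Real.exp t * armSum (c t))) ^ j)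
      (Real.exp t * armSum (c t)) := by
  have hg' : ∀ n : ℕ, ((coeff n g : ℝ≥0) : ℝ) = (n + 1) * μ (n + 1) := fun n => by
    rw [hg, hν]
  have hα := clock_nonneg hc ht
  have hA := armSum_nonneg hc ht
  set x := Real.exp (-t) + clock c t * (Real.exp t * armSum (c t)) with hx
  have hx0 : 0 ≤ x := by positivity
  have h := burgersValue_functional_eq g (ENNReal.ofReal (clock c t))
    (ENNReal.ofReal (Real.exp (-t)))
  rw [← ofReal_armSum_eq hc hg' ht, ← ENNReal.ofReal_mul hα,
    ← ENNReal.ofReal_add (by positivity) (by positivity), ← hx] at h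
  simp_rw [tsum_ofReal_eq_tsum hg hx0] at h
  have hnn : ∀ j, 0 ≤ ν j * x ^ j := fun j => by rw [← hg]; positivity
  have hs : Summable fun j => ν j * x ^ j := by
    have := ENNReal.summable_toReal (h ▸ ENNReal.ofReal_ne_top)
    simpa only [ENNReal.toReal_ofReal (hnn _)] using this
  rw [← ENNReal.ofReal_tsum_of_nonneg hnn hs,
    ENNReal.ofReal_eq_ofReal_iff (by positivity) (tsum_nonneg hnn)] at h
  rw [h]
  exact hs.hasSum

lemma armSum_le_of_supersolution
    (hc : IsModifiedSmoluchowskiSolution c (fun a m => if m = 1 then μ a else 0))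
    (hν : ∀ k, ν k = ((k : ℝ) + 1) * μ (k + 1))
    (hg : ∀ n : ℕ, ((coeff n g : ℝ≥0) : ℝ) = ν n) {t : ℝ} (ht : 0 ≤ t) {y : ℝ} (hy : 0 ≤ y)
    (hs : Summable fun j => ν j * y ^ j)
    (hle : Real.exp (-t) + clock c t * Gfun ν y ≤ y) :
    Real.exp t * armSum (c t) ≤ Gfun ν y := by
  have hg' : ∀ n : ℕ, ((coeff n g : ℝ≥0) : ℝ) = (n + 1) * μ (n + 1) := fun n => by
    rw [hg, hν]
  have hα := clock_nonneg hc ht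
  have hnn : ∀ j, 0 ≤ ν j * y ^ j := fun j => by rw [← hg]; positivity
  have hG : 0 ≤ Gfun ν y := tsum_nonneg hnn
  have h := burgersValue_le_of_supersolution g (ENNReal.ofReal (clock c t))
    (ENNReal.ofReal (Real.exp (-t))) (ENNReal.ofReal y)
  simp_rw [tsum_ofReal_eq_tsum hg hy] at h
  rw [← ENNReal.ofReal_tsum_of_nonneg hnn hs, ← ofReal_armSum_eq hc hg' ht,
    ← ENNReal.ofReal_mul hα, ← ENNReal.ofReal_add (by positivity) (by positivity)] at h
  exact (ENNReal.ofReal_le_ofReal_iff hG).1 (h (ENNReal.ofReal_le_ofReal hle))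

end Solution


lemma coeff_pow_eq_convPow {g : ℝ≥0⟦X⟧} {ν : ℕ → ℝ}
    (hg : ∀ n : ℕ, ((coeff n g : ℝ≥0) : ℝ) = ν n) (m n : ℕ) :
    ((coeff n (g ^ m) : ℝ≥0) : ℝ) = convPow ν m n := by
  induction m generalizing n with
  | zero =>
    rw [pow_zero, coeff_one, convPow]
    split_ifs <;> simp_all
  | succ m ih =>
    rw [pow_succ', coeff_mul, Finset.Nat.sum_antidiagonal_eq_sum_range_succ_mk, convPow, convNat]
    push_cast
    exact Finset.sum_congr rfl fun i _ => by rw [hg, ih]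

/-- Tangent line inequality for generating functions, along a tangent through the origin. -/
lemma gder_mul_le_gfun {ν : ℕ → ℝ} (hν : ∀ k, 0 ≤ ν k) {y x : ℝ} (hy : 0 ≤ y) (hx : 0 ≤ x)
    (hs : Summable fun k => ν k * y ^ k)
    (hs' : Summable fun k : ℕ => ((k : ℝ) + 1) * ν (k + 1) * y ^ k)
    (hsx : Summable fun k => ν k * x ^ k) (heq : y * Gder ν y = Gfun ν y) :
    Gder ν y * x ≤ Gfun ν x := by
  have hd : HasSum (fun k : ℕ => (k : ℝ) * ν k * y ^ (k - 1)) (Gder ν y) := by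
    rw [← hasSum_nat_add_iff' 1]
    simpa [Gder] using hs'.hasSum
  have ht : HasSum (fun k : ℕ => ν k * y ^ k + (k : ℝ) * ν k * y ^ (k - 1) * (x - y))
      (Gder ν y * x) := by
    convert hs.hasSum.add (hd.mul_right (x - y)) using 1
    rw [← Gfun, ← heq]
    ring
  refine hasSum_le (fun k => ?_) ht hsx.hasSum
  have key : y ^ k + k * y ^ (k - 1) * (x - y) ≤ x ^ k := by
    rcases k with _ | k
    · simp
    induction k with
    | zero => simp
    | succ k ih =>
      have h0 := mul_le_mul_of_nonneg_left ih hx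
      have h1 : 0 ≤ (k + 1 : ℝ) * y ^ k * (x - y) ^ 2 := by positivity
      simp only [Nat.add_sub_cancel] at h0 ⊢
      push_cast at h0 ⊢
      calc _ = x * (y ^ (k + 1) + (k + 1) * y ^ k * (x - y)) -
            (k + 1 : ℝ) * y ^ k * (x - y) ^ 2 := by ring
        _ ≤ x * x ^ (k + 1) := by linarith
        _ = _ := by ring
  have := mul_le_mul_of_nonneg_left key (hν k)
  linarith

section Limit

variable {c : ℝ → ℕ → ℕ → ℝ} {μ ν : ℕ → ℝ} {g : ℝ≥0⟦X⟧} {y : ℝ}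

lemma clock_le
    (hc : IsModifiedSmoluchowskiSolution c (fun a m => if m = 1 then μ a else 0))
    (hν : ∀ k, ν k = ((k : ℝ) + 1) * μ (k + 1))
    (hg : ∀ n : ℕ, ((coeff n g : ℝ≥0) : ℝ) = ν n) (hy : 0 ≤ y)
    (hs : Summable fun k => ν k * y ^ k)
    (hs' : Summable fun k : ℕ => ((k : ℝ) + 1) * ν (k + 1) * y ^ k)
    (heq : y * Gder ν y = Gfun ν y) (hpos : 0 < Gder ν y) {t : ℝ} (ht : 0 ≤ t) :
    clock c t ≤ 1 / Gder ν y := by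
  have hA := armSum_pos hc ht
  have hα := clock_nonneg hc ht
  have hsum := hasSum_armSum hc hν hg ht
  set w := Real.exp t * armSum (c t) with hw
  have hw0 : 0 < w := by positivity
  have h := gder_mul_le_gfun (fun k => hg k ▸ NNReal.coe_nonneg _) hy
    (by positivity) hs hs' hsum.summable heq
  rw [Gfun, hsum.tsum_eq] at h
  rw [le_div_iff₀ hpos]
  by_contra! hlt
  have h1 := Real.exp_pos (-t)
  nlinarith [mul_lt_mul_of_pos_right hlt hw0, mul_pos hpos h1]

lemma le_clock
    (hc : IsModifiedSmoluchowskiSolution c (fun a m => if m = 1 then μ a else 0))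
    (hν : ∀ k, ν k = ((k : ℝ) + 1) * μ (k + 1))
    (hg : ∀ n : ℕ, ((coeff n g : ℝ≥0) : ℝ) = ν n) (hy : 0 ≤ y) (hy1 : y ≤ 1)
    (hs : Summable fun k => ν k * y ^ k) (hpos : 0 < Gfun ν y) {T : ℝ} (hT : 0 ≤ T) :
    (y - Real.exp (-T)) / Gfun ν y ≤ clock c T := by
  rw [div_le_iff₀ hpos]
  by_contra! hlt
  have hcont : ContinuousOn (fun r => y - Real.exp (-r) - clock c r * Gfun ν y) (Icc 0 T) :=
    ContinuousOn.sub (by fun_prop) ((continuousOn_clock hc hT).mul_const _)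
  have hcomp : IsCompact (Icc 0 T ∩ {r | y - Real.exp (-r) - clock c r * Gfun ν y ≤ 0}) :=
    isCompact_Icc.of_isClosed_subset
      (hcont.preimage_isClosed_of_isClosed isClosed_Icc isClosed_Iic) inter_subset_left
  obtain ⟨s, ⟨⟨hs0, hsT⟩, hsle⟩, hsmax⟩ := hcomp.exists_isGreatest
    ⟨0, ⟨le_rfl, hT⟩, by simp [clock, hy1]⟩
  rw [mem_ofPred_eq] at hsle
  have hsub : Icc s T ⊆ Icc 0 T := Icc_subset_Icc_left hs0
  have hint := intervalIntegrable_exp_mul_inv_armSum hc hT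
  have hint0 := intervalIntegrable_exp_mul_inv_armSum hc hs0
  have hintsT : IntervalIntegrable (fun s => Real.exp (-2 * s) * (armSum (c s))⁻¹) volume s T :=
    hint0.symm.trans hint
  have hexp : ∫ r in s..T, Real.exp (-r) / Gfun ν y =
      (Real.exp (-s) - Real.exp (-T)) / Gfun ν y := by
    rw [intervalIntegral.integral_div, intervalIntegral.integral_comp_neg (fun r => Real.exp r),
      integral_exp]
  have hmono : ∫ r in s..T, Real.exp (-r) / Gfun ν y ≤
      ∫ r in s..T, Real.exp (-2 * r) * (armSum (c r))⁻¹ := by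
    refine intervalIntegral.integral_mono_on_of_le_Ioo hsT
      (Continuous.intervalIntegrable (by fun_prop) _ _) hintsT fun r hr => ?_
    have hr0 : 0 ≤ r := hs0.trans hr.1.le
    have hru : 0 < y - Real.exp (-r) - clock c r * Gfun ν y := by
      by_contra! h
      exact absurd (hsmax ⟨⟨hr0, hr.2.le⟩, h⟩) (not_le.2 hr.1)
    have hle := armSum_le_of_supersolution hc hν hg hr0 hy hs (by linarith)
    have hA := armSum_pos hc hr0
    rw [← div_eq_mul_inv, div_le_div_iff₀ hpos hA]
    have he : Real.exp (-r) = Real.exp (-2 * r) * Real.exp r := by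
      rw [← Real.exp_add]; ring_nf
    rw [he, mul_assoc]
    exact mul_le_mul_of_nonneg_left hle (Real.exp_nonneg _)
  have hadd := intervalIntegral.integral_add_adjacent_intervals hint0 hintsT
  rw [← clock, ← clock] at hadd
  rw [hexp, div_le_iff₀ hpos] at hmono
  rw [← hadd] at hlt
  linarith

lemma tendsto_clock
    (hc : IsModifiedSmoluchowskiSolution c (fun a m => if m = 1 then μ a else 0))
    (hν : ∀ k, ν k = ((k : ℝ) + 1) * μ (k + 1))
    (hg : ∀ n : ℕ, ((coeff n g : ℝ≥0) : ℝ) = ν n) (hy : 0 ≤ y) (hy1 : y ≤ 1)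
    (hs : Summable fun k => ν k * y ^ k)
    (hs' : Summable fun k : ℕ => ((k : ℝ) + 1) * ν (k + 1) * y ^ k)
    (heq : y * Gder ν y = Gfun ν y) (hpos : 0 < Gfun ν y) :
    Tendsto (clock c) atTop (𝓝 (1 / Gder ν y)) := by
  have hder : 0 < Gder ν y := pos_of_mul_pos_right (heq ▸ hpos) hy
  have hy0 : y ≠ 0 := by
    rintro rfl
    simp [← heq] at hpos
  have hlim : Tendsto (fun t => (y - Real.exp (-t)) / Gfun ν y) atTop (𝓝 (1 / Gder ν y)) := by
    have h := ((Real.tendsto_exp_neg_atTop_nhds_zero).const_sub y).div_const (Gfun ν y)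
    have hval : y / Gfun ν y = 1 / Gder ν y := by
      rw [← heq, div_mul_eq_div_div, div_self hy0]
    rwa [sub_zero, hval] at h
  refine tendsto_of_tendsto_of_tendsto_of_le_of_le' hlim tendsto_const_nhds ?_ ?_
  · filter_upwards [eventually_ge_atTop 0] with t ht
    exact le_clock hc hν hg hy hy1 hs hpos ht
  · filter_upwards [eventually_ge_atTop 0] with t ht
    exact clock_le hc hν hg hy hs hs' heq hder ht

lemma tendsto_monodisperse
    (hc : IsModifiedSmoluchowskiSolution c (fun a m => if m = 1 then μ a else 0))
    (hν : ∀ k, ν k = ((k : ℝ) + 1) * μ (k + 1))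
    (hg : ∀ n : ℕ, ((coeff n g : ℝ≥0) : ℝ) = ν n) {β : ℝ}
    (hβ : Tendsto (clock c) atTop (𝓝 β)) (a k : ℕ) :
    Tendsto (fun t => c t a (k + 1)) atTop
      (𝓝 (if a = 0 then β ^ k * solutionCoeff μ g 0 k else 0)) := by
  have hprod := (hβ.pow k).mul_const (solutionCoeff μ g a k)
  have hE : Tendsto (fun t : ℝ => Real.exp (-a * t)) atTop (𝓝 (if a = 0 then 1 else 0)) := by
    split_ifs with ha
    · simp [ha]
    · have ha' : (0 : ℝ) < a := by exact_mod_cast Nat.pos_of_ne_zero ha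
      exact Real.tendsto_exp_atBot.comp
        (tendsto_id.const_mul_atTop_of_neg (neg_lt_zero.2 ha'))
  have h := hE.mul hprod
  have hval : (if a = 0 then (1 : ℝ) else 0) * (β ^ k * solutionCoeff μ g a k) =
      if a = 0 then β ^ k * solutionCoeff μ g 0 k else 0 := by
    split_ifs with ha <;> simp [ha]
  rw [hval] at h
  refine h.congr' ?_
  filter_upwards [eventually_ge_atTop 0] with t ht
  rw [monodisperse_eq hc (fun n => by rw [hg, hν]) k a ht]

lemma solutionCoeff_zero_succ (hg : ∀ n : ℕ, ((coeff n g : ℝ≥0) : ℝ) = ν n) (k : ℕ) :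
    solutionCoeff μ g 0 (k + 1) = 1 / (((k : ℝ) + 2) * (k + 1)) * convPow ν (k + 2) k := by
  have h := congrArg NNReal.toReal (coeff_zero_coeff_burgers_sq g k)
  push_cast at h
  rw [coeff_pow_eq_convPow hg] at h
  rw [solutionCoeff]
  field_simp
  linarith

end Limit

end Smoluchowski

/-- limiting concentrations in the supercritical monodisperse case. -/
theorem stmt3
    (μ' : ℕ → ℝ) (hμ'pos : ∀ a, 0 ≤ μ' a)
    (hμ'm1sum : Summable (fun a : ℕ => (a : ℝ) * μ' a))
    (hμ'm1 : ∑' a : ℕ, (a : ℝ) * μ' a = 1)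
    (hμ'm2sum : Summable (fun a : ℕ => (a : ℝ) ^ 2 * μ' a))
    (hμ'1 : 0 < μ' 1)
    (hγ' : 0 < ∑' a : ℕ, (a : ℝ) * ((a : ℝ) - 2) * μ' a)
    (ν : ℕ → ℝ) (hν : ∀ k, ν k = ((k : ℝ) + 1) * μ' (k + 1))
    (cc : ℝ) (hcc : cc ∈ Ioo (0:ℝ) 1) (hcceq : cc * Gder ν cc = Gfun ν cc)
    (β : ℝ) (hβ : β = 1 / Gder ν cc)
    (c : ℝ → ℕ → ℕ → ℝ)
    (hc : IsModifiedSmoluchowskiSolution c (fun a m => if m = 1 then μ' a else 0)) :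
    -- the limiting concentrations exist
    (∀ a m : ℕ, 1 ≤ m → ∃ L : ℝ, Tendsto (fun t => c t a m) atTop (nhds L)) ∧
    -- and for m ≥ 2 they are given by the explicit formula
    ∀ a m : ℕ, 2 ≤ m →
      Tendsto (fun t => c t a m) atTop
        (nhds (if a = 0 then
          (1 / ((m : ℝ) * ((m : ℝ) - 1))) * β ^ (m - 1) * convPow ν m (m - 2)
        else 0)) := by
  have hνnn : ∀ k, 0 ≤ ν k := fun k => by
    rw [hν]
    exact mul_nonneg (by positivity) (hμ'pos _)
  have hc0 : 0 ≤ cc := hcc.1.le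
  have hc1 : cc ≤ 1 := hcc.2.le
  have hs1 : Summable ν := by
    refine ((summable_nat_add_iff 1).2 hμ'm1sum).congr fun k => ?_
    rw [hν]
    push_cast
    rfl
  have hs : Summable fun k => ν k * cc ^ k :=
    hs1.of_nonneg_of_le (fun k => mul_nonneg (hνnn k) (by positivity))
      fun k => mul_le_of_le_one_right (hνnn k) (pow_le_one₀ hc0 hc1)
  have hs' : Summable fun k : ℕ => ((k : ℝ) + 1) * ν (k + 1) * cc ^ k := by
    refine ((summable_nat_add_iff 2).2 hμ'm2sum).of_nonneg_of_le
      (fun k => mul_nonneg (mul_nonneg (by positivity) (hνnn _)) (by positivity)) fun k => ?_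
    refine (mul_le_of_le_one_right (mul_nonneg (by positivity) (hνnn _))
      (pow_le_one₀ hc0 hc1)).trans ?_
    rw [hν, ← mul_assoc]
    refine mul_le_mul_of_nonneg_right ?_ (hμ'pos _)
    push_cast
    nlinarith [(Nat.cast_nonneg k : (0 : ℝ) ≤ k)]
  have hpos : 0 < Gfun ν cc := by
    refine hs.tsum_pos (fun k => mul_nonneg (hνnn k) (by positivity)) 0 ?_
    simpa [hν] using hμ'1
  have hg : ∀ n : ℕ, ((PowerSeries.coeff n
      (PowerSeries.mk fun n => Real.toNNReal (ν n)) : NNReal) : ℝ) = ν n := fun n => by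
    rw [PowerSeries.coeff_mk, Real.coe_toNNReal _ (hνnn n)]
  have hclock := Smoluchowski.tendsto_clock hc hν hg hc0 hc1 hs hs' hcceq hpos
  rw [← hβ] at hclock
  have hlim := Smoluchowski.tendsto_monodisperse hc hν hg hclock
  refine ⟨fun a m hm => ?_, fun a m hm => ?_⟩
  · obtain ⟨k, rfl⟩ := Nat.exists_eq_add_of_le' hm
    exact ⟨_, hlim a k⟩
  · obtain ⟨k, rfl⟩ := Nat.exists_eq_add_of_le' hm
    convert hlim a (k + 1) using 3
    rw [Smoluchowski.solutionCoeff_zero_succ hg, show k + 2 - 1 = k + 1 by omega,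
      Nat.add_sub_cancel]
    push_cast
    rw [show (k : ℝ) + 2 - 1 = k + 1 by ring]
    ring
end

section
/- Well-posedness of the post-gelation equation for Q: let μ be a probability measure on ℕ with 0 < m₁^μ, m₂^μ < ∞, m₂^μ > m₁^μ, and μ(k) > 0 for some k ≥ 3, and let ν = μ̂. Then for every t ≥ T_gel the equation (x − e^{−t})·G_ν'(x) = G_ν(x) has a unique solution x = Q(t) in the interval (e^{−t}, 1]; moreover Q(T_gel) = 1, and the function Q, extended by Q(t) = 1 for 0 ≤ t < T_gel, is continuous on [0,∞). -/
open Set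

/-- First factorial moment m₁ = ∑ k μ(k). -/
noncomputable def fm1 (μ : ℕ → ℝ) : ℝ := ∑' k : ℕ, (k : ℝ) * μ k

/-- Second factorial moment m₂ = ∑ k(k-1) μ(k). -/
noncomputable def fm2 (μ : ℕ → ℝ) : ℝ := ∑' k : ℕ, (k : ℝ) * ((k : ℝ) - 1) * μ k

/-- Size-biased, shifted-by-one law μ̂. -/
noncomputable def hatMu (μ : ℕ → ℝ) (k : ℕ) : ℝ := ((k : ℝ) + 1) * μ (k + 1) / fm1 μ

/-- Gelation time T_gel = - log (1 - m₁/m₂). -/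
noncomputable def Tgel (μ : ℕ → ℝ) : ℝ := - Real.log (1 - fm1 μ / fm2 μ)

/-- A coefficientwise form of convexity of the monomials. -/
lemma pow_succ_sub_pow_succ_le {x y : ℝ} (hx : 0 ≤ x) (hxy : x ≤ y) (k : ℕ) :
    y ^ (k + 1) - x ^ (k + 1) ≤ ((k : ℝ) + 1) * y ^ k * (y - x) := by
  induction k with
  | zero => simp
  | succ k ih =>
    have h1 : y * (y ^ (k + 1) - x ^ (k + 1)) ≤ y * (((k : ℝ) + 1) * y ^ k * (y - x)) :=
      mul_le_mul_of_nonneg_left ih (hx.trans hxy)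
    have h2 : x ^ (k + 1) * (y - x) ≤ y ^ (k + 1) * (y - x) :=
      mul_le_mul_of_nonneg_right (pow_le_pow_left₀ hx hxy _) (sub_nonneg.2 hxy)
    push_cast
    calc y ^ (k + 1 + 1) - x ^ (k + 1 + 1)
        = y * (y ^ (k + 1) - x ^ (k + 1)) + x ^ (k + 1) * (y - x) := by ring
      _ ≤ y * (((k : ℝ) + 1) * y ^ k * (y - x)) + y ^ (k + 1) * (y - x) := add_le_add h1 h2
      _ = _ := by ring

lemma summable_mul_pow {a : ℕ → ℝ} (ha : ∀ k, 0 ≤ a k) (hs : Summable a) {x : ℝ}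
    (hx : x ∈ Icc (0 : ℝ) 1) : Summable fun k => a k * x ^ k :=
  hs.of_nonneg_of_le (fun k => mul_nonneg (ha k) (pow_nonneg hx.1 k))
    fun k => mul_le_of_le_one_right (ha k) (pow_le_one₀ hx.1 hx.2)

lemma continuousOn_tsum_mul_pow {a : ℕ → ℝ} (ha : ∀ k, 0 ≤ a k) (hs : Summable a) :
    ContinuousOn (fun x : ℝ => ∑' k, a k * x ^ k) (Icc 0 1) := by
  refine continuousOn_tsum (fun k => by fun_prop) hs fun k x hx => ?_
  rw [Real.norm_of_nonneg (mul_nonneg (ha k) (pow_nonneg hx.1 k))]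
  exact mul_le_of_le_one_right (ha k) (pow_le_one₀ hx.1 hx.2)

lemma strictMonoOn_tsum_mul_pow {a : ℕ → ℝ} (ha : ∀ k, 0 ≤ a k) (hs : Summable a)
    {j : ℕ} (hj : j ≠ 0) (haj : 0 < a j) :
    StrictMonoOn (fun x : ℝ => ∑' k, a k * x ^ k) (Icc 0 1) := fun _ hx _ hy hxy =>
  Summable.tsum_lt_tsum (i := j)
    (fun k => mul_le_mul_of_nonneg_left (pow_le_pow_left₀ hx.1 hxy.le k) (ha k))
    (mul_lt_mul_of_pos_left (pow_lt_pow_left₀ hxy hx.1 hj) haj)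
    (summable_mul_pow ha hs hx) (summable_mul_pow ha hs hy)

/-- The generating function lies above its tangents, written with the derivative series. -/
lemma Gfun_sub_le {ν : ℕ → ℝ} (hν : ∀ k, 0 ≤ ν k) (hs : Summable ν)
    (hs' : Summable fun k : ℕ => ((k : ℝ) + 1) * ν (k + 1)) {x y : ℝ}
    (hx : x ∈ Icc (0 : ℝ) 1) (hy : y ∈ Icc (0 : ℝ) 1) (hxy : x ≤ y) :
    Gfun ν y - Gfun ν x ≤ (y - x) * Gder ν y := by
  have hsx := summable_mul_pow hν hs hx
  have hsy := summable_mul_pow hν hs hy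
  have hsd := summable_mul_pow (fun k => mul_nonneg (by positivity) (hν (k + 1))) hs' hy
  unfold Gfun Gder
  rw [hsx.tsum_eq_zero_add, hsy.tsum_eq_zero_add, ← tsum_mul_left, pow_zero, pow_zero,
    add_sub_add_left_eq_sub]
  have hsx1 := (summable_nat_add_iff 1).2 hsx
  have hsy1 := (summable_nat_add_iff 1).2 hsy
  rw [← hsy1.tsum_sub hsx1]
  refine Summable.tsum_le_tsum (fun k => ?_) (hsy1.sub hsx1) (hsd.mul_left _)
  have := mul_le_mul_of_nonneg_left (pow_succ_sub_pow_succ_le hx.1 hxy k) (hν (k + 1))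
  linarith

/-- If `(x - s) * D x ≥ G x`, then the strict inequality holds at every later point. -/
lemma lt_of_le_of_tangent {G D : ℝ → ℝ} (hD : StrictMonoOn D (Icc 0 1))
    (hGD : ∀ x ∈ Icc (0 : ℝ) 1, ∀ y ∈ Icc (0 : ℝ) 1, x ≤ y → G y - G x ≤ (y - x) * D y)
    {s x y : ℝ} (hs : 0 ≤ s) (hsx : s < x) (hxy : x < y) (hy : y ≤ 1)
    (h : G x ≤ (x - s) * D x) : G y < (y - s) * D y := by
  have hxm : x ∈ Icc (0 : ℝ) 1 := ⟨by linarith, by linarith⟩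
  have hym : y ∈ Icc (0 : ℝ) 1 := ⟨by linarith, hy⟩
  have h1 := hGD x hxm y hym hxy.le
  have h2 := mul_lt_mul_of_pos_left (hD hxm hym hxy) (sub_pos.2 hsx)
  linarith

lemma existsUnique_mul_eq {G D : ℝ → ℝ} (hGc : ContinuousOn G (Icc 0 1))
    (hDc : ContinuousOn D (Icc 0 1)) (hD : StrictMonoOn D (Icc 0 1))
    (hG : ∀ x ∈ Ioc (0 : ℝ) 1, 0 < G x)
    (hGD : ∀ x ∈ Icc (0 : ℝ) 1, ∀ y ∈ Icc (0 : ℝ) 1, x ≤ y → G y - G x ≤ (y - x) * D y)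
    {s : ℝ} (hs : 0 < s) (hs1 : s ≤ 1) (h1 : G 1 ≤ (1 - s) * D 1) :
    ∃! x : ℝ, x ∈ Ioc s 1 ∧ (x - s) * D x = G x := by
  have hsub : Icc s 1 ⊆ Icc 0 1 := Icc_subset_Icc_left hs.le
  have hc : ContinuousOn (fun x => (x - s) * D x - G x) (Icc s 1) :=
    ((continuousOn_id.sub continuousOn_const).mul (hDc.mono hsub)).sub (hGc.mono hsub)
  have hGs := hG s ⟨hs, hs1⟩
  obtain ⟨x, hx, hx0⟩ := intermediate_value_Icc hs1 hc
    (show (0 : ℝ) ∈ Icc _ _ from ⟨by simpa using hGs.le, by linarith⟩)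
  have hxe : (x - s) * D x = G x := by linarith [show (x - s) * D x - G x = 0 from hx0]
  have hxs : s < x := hx.1.lt_of_ne fun h => by
    rw [← h] at hxe
    simp only [sub_self, zero_mul] at hxe
    linarith
  refine ⟨x, ⟨⟨hxs, hx.2⟩, hxe⟩, fun y ⟨hy, hye⟩ => ?_⟩
  rcases lt_trichotomy y x with h | h | h
  · exact absurd (lt_of_le_of_tangent hD hGD hs.le hy.1 h hx.2 hye.ge) hxe.not_gt
  · exact h
  · exact absurd (lt_of_le_of_tangent hD hGD hs.le hxs h hy.2 hxe.ge) hye.not_gt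

/-- Solutions of `(x - s) * D x = G x` depend continuously on the parameter `s`. -/
lemma continuous_of_mul_eq {X : Type*} [TopologicalSpace X] {G D : ℝ → ℝ}
    (hD : StrictMonoOn D (Icc 0 1))
    (hGD : ∀ x ∈ Icc (0 : ℝ) 1, ∀ y ∈ Icc (0 : ℝ) 1, x ≤ y → G y - G x ≤ (y - x) * D y)
    {s q : X → ℝ} (hsc : Continuous s) (hs : ∀ t, 0 < s t)
    (hq : ∀ t, q t ∈ Ioc (s t) 1 ∧ (q t - s t) * D (q t) = G (q t)) : Continuous q := by
  refine continuous_iff_continuousAt.2 fun t₀ => tendsto_order.2 ⟨fun a ha => ?_, fun b hb => ?_⟩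
  · obtain ⟨x, hx, hxq⟩ := exists_between (max_lt ha (hq t₀).1.1)
    have hlt : (x - s t₀) * D x < G x := by
      by_contra! h
      exact absurd (lt_of_le_of_tangent hD hGD (hs t₀).le ((le_max_right _ _).trans_lt hx) hxq
        (hq t₀).1.2 h) (hq t₀).2.not_gt
    have hc : Continuous fun t => (x - s t) * D x := by fun_prop
    filter_upwards [hc.continuousAt.eventually_lt_const hlt] with t ht
    refine ((le_max_left _ _).trans_lt hx).trans ?_
    by_contra! h
    rcases h.eq_or_lt with h | h
    · exact absurd (h ▸ (hq t).2) ht.ne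
    · exact absurd (lt_of_le_of_tangent hD hGD (hs t).le (hq t).1.1 h
        (hxq.le.trans (hq t₀).1.2) (hq t).2.ge) ht.not_gt
  · rcases lt_or_ge 1 b with h1 | h1
    · exact .of_forall fun t => (hq t).1.2.trans_lt h1
    have hlt := lt_of_le_of_tangent hD hGD (hs t₀).le (hq t₀).1.1 hb h1 (hq t₀).2.ge
    have hc : Continuous fun t => (b - s t) * D b := by fun_prop
    filter_upwards [hc.continuousAt.eventually_const_lt hlt,
      hsc.continuousAt.eventually_lt_const ((hq t₀).1.1.trans hb)] with t ht hst
    by_contra! h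
    rcases h.eq_or_lt with h | h
    · exact absurd (h ▸ (hq t).2) ht.ne'
    · exact absurd (lt_of_le_of_tangent hD hGD (hs t).le hst h (hq t).1.2 ht.le) (hq t).2.not_gt

lemma hasSum_hatMu {μ : ℕ → ℝ} (hm1sum : Summable fun k : ℕ => (k : ℝ) * μ k)
    (hm1 : fm1 μ ≠ 0) : HasSum (hatMu μ) 1 := by
  have h := (hasSum_nat_add_iff' 1).2 hm1sum.hasSum
  have h' := h.div_const (fm1 μ)
  simp only [Finset.range_one, Finset.sum_singleton, Nat.cast_zero, zero_mul, sub_zero,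
    Nat.cast_add, Nat.cast_one] at h'
  rwa [show (∑' k : ℕ, (k : ℝ) * μ k) / fm1 μ = 1 from div_self hm1] at h'

lemma hasSum_succ_mul_hatMu {μ : ℕ → ℝ}
    (hm2sum : Summable fun k : ℕ => (k : ℝ) * ((k : ℝ) - 1) * μ k) :
    HasSum (fun k : ℕ => ((k : ℝ) + 1) * hatMu μ (k + 1)) (fm2 μ / fm1 μ) := by
  have h := ((hasSum_nat_add_iff' 2).2 hm2sum.hasSum).div_const (fm1 μ)
  simp only [Finset.sum_range_succ, Finset.range_zero, Finset.sum_empty, Nat.cast_zero, zero_mul,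
    Nat.cast_one, sub_self, mul_zero, add_zero, sub_zero] at h
  have hterm (k : ℕ) : ((k : ℝ) + 1) * hatMu μ (k + 1) =
      ((k + 2 : ℕ) : ℝ) * (((k + 2 : ℕ) : ℝ) - 1) * μ (k + 2) / fm1 μ := by
    unfold hatMu
    push_cast
    ring
  simp only [hterm]
  exact h

/-- well-posedness of the post-gelation equation for Q. -/
theorem stmt7
    (μ : ℕ → ℝ) (hμ : ∀ k, 0 ≤ μ k) (hsum : Summable μ) (hprob : ∑' k : ℕ, μ k = 1)
    (hm1sum : Summable (fun k : ℕ => (k : ℝ) * μ k))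
    (hm2sum : Summable (fun k : ℕ => (k : ℝ) * ((k : ℝ) - 1) * μ k))
    (hm1 : 0 < fm1 μ) (hm12 : fm1 μ < fm2 μ)
    (h3 : ∃ k : ℕ, 3 ≤ k ∧ 0 < μ k) :
    (∀ t : ℝ, Tgel μ ≤ t →
        ∃! x : ℝ, x ∈ Ioc (Real.exp (-t)) 1 ∧
          (x - Real.exp (-t)) * Gder (hatMu μ) x = Gfun (hatMu μ) x) ∧
    ∃ Q : ℝ → ℝ,
      (∀ t : ℝ, 0 ≤ t → t < Tgel μ → Q t = 1) ∧
      (∀ t : ℝ, Tgel μ ≤ t → Q t ∈ Ioc (Real.exp (-t)) 1 ∧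
        (Q t - Real.exp (-t)) * Gder (hatMu μ) (Q t) = Gfun (hatMu μ) (Q t)) ∧
      Q (Tgel μ) = 1 ∧ ContinuousOn Q (Ici 0) := by
  have hν : ∀ k, 0 ≤ hatMu μ k := fun k =>
    div_nonneg (mul_nonneg (by positivity) (hμ _)) hm1.le
  have hν1 := hasSum_hatMu hm1sum hm1.ne'
  have hν2 := hasSum_succ_mul_hatMu hm2sum
  have hν' : ∀ k : ℕ, 0 ≤ ((k : ℝ) + 1) * hatMu μ (k + 1) := fun k =>
    mul_nonneg (by positivity) (hν _)
  obtain ⟨j, hjpos⟩ : ∃ j, 0 < hatMu μ (j + 2) := by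
    obtain ⟨k, hk, hk0⟩ := h3
    obtain ⟨j, rfl⟩ := Nat.exists_eq_add_of_le' hk
    exact ⟨j, div_pos (mul_pos (by positivity) hk0) hm1⟩
  have hGc : ContinuousOn (Gfun (hatMu μ)) (Icc 0 1) := continuousOn_tsum_mul_pow hν hν1.summable
  have hDc : ContinuousOn (Gder (hatMu μ)) (Icc 0 1) := continuousOn_tsum_mul_pow hν' hν2.summable
  have hD : StrictMonoOn (Gder (hatMu μ)) (Icc 0 1) :=
    strictMonoOn_tsum_mul_pow hν' hν2.summable j.succ_ne_zero (mul_pos (by positivity) hjpos)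
  have hG : ∀ x ∈ Ioc (0 : ℝ) 1, 0 < Gfun (hatMu μ) x := fun x hx =>
    (summable_mul_pow hν hν1.summable ⟨hx.1.le, hx.2⟩).tsum_pos
      (fun k => mul_nonneg (hν k) (pow_nonneg hx.1.le k)) (j + 2) (mul_pos hjpos (pow_pos hx.1 _))
  have hGD : ∀ x ∈ Icc (0 : ℝ) 1, ∀ y ∈ Icc (0 : ℝ) 1, x ≤ y →
      Gfun (hatMu μ) y - Gfun (hatMu μ) x ≤ (y - x) * Gder (hatMu μ) y :=
    fun x hx y hy hxy => Gfun_sub_le hν hν1.summable hν2.summable hx hy hxy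
  have hG1 : Gfun (hatMu μ) 1 = 1 := by simpa [Gfun] using hν1.tsum_eq
  have hD1 : Gder (hatMu μ) 1 = fm2 μ / fm1 μ := by simpa [Gder] using hν2.tsum_eq
  have hm2 : 0 < fm2 μ := hm1.trans hm12
  have hratio : fm1 μ / fm2 μ < 1 := (div_lt_one hm2).2 hm12
  have hT : Real.exp (-Tgel μ) = 1 - fm1 μ / fm2 μ := by
    rw [Tgel, neg_neg, Real.exp_log (by linarith)]
  have hratio0 : 0 < fm1 μ / fm2 μ := div_pos hm1 hm2
  have hroot : (1 - Real.exp (-Tgel μ)) * Gder (hatMu μ) 1 = Gfun (hatMu μ) 1 := by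
    rw [hT, hG1, hD1]
    field_simp
    ring
  have hD1pos : 0 < Gder (hatMu μ) 1 := hD1 ▸ div_pos hm2 hm1
  have hex : ∀ t : ℝ, Tgel μ ≤ t → ∃! x : ℝ, x ∈ Ioc (Real.exp (-t)) 1 ∧
      (x - Real.exp (-t)) * Gder (hatMu μ) x = Gfun (hatMu μ) x := fun t ht => by
    have hle : Real.exp (-t) ≤ Real.exp (-Tgel μ) := Real.exp_le_exp.2 (neg_le_neg ht)
    refine existsUnique_mul_eq hGc hDc hD hG hGD (Real.exp_pos _) (by linarith) ?_
    rw [← hroot]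
    exact mul_le_mul_of_nonneg_right (by linarith) hD1pos.le
  refine ⟨hex, ?_⟩
  choose q hq using fun t : ℝ => (hex (max t (Tgel μ)) (le_max_right _ _)).exists
  have hq1 : ∀ t ≤ Tgel μ, q t = 1 := fun t ht => by
    have hqt := hq t
    rw [max_eq_right ht] at hqt
    exact (hex _ le_rfl).unique hqt ⟨⟨by linarith, le_rfl⟩, hroot⟩
  refine ⟨q, fun t _ ht => hq1 t ht.le, fun t ht => ?_, hq1 _ le_rfl, Continuous.continuousOn ?_⟩
  · have hqt := hq t
    rwa [max_eq_left ht] at hqt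
  · exact continuous_of_mul_eq hD hGD (by fun_prop) (fun t => Real.exp_pos _) hq
end
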